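/- arXiv:2405.04728 — 7 statements merged into one kernel-verified Lean document; each statement's English description precedes it below -/
import Mathlib

section
/- Let t ≥ 4 be a rational number, let G be a t-tough graph on n ≥ 3 vertices, and let x, y be two distinct nonadjacent vertices of G with deg(x) + deg(y) ≥ n − t. Then G is Hamiltonian if and only if the graph G + xy, obtained from G by adding the edge xy, is Hamiltonian. -/
/-- A graph `G` is `t`-tough if `|S| ≥ t · c(G − S)` for every vertex subset `S`
whose removal leaves at least two connected components. -/
def SimpleGraph.Tough {V : Type*} [Fintype V] (t : ℚ) (G : SimpleGraph V) : Prop :=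
  ∀ S : Finset V,
    2 ≤ Nat.card ((G.induce ((↑S : Set V)ᶜ)).ConnectedComponent) →
    t * (Nat.card ((G.induce ((↑S : Set V)ᶜ)).ConnectedComponent) : ℚ) ≤ (S.card : ℚ)

namespace SimpleGraph

/-- The vertices `v 1, …, v n` are distinct and consecutive ones are adjacent. -/
structure IsPathSeq {V : Type*} (G : SimpleGraph V) (n : ℕ) (v : ℕ → V) : Prop where
  inj : ∀ i j, 1 ≤ i → i ≤ n → 1 ≤ j → j ≤ n → v i = v j → i = j
  adj : ∀ i, 1 ≤ i → i < n → G.Adj (v i) (v (i + 1))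

namespace IsPathSeq

variable {V : Type*} {G : SimpleGraph V} {n : ℕ} {v : ℕ → V}

lemma mono {H : SimpleGraph V} (h : G.IsPathSeq n v) (hH : ∀ i, 1 ≤ i → i < n →
    H.Adj (v i) (v (i + 1))) : H.IsPathSeq n v :=
  ⟨h.inj, hH⟩

lemma reverse (h : G.IsPathSeq n v) : G.IsPathSeq n (fun i => v (n + 1 - i)) where
  inj i j hi hi' hj hj' hij := by
    have := h.inj _ _ (by omega) (by omega) (by omega) (by omega) hij
    omega
  adj i hi hi' := by
    have := h.adj (n - i) (by omega) (by omega)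
    rw [show n + 1 - i = n - i + 1 by omega, show n + 1 - (i + 1) = n - i by omega]
    exact this.symm

lemma exists_eq [Fintype V] (h : G.IsPathSeq n v) (hn : Fintype.card V = n) (u : V) :
    ∃ i, 1 ≤ i ∧ i ≤ n ∧ v i = u := by
  classical
  have hinj : Set.InjOn v (Finset.Icc 1 n : Finset ℕ) := fun i hi j hj hij => by
    simp only [Finset.coe_Icc, Set.mem_Icc] at hi hj
    exact h.inj i j hi.1 hi.2 hj.1 hj.2 hij
  have himg : (Finset.Icc 1 n).image v = Finset.univ := by
    rw [← Finset.card_eq_iff_eq_univ, Finset.card_image_of_injOn hinj, hn]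
    simp
  have hu : u ∈ (Finset.Icc 1 n).image v := himg ▸ Finset.mem_univ u
  simpa [and_assoc] using hu

lemma exists_walk (h : G.IsPathSeq n v) (m : ℕ) (hm : m + 1 ≤ n) :
    ∃ p : G.Walk (v 1) (v (m + 1)), p.IsPath ∧ p.length = m ∧
      ∀ u ∈ p.support, ∃ i, 1 ≤ i ∧ i ≤ m + 1 ∧ u = v i := by
  induction m with
  | zero => exact ⟨.nil, .nil, rfl, fun u hu => ⟨1, le_rfl, le_rfl, by simpa using hu⟩⟩
  | succ m ih =>
    obtain ⟨p, hp, hl, hs⟩ := ih (by omega)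
    have hadj := h.adj (m + 1) (by omega) (by omega)
    refine ⟨p.concat hadj, hp.concat ?_ hadj, by simp [hl], fun u hu => ?_⟩
    · intro hmem
      obtain ⟨i, hi, hi', he⟩ := hs _ hmem
      have := h.inj _ _ (by omega) (by omega) hi (by omega) he
      omega
    · rw [Walk.support_concat, List.mem_append, List.mem_singleton] at hu
      obtain hu | rfl := hu
      · obtain ⟨i, hi, hi', he⟩ := hs _ hu
        exact ⟨i, hi, by omega, he⟩
      · exact ⟨m + 1 + 1, by omega, le_rfl, rfl⟩

lemma isHamiltonian [Fintype V] [DecidableEq V] (h : G.IsPathSeq n v)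
    (hn : Fintype.card V = n) (hn3 : 3 ≤ n) (hclose : G.Adj (v n) (v 1)) :
    G.IsHamiltonian := by
  intro _
  obtain ⟨m, rfl⟩ : ∃ m, n = m + 1 := ⟨n - 1, by omega⟩
  obtain ⟨p, hp, hl, -⟩ := h.exists_walk m le_rfl
  refine ⟨_, .cons hclose p, ?_⟩
  rw [Walk.isHamiltonianCycle_iff_isCycle_and_length_eq, Walk.isCycle_iff_isPath_tail_and_le_length]
  simp only [Walk.length_cons, hl]
  exact ⟨⟨by simpa using hp, hn3⟩, hn.symm⟩

/-- Rearranging a path sequence into a closed spanning sequence. -/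
lemma isHamiltonian_of_rearrange [Fintype V] [DecidableEq V] (h : G.IsPathSeq n v)
    (hn : Fintype.card V = n) (hn3 : 3 ≤ n) (f : ℕ → ℕ)
    (hf : ∀ i, 1 ≤ i → i ≤ n → 1 ≤ f i ∧ f i ≤ n)
    (hinj : ∀ i j, 1 ≤ i → i < j → j ≤ n → f i ≠ f j)
    (hadj : ∀ i, 1 ≤ i → i < n → G.Adj (v (f i)) (v (f (i + 1))))
    (hclose : G.Adj (v (f n)) (v (f 1))) : G.IsHamiltonian := by
  refine IsPathSeq.isHamiltonian (v := fun i => v (f i)) ⟨fun i j hi hi' hj hj' hij => ?_, hadj⟩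
    hn hn3 hclose
  have := h.inj _ _ (hf i hi hi').1 (hf i hi hi').2 (hf j hj hj').1 (hf j hj hj').2 hij
  obtain hlt | heq | hlt := lt_trichotomy i j
  · exact absurd this (hinj i j hi hlt hj')
  · exact heq
  · exact absurd this.symm (hinj j i hj hlt hi')

end IsPathSeq

lemma IsHamiltonian.exists_isPathSeq {V : Type*} [Fintype V] [DecidableEq V] {G : SimpleGraph V}
    {n : ℕ} (hG : G.IsHamiltonian) (hn : Fintype.card V = n) (hn3 : 3 ≤ n) :
    ∃ v : ℕ → V, G.IsPathSeq n v ∧ G.Adj (v n) (v 1) := by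
  obtain ⟨a, p, hp⟩ := hG (by omega)
  have hl : p.length = n := hp.length_eq.trans hn
  refine ⟨p.getVert, ⟨fun i j hi hi' hj hj' hij =>
    hp.isCycle.getVert_injOn ⟨hi, by omega⟩ ⟨hj, by omega⟩ hij,
    fun i _ hi' => p.adj_getVert_succ (by omega)⟩, ?_⟩
  have hstart := p.adj_getVert_succ (i := 0) (by omega)
  have hlast : p.getVert n = p.getVert 0 := by rw [← hl, p.getVert_length, p.getVert_zero]
  rwa [hlast]

/-- A Hamiltonian cycle of `G + xy` that uses `xy` leaves a spanning path from `x` to `y`. -/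
lemma exists_isPathSeq_of_isHamiltonian_sup {V : Type*} [Fintype V] [DecidableEq V]
    {G : SimpleGraph V} {n : ℕ} {x y : V} (hn : Fintype.card V = n) (hn3 : 3 ≤ n)
    (hG : ¬ G.IsHamiltonian) (hxy : (G ⊔ fromEdgeSet {s(x, y)}).IsHamiltonian) :
    ∃ v : ℕ → V, G.IsPathSeq n v ∧ v 1 = x ∧ v n = y := by
  obtain ⟨w, hw, hclose⟩ := hxy.exists_isPathSeq hn hn3
  have hstep : ∀ a b, (G ⊔ fromEdgeSet {s(x, y)}).Adj a b → ¬ G.Adj a b →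
      (a = x ∧ b = y) ∨ (a = y ∧ b = x) := by
    intro a b hab hnot
    simp only [sup_adj, fromEdgeSet_adj, Set.mem_singleton_iff] at hab
    simpa using (hab.resolve_left hnot).1
  have key : ∀ u : ℕ → V, (G ⊔ fromEdgeSet {s(x, y)}).IsPathSeq n u →
      (G ⊔ fromEdgeSet {s(x, y)}).Adj (u n) (u 1) → ¬ G.Adj (u n) (u 1) →
      ∃ v : ℕ → V, G.IsPathSeq n v ∧ v 1 = x ∧ v n = y := by
    intro u hu hc hc'
    have hends := hstep _ _ hc hc'
    have hGu : G.IsPathSeq n u := hu.mono fun i hi hi' => by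
      by_contra hnot
      have hi2 := hstep _ _ (hu.adj i hi hi') hnot
      have h1 : ∀ j, 1 ≤ j → j ≤ n → u j = u 1 → j = 1 :=
        fun j hj hj' he => hu.inj _ _ hj hj' le_rfl (by omega) he
      have h2 : ∀ j, 1 ≤ j → j ≤ n → u j = u n → j = n :=
        fun j hj hj' he => hu.inj _ _ hj hj' (by omega) le_rfl he
      have hn1 : u n ≠ u 1 := hc.ne
      have e1 := h1 i hi hi'.le
      have e2 := h1 (i + 1) (by omega) hi'
      have e3 := h2 i hi hi'.le
      have e4 := h2 (i + 1) (by omega) hi'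
      rcases hends with ⟨a, b⟩ | ⟨a, b⟩ <;> rcases hi2 with ⟨c, d⟩ | ⟨c, d⟩ <;>
        simp only [a, b, c, d, forall_const] at e1 e2 e3 e4 <;> omega
    obtain ⟨hy, hx⟩ | ⟨hy, hx⟩ := hends
    · exact ⟨_, hGu.reverse, by simpa using hy, by simpa using hx⟩
    · exact ⟨u, hGu, hx, hy⟩
  by_cases hc' : G.Adj (w n) (w 1)
  · have : ∃ i, 1 ≤ i ∧ i < n ∧ ¬ G.Adj (w i) (w (i + 1)) := by
      by_contra! hall
      exact hG ((hw.mono hall).isHamiltonian hn hn3 hc')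
    obtain ⟨i, hi, hi', hnot⟩ := this
    refine key (fun j => if i + j ≤ n then w (i + j) else w (i + j - n)) ⟨?_, ?_⟩ ?_ ?_
    · intro j k hj hj' hk hk' he
      split_ifs at he <;>
        have := hw.inj _ _ (by omega) (by omega) (by omega) (by omega) he <;> omega
    · intro j hj hj'
      split_ifs with h1 h2 h2
      · exact hw.adj (i + j) (by omega) (by omega)
      · rw [show i + j = n by omega, show i + (j + 1) - n = 1 by omega]
        exact hclose
      · omega
      · rw [show i + (j + 1) - n = i + j - n + 1 by omega]
        exact hw.adj (i + j - n) (by omega) (by omega)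
    · rw [if_neg (by omega), if_pos (by omega), Nat.add_sub_cancel]
      exact hw.adj i hi hi'
    · rw [if_neg (by omega), if_pos (by omega), Nat.add_sub_cancel]
      exact hnot
  · exact key w hw hclose hc'

namespace IsPathSeq

variable {V : Type*} [Fintype V] [DecidableEq V] {G : SimpleGraph V} {n : ℕ} {v : ℕ → V}

lemma adj_of_consecutive {V : Type*} {G : SimpleGraph V} {n : ℕ} {v : ℕ → V}
    (h : G.IsPathSeq n v) (p q : ℕ) (hp : 1 ≤ p) (hp' : p ≤ n) (hq : 1 ≤ q) (hq' : q ≤ n)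
    (hpq : p + 1 = q ∨ q + 1 = p) : G.Adj (v p) (v q) := by
  obtain rfl | rfl := hpq
  exacts [h.adj _ hp hq', (h.adj _ hq hp').symm]

/-- The cycle `v 1, …, v i, v n, …, v (i + 1)`. -/
lemma isHamiltonian_of_crossing (h : G.IsPathSeq n v) (hn : Fintype.card V = n) (hn3 : 3 ≤ n)
    {i : ℕ} (hi : 1 ≤ i) (hin : i < n) (hx : G.Adj (v 1) (v (i + 1)))
    (hy : G.Adj (v n) (v i)) : G.IsHamiltonian := by
  refine h.isHamiltonian_of_rearrange hn hn3
    (fun j => if j ≤ i then j else n + i + 1 - j) ?_ ?_ ?_ ?_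
  · intro j hj hj'
    split_ifs <;> omega
  · intro j k hj hjk hk
    split_ifs <;> omega
  · intro j hj hj'
    split_ifs <;> first
      | omega
      | exact h.adj_of_consecutive _ _ (by omega) (by omega) (by omega) (by omega) (by omega)
      | (convert hy.symm using 2 <;> omega)
  · split_ifs <;> first
      | omega
      | (convert hx.symm using 2 <;> omega)

/-- The cycle `v i, …, v 1, v (i + 1), …, v q, v n, …, v (q + 1)`. -/
lemma isHamiltonian_of_outer_chord (h : G.IsPathSeq n v) (hn : Fintype.card V = n) (hn3 : 3 ≤ n)
    {i q : ℕ} (hi : 1 ≤ i) (hiq : i < q) (hq : q < n) (hx : G.Adj (v 1) (v (i + 1)))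
    (hy : G.Adj (v n) (v q)) (hc : G.Adj (v i) (v (q + 1))) : G.IsHamiltonian := by
  refine h.isHamiltonian_of_rearrange hn hn3
    (fun j => if j ≤ i then i + 1 - j else if j ≤ q then j else n + q + 1 - j) ?_ ?_ ?_ ?_
  · intro j hj hj'
    split_ifs <;> omega
  · intro j k hj hjk hk
    split_ifs <;> omega
  · intro j hj hj'
    split_ifs <;> first
      | omega
      | exact h.adj_of_consecutive _ _ (by omega) (by omega) (by omega) (by omega) (by omega)
      | (convert hx using 2 <;> omega)
      | (convert hy.symm using 2 <;> omega)
  · split_ifs <;> first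
      | omega
      | (convert hc.symm using 2 <;> omega)

/-- The cycle `v 1, …, v p, v s, …, v (p + 1), v n, …, v (s + 1)`. -/
lemma isHamiltonian_of_inner_chord (h : G.IsPathSeq n v) (hn : Fintype.card V = n) (hn3 : 3 ≤ n)
    {p s : ℕ} (hp : 1 ≤ p) (hps : p < s) (hs : s < n) (hx : G.Adj (v 1) (v (s + 1)))
    (hy : G.Adj (v n) (v (p + 1))) (hc : G.Adj (v p) (v s)) : G.IsHamiltonian := by
  refine h.isHamiltonian_of_rearrange hn hn3
    (fun j => if j ≤ p then j else if j ≤ s then s + p + 1 - j else n + s + 1 - j) ?_ ?_ ?_ ?_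
  · intro j hj hj'
    split_ifs <;> omega
  · intro j k hj hjk hk
    split_ifs <;> omega
  · intro j hj hj'
    split_ifs <;> first
      | omega
      | exact h.adj_of_consecutive _ _ (by omega) (by omega) (by omega) (by omega) (by omega)
      | (convert hc using 2 <;> omega)
      | (convert hy.symm using 2 <;> omega)
  · split_ifs <;> first
      | omega
      | (convert hx.symm using 2 <;> omega)

/-- The cycle `v 1, …, v l, v s, …, v k, v (l + 1), …, v (k - 1), v n, …, v (s + 1)`. -/
lemma isHamiltonian_of_nested_chords (h : G.IsPathSeq n v) (hn : Fintype.card V = n) (hn3 : 3 ≤ n)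
    {l k s : ℕ} (hl : 1 ≤ l) (hlk : l + 1 < k) (hks : k ≤ s) (hs : s < n)
    (hx : G.Adj (v 1) (v (s + 1))) (hy : G.Adj (v n) (v (k - 1))) (hc : G.Adj (v l) (v s))
    (hc' : G.Adj (v (l + 1)) (v k)) : G.IsHamiltonian := by
  refine h.isHamiltonian_of_rearrange hn hn3
    (fun j => if j ≤ l then j else if j ≤ l + s + 1 - k then s + l + 1 - j else
      if j ≤ s then k + j - s - 1 else n + s + 1 - j) ?_ ?_ ?_ ?_
  · intro j hj hj'
    split_ifs <;> omega
  · intro j k hj hjk hk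
    split_ifs <;> omega
  · intro j hj hj'
    split_ifs <;> first
      | omega
      | exact h.adj_of_consecutive _ _ (by omega) (by omega) (by omega) (by omega) (by omega)
      | (convert hc using 2 <;> omega)
      | (convert hc'.symm using 2 <;> omega)
      | (convert hy.symm using 2 <;> omega)
  · split_ifs <;> first
      | omega
      | (convert hx.symm using 2 <;> omega)

/-- The cycle `v 1, …, v l, v s, …, v (l + 1), v k, …, v n, v (k - 1), …, v (s + 1)`. -/
lemma isHamiltonian_of_crossed_chords (h : G.IsPathSeq n v) (hn : Fintype.card V = n)
    (hn3 : 3 ≤ n) {l k s : ℕ} (hl : 1 ≤ l) (hls : l < s) (hsk : s + 1 < k) (hk : k ≤ n)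
    (hx : G.Adj (v 1) (v (s + 1))) (hy : G.Adj (v n) (v (k - 1))) (hc : G.Adj (v l) (v s))
    (hc' : G.Adj (v (l + 1)) (v k)) : G.IsHamiltonian := by
  refine h.isHamiltonian_of_rearrange hn hn3
    (fun j => if j ≤ l then j else if j ≤ s then s + l + 1 - j else
      if j ≤ n + s + 1 - k then k + j - s - 1 else n + s + 1 - j) ?_ ?_ ?_ ?_
  · intro j hj hj'
    split_ifs <;> omega
  · intro j k hj hjk hk
    split_ifs <;> omega
  · intro j hj hj'
    split_ifs <;> first
      | omega
      | exact h.adj_of_consecutive _ _ (by omega) (by omega) (by omega) (by omega) (by omega)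
      | (convert hc using 2 <;> omega)
      | (convert hc' using 2 <;> omega)
      | (convert hy using 2 <;> omega)
  · split_ifs <;> first
      | omega
      | (convert hx.symm using 2 <;> omega)

/-- The cycle `v 1, …, v q, v n, …, v l, v (q + 1), …, v (l - 1)`. -/
lemma isHamiltonian_of_chord_beyond (h : G.IsPathSeq n v) (hn : Fintype.card V = n) (hn3 : 3 ≤ n)
    {q l : ℕ} (hq : 1 ≤ q) (hql : q + 1 < l) (hl : l ≤ n)
    (hx : G.Adj (v 1) (v (l - 1))) (hy : G.Adj (v n) (v q)) (hc : G.Adj (v (q + 1)) (v l)) :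
    G.IsHamiltonian := by
  refine h.isHamiltonian_of_rearrange hn hn3
    (fun j => if j ≤ q then j else if j ≤ n + q + 1 - l then n + q + 1 - j else l + j - n - 1)
    ?_ ?_ ?_ ?_
  · intro j hj hj'
    split_ifs <;> omega
  · intro j k hj hjk hk
    split_ifs <;> omega
  · intro j hj hj'
    split_ifs <;> first
      | omega
      | exact h.adj_of_consecutive _ _ (by omega) (by omega) (by omega) (by omega) (by omega)
      | (convert hy.symm using 2 <;> omega)
      | (convert hc.symm using 2 <;> omega)
  · split_ifs <;> first
      | omega
      | (convert hx.symm using 2 <;> omega)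

/-- The cycle `v n, …, v (s + 1), v 1, …, v l, v (e + 1), …, v s, v e, …, v (l + 1)`. -/
lemma isHamiltonian_of_linked_chords (h : G.IsPathSeq n v) (hn : Fintype.card V = n) (hn3 : 3 ≤ n)
    {l e s : ℕ} (hl : 1 ≤ l) (hle : l < e) (hes : e < s) (hs : s < n)
    (hx : G.Adj (v 1) (v (s + 1))) (hy : G.Adj (v n) (v (l + 1))) (hc : G.Adj (v e) (v s))
    (hc' : G.Adj (v l) (v (e + 1))) : G.IsHamiltonian := by
  refine h.isHamiltonian_of_rearrange hn hn3
    (fun j => if j ≤ n - s then n + 1 - j else if j ≤ n - s + l then j - (n - s) else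
      if j ≤ n + l - e then e + j + s - n - l else n + l + 1 - j) ?_ ?_ ?_ ?_
  · intro j hj hj'
    split_ifs <;> omega
  · intro j k hj hjk hk
    split_ifs <;> omega
  · intro j hj hj'
    split_ifs <;> first
      | omega
      | exact h.adj_of_consecutive _ _ (by omega) (by omega) (by omega) (by omega) (by omega)
      | (convert hx.symm using 2 <;> omega)
      | (convert hc' using 2 <;> omega)
      | (convert hc.symm using 2 <;> omega)
  · split_ifs <;> first
      | omega
      | (convert hy.symm using 2 <;> omega)

lemma isHamiltonian_of_consecutive_chords (h : G.IsPathSeq n v) (hn : Fintype.card V = n)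
    (hn3 : 3 ≤ n) {l k s : ℕ} (hl : 1 ≤ l) (hls : l < s) (hs : s < n) (hlk : l + 1 < k)
    (hk : k ≤ n) (hx : G.Adj (v 1) (v (s + 1))) (hy : G.Adj (v n) (v (k - 1)))
    (hc : G.Adj (v l) (v s)) (hc' : G.Adj (v (l + 1)) (v k)) : G.IsHamiltonian := by
  obtain hks | rfl | hsk : k ≤ s ∨ k = s + 1 ∨ s + 1 < k := by omega
  · exact h.isHamiltonian_of_nested_chords hn hn3 hl hlk hks hs hx hy hc hc'
  · exact h.isHamiltonian_of_crossing hn hn3 (by omega) hs hx (by simpa using hy)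
  · exact h.isHamiltonian_of_crossed_chords hn hn3 hl hls hsk hk hx hy hc hc'

end IsPathSeq

/-- In a tough graph, deleting `S` leaves at most `|S| / t` components; the components are told
apart by a labelling that is constant along the edges of `G - S`. -/
lemma Tough.mul_card_le {V α : Type*} [Fintype V] {t : ℚ} {G : SimpleGraph V} (hG : G.Tough t)
    (ht : 0 ≤ t) (S I : Finset V) (c : V → α)
    (hc : ∀ u w, u ∉ S → w ∉ S → G.Adj u w → c u = c w) (hIS : ∀ u ∈ I, u ∉ S)
    (hI : Set.InjOn c I) (hcard : 2 ≤ I.card) : t * I.card ≤ S.card := by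
  classical
  set H := G.induce ((↑S : Set V)ᶜ) with hH
  have hreach : ∀ a b, H.Reachable a b → c a = c b := by
    rintro a b ⟨p⟩
    induction p with
    | nil => rfl
    | @cons a b _ hab _ ih => exact (hc _ _ a.2 b.2 hab).trans ih
  have hle : I.card ≤ Nat.card H.ConnectedComponent := by
    have hinj : Function.Injective
        (fun u : I => H.connectedComponentMk ⟨u.1, by simpa using hIS u.1 u.2⟩) :=
      fun u w he => Subtype.ext (hI u.2 w.2 (hreach _ _ (ConnectedComponent.exact he)))
    simpa using Nat.card_le_card_of_injective _ hinj
  have := hG S (hcard.trans hle)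
  refine le_trans (mul_le_mul_of_nonneg_left ?_ ht) this
  exact_mod_cast hle

lemma card_le_of_no_consecutive {S K M : Finset ℕ} (hS : ∀ l ∈ S, l ∈ M ∨ l + 1 ∈ K ∪ M)
    (hcons : ∀ l ∈ S, l + 1 ∉ S) : S.card ≤ K.card + M.card := by
  refine le_trans ?_ (Finset.card_union_le K M)
  refine Finset.card_le_card_of_injOn (fun l => if l ∈ M then l else l + 1) (fun l hl => ?_)
    fun l hl l' hl' he => ?_
  · simp only [Finset.mem_coe] at hl ⊢
    split_ifs with h
    · exact Finset.mem_union_right _ h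
    · exact (hS l hl).resolve_left h
  · simp only [Finset.mem_coe] at hl hl'
    dsimp only at he
    split_ifs at he
    · exact he
    · subst he
      exact absurd hl (hcons _ hl')
    · subst he
      exact absurd hl' (hcons _ hl)
    · omega

namespace IsPathSeq

section Indices

variable {V : Type*} (G : SimpleGraph V) (n : ℕ) (v : ℕ → V)

open Classical in
/-- Indices of predecessors of neighbours of `v 1`. -/
noncomputable def startIndices : Finset ℕ :=
  {i ∈ Finset.Icc 1 (n - 1) | G.Adj (v 1) (v (i + 1))}

open Classical in
/-- Indices of neighbours of `v n`. -/
noncomputable def endIndices : Finset ℕ :=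
  {i ∈ Finset.Icc 1 (n - 1) | G.Adj (v n) (v i)}

open Classical in
/-- Indices that are neither in `startIndices` nor in `endIndices`. -/
noncomputable def missingIndices : Finset ℕ :=
  {i ∈ Finset.Icc 1 (n - 1) | ¬ G.Adj (v 1) (v (i + 1)) ∧ ¬ G.Adj (v n) (v i)}

open Classical in
/-- Indices `k` such that `v (k - 1)` is a neighbour of `v n` and `v (k + 1)` one of `v 1`. -/
noncomputable def bypassedIndices : Finset ℕ :=
  {k ∈ Finset.Icc 2 (n - 1) | G.Adj (v n) (v (k - 1)) ∧ G.Adj (v 1) (v (k + 1))}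

end Indices

section Counting

variable {V : Type*} {G : SimpleGraph V} {n : ℕ} {v : ℕ → V}

lemma mem_startIndices {i : ℕ} : i ∈ startIndices G n v ↔
    (1 ≤ i ∧ i ≤ n - 1) ∧ G.Adj (v 1) (v (i + 1)) := by
  simp [startIndices]

lemma mem_endIndices {i : ℕ} : i ∈ endIndices G n v ↔
    (1 ≤ i ∧ i ≤ n - 1) ∧ G.Adj (v n) (v i) := by
  simp [endIndices]

lemma mem_missingIndices {i : ℕ} : i ∈ missingIndices G n v ↔
    (1 ≤ i ∧ i ≤ n - 1) ∧ ¬ G.Adj (v 1) (v (i + 1)) ∧ ¬ G.Adj (v n) (v i) := by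
  simp [missingIndices]

lemma mem_bypassedIndices {k : ℕ} : k ∈ bypassedIndices G n v ↔
    (2 ≤ k ∧ k ≤ n - 1) ∧ G.Adj (v n) (v (k - 1)) ∧ G.Adj (v 1) (v (k + 1)) := by
  simp [bypassedIndices]

variable [Fintype V]

lemma card_startIndices [DecidableRel G.Adj] (h : G.IsPathSeq n v) (hn : Fintype.card V = n) :
    (startIndices G n v).card = G.degree (v 1) := by
  classical
  rw [← card_neighborFinset_eq_degree]
  refine Finset.card_bij (fun i _ => v (i + 1)) (fun i hi => ?_) (fun i hi j hj he => ?_)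
    fun u hu => ?_
  · rw [mem_neighborFinset]
    exact (mem_startIndices.1 hi).2
  · have hi := (mem_startIndices.1 hi).1
    have hj := (mem_startIndices.1 hj).1
    have := h.inj _ _ (by omega) (by omega) (by omega) (by omega) he
    omega
  · rw [mem_neighborFinset] at hu
    obtain ⟨i, hi, hi', rfl⟩ := h.exists_eq hn u
    have h1 : i ≠ 1 := fun h1 => hu.ne (by rw [h1])
    have hi2 : i - 1 + 1 = i := by omega
    exact ⟨i - 1, mem_startIndices.2 ⟨by omega, by rwa [hi2]⟩, by rw [hi2]⟩

lemma card_endIndices [DecidableRel G.Adj] (h : G.IsPathSeq n v) (hn : Fintype.card V = n) :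
    (endIndices G n v).card = G.degree (v n) := by
  classical
  rw [← card_neighborFinset_eq_degree]
  refine Finset.card_bij (fun i _ => v i) (fun i hi => ?_) (fun i hi j hj he => ?_)
    fun u hu => ?_
  · rw [mem_neighborFinset]
    exact (mem_endIndices.1 hi).2
  · have hi := (mem_endIndices.1 hi).1
    have hj := (mem_endIndices.1 hj).1
    exact h.inj _ _ (by omega) (by omega) (by omega) (by omega) he
  · rw [mem_neighborFinset] at hu
    obtain ⟨i, hi, hi', rfl⟩ := h.exists_eq hn u
    have h1 : i ≠ n := fun h1 => hu.ne (by rw [h1])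
    exact ⟨i, mem_endIndices.2 ⟨by omega, hu⟩, rfl⟩

variable [DecidableEq V]

lemma disjoint_startIndices_endIndices (h : G.IsPathSeq n v) (hn : Fintype.card V = n)
    (hn3 : 3 ≤ n) (hG : ¬ G.IsHamiltonian) :
    Disjoint (startIndices G n v) (endIndices G n v) := by
  rw [Finset.disjoint_left]
  intro i hi hi'
  have := (mem_startIndices.1 hi).1
  exact hG (h.isHamiltonian_of_crossing hn hn3 (by omega) (by omega) (mem_startIndices.1 hi).2
    (mem_endIndices.1 hi').2)

lemma card_indices (h : G.IsPathSeq n v) (hn : Fintype.card V = n) (hn3 : 3 ≤ n)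
    (hG : ¬ G.IsHamiltonian) :
    (startIndices G n v).card + (endIndices G n v).card + (missingIndices G n v).card = n - 1 := by
  have hM : missingIndices G n v =
      Finset.Icc 1 (n - 1) \ (startIndices G n v ∪ endIndices G n v) := by
    ext i
    simp only [mem_missingIndices, Finset.mem_sdiff, Finset.mem_union, mem_startIndices,
      mem_endIndices, Finset.mem_Icc]
    tauto
  have hsub : startIndices G n v ∪ endIndices G n v ⊆ Finset.Icc 1 (n - 1) :=
    Finset.union_subset (fun i hi => Finset.mem_Icc.2 (mem_startIndices.1 hi).1)
      fun i hi => Finset.mem_Icc.2 (mem_endIndices.1 hi).1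
  have hle := Finset.card_le_card hsub
  rw [hM, Finset.card_sdiff_of_subset hsub]
  rw [Finset.card_union_of_disjoint (h.disjoint_startIndices_endIndices hn hn3 hG)] at hle ⊢
  rw [Nat.card_Icc] at hle ⊢
  omega

/-- The successor of a left neighbour of a bypassed vertex is adjacent to neither end. -/
lemma not_adj_succ_of_adj_left (h : G.IsPathSeq n v) (hn : Fintype.card V = n) (hn3 : 3 ≤ n)
    (hG : ¬ G.IsHamiltonian) {l k : ℕ} (hl : 1 ≤ l) (hk : k ∈ bypassedIndices G n v)
    (hlk : l < k) (hadj : G.Adj (v l) (v k)) :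
    ¬ G.Adj (v 1) (v (l + 1)) ∧ ¬ G.Adj (v n) (v (l + 1)) := by
  obtain ⟨⟨hk2, hkn⟩, hy, hx⟩ := mem_bypassedIndices.1 hk
  have hk1 : k - 1 + 1 = k := by omega
  refine ⟨fun hx' => hG ?_, fun hy' => hG ?_⟩
  · obtain rfl | hlt : l = k - 1 ∨ l < k - 1 := by omega
    · exact h.isHamiltonian_of_crossing hn hn3 hl (by omega) hx' hy
    · exact h.isHamiltonian_of_outer_chord hn hn3 hl hlt (by omega) hx' hy (by rwa [hk1])
  · exact h.isHamiltonian_of_inner_chord hn hn3 hl hlk (by omega) hx hy' hadj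

/-- The predecessor of a right neighbour of a bypassed vertex is adjacent to neither end. -/
lemma not_adj_pred_of_adj_right (h : G.IsPathSeq n v) (hn : Fintype.card V = n) (hn3 : 3 ≤ n)
    (hG : ¬ G.IsHamiltonian) {l k : ℕ} (hl : l ≤ n) (hk : k ∈ bypassedIndices G n v)
    (hkl : k < l) (hadj : G.Adj (v k) (v l)) :
    ¬ G.Adj (v 1) (v (l - 1)) ∧ ¬ G.Adj (v n) (v (l - 1)) := by
  obtain ⟨⟨hk2, hkn⟩, hy, hx⟩ := mem_bypassedIndices.1 hk
  have hk1 : k - 1 + 1 = k := by omega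
  have hl1 : l - 1 + 1 = l := by omega
  refine ⟨fun hx' => hG ?_, fun hy' => hG ?_⟩
  · exact h.isHamiltonian_of_chord_beyond hn hn3 (q := k - 1) (by omega) (by omega) hl hx' hy
      (by rwa [hk1])
  · obtain rfl | hlt : k = l - 1 ∨ k < l - 1 := by omega
    · exact h.isHamiltonian_of_crossing hn hn3 (by omega) (by omega) hx hy'
    · exact h.isHamiltonian_of_outer_chord hn hn3 (by omega) hlt (by omega) hx hy'
        (by rwa [hl1])

lemma not_adj_of_mem_bypassedIndices (h : G.IsPathSeq n v) (hn : Fintype.card V = n)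
    (hn3 : 3 ≤ n) (hG : ¬ G.IsHamiltonian) {k k' : ℕ} (hk : k ∈ bypassedIndices G n v)
    (hk' : k' ∈ bypassedIndices G n v) : ¬ G.Adj (v k) (v k') := by
  intro hadj
  have hk2 := mem_bypassedIndices.1 hk
  have hk2' := mem_bypassedIndices.1 hk'
  obtain hlt | rfl | hlt := lt_trichotomy k k'
  · exact (h.not_adj_succ_of_adj_left hn hn3 hG (by omega) hk' hlt hadj).1 hk2.2.2
  · exact hadj.ne rfl
  · exact (h.not_adj_succ_of_adj_left hn hn3 hG (by omega) hk hlt hadj.symm).1 hk2'.2.2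

end Counting

end IsPathSeq

namespace IsPathSeq

variable {V : Type*} {G : SimpleGraph V} {n : ℕ} {v : ℕ → V}

open Classical in
/-- Indices of neighbours of bypassed vertices lying to their left. -/
noncomputable def leftIndices (G : SimpleGraph V) (n : ℕ) (v : ℕ → V) : Finset ℕ :=
  {l ∈ Finset.Icc 1 n | ∃ k ∈ bypassedIndices G n v, l < k ∧ G.Adj (v l) (v k)}

open Classical in
/-- Indices of neighbours of bypassed vertices lying to their right. -/
noncomputable def rightIndices (G : SimpleGraph V) (n : ℕ) (v : ℕ → V) : Finset ℕ :=
  {l ∈ Finset.Icc 1 n | ∃ k ∈ bypassedIndices G n v, k < l ∧ G.Adj (v k) (v l)}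

lemma mem_leftIndices {l : ℕ} : l ∈ leftIndices G n v ↔ (1 ≤ l ∧ l ≤ n) ∧
    ∃ k ∈ bypassedIndices G n v, l < k ∧ G.Adj (v l) (v k) := by
  simp [leftIndices]

lemma mem_rightIndices {l : ℕ} : l ∈ rightIndices G n v ↔ (1 ≤ l ∧ l ≤ n) ∧
    ∃ k ∈ bypassedIndices G n v, k < l ∧ G.Adj (v k) (v l) := by
  simp [rightIndices]

variable [Fintype V] [DecidableEq V]

lemma card_leftIndices_le (h : G.IsPathSeq n v) (hn : Fintype.card V = n) (hn3 : 3 ≤ n)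
    (hG : ¬ G.IsHamiltonian) {N : ℕ} (hN : ∀ k ∈ bypassedIndices G n v, k ≤ N) :
    (leftIndices G n v).card ≤ (bypassedIndices G n v).card +
      {i ∈ missingIndices G n v | i < N}.card := by
  refine card_le_of_no_consecutive (fun l hl => ?_) fun l hl hl' => hG ?_
  · obtain ⟨⟨hl1, hln⟩, k, hk, hlk, hadj⟩ := mem_leftIndices.1 hl
    obtain ⟨ha, hb⟩ := h.not_adj_succ_of_adj_left hn hn3 hG hl1 hk hlk hadj
    have hkN := hN k hk
    have hk' := mem_bypassedIndices.1 hk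
    by_cases hbl : G.Adj (v n) (v l)
    · right
      rw [Finset.mem_union]
      by_cases hal : G.Adj (v 1) (v (l + 1 + 1))
      · exact Or.inl (mem_bypassedIndices.2 ⟨by omega, by simpa using hbl, hal⟩)
      · have hne : l + 1 ≠ k := by
          rintro rfl
          exact hal hk'.2.2
        exact Or.inr (Finset.mem_filter.2
          ⟨mem_missingIndices.2 ⟨by omega, hal, hb⟩, by omega⟩)
    · exact Or.inl (Finset.mem_filter.2 ⟨mem_missingIndices.2 ⟨by omega, ha, hbl⟩, by omega⟩)
  · obtain ⟨⟨hl1, hln⟩, s, hs, hls, hadj⟩ := mem_leftIndices.1 hl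
    obtain ⟨-, k, hk, hlk, hadj'⟩ := mem_leftIndices.1 hl'
    have hs' := mem_bypassedIndices.1 hs
    have hk' := mem_bypassedIndices.1 hk
    exact h.isHamiltonian_of_consecutive_chords hn hn3 hl1 hls (by omega) hlk (by omega)
      hs'.2.2 hk'.2.1 hadj hadj'

lemma card_rightIndices_le (h : G.IsPathSeq n v) (hn : Fintype.card V = n) (hn3 : 3 ≤ n)
    (hG : ¬ G.IsHamiltonian) {N : ℕ} (hN : ∀ k ∈ bypassedIndices G n v, N ≤ k) :
    (rightIndices G n v).card ≤ (bypassedIndices G n v).card +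
      {i ∈ missingIndices G n v | N ≤ i}.card := by
  have h3 : ∀ l ∈ rightIndices G n v, 3 ≤ l := by
    intro l hl
    obtain ⟨-, k, hk, hkl, -⟩ := mem_rightIndices.1 hl
    have := mem_bypassedIndices.1 hk
    omega
  have hcard : ((rightIndices G n v).image (· - 2)).card = (rightIndices G n v).card := by
    refine Finset.card_image_of_injOn fun l hl l' hl' he => ?_
    have := h3 l hl
    have := h3 l' hl'
    omega
  rw [← hcard]
  refine card_le_of_no_consecutive (fun j hj => ?_) fun j hj hj' => hG ?_
  · obtain ⟨l, hl, rfl⟩ := Finset.mem_image.1 hj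
    have hl3 := h3 l hl
    obtain ⟨l, rfl⟩ := Nat.exists_eq_add_of_le' hl3
    obtain ⟨⟨-, hln⟩, k, hk, hkl, hadj⟩ := mem_rightIndices.1 hl
    obtain ⟨ha, hb⟩ := h.not_adj_pred_of_adj_right hn hn3 hG hln hk hkl hadj
    have hkN := hN k hk
    have hk' := mem_bypassedIndices.1 hk
    simp only [Nat.reduceSubDiff, Nat.add_one_sub_one] at ha hb ⊢
    by_cases hbl : G.Adj (v n) (v (l + 1))
    · right
      rw [Finset.mem_union]
      by_cases hal : G.Adj (v 1) (v (l + 1 + 1 + 1))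
      · exact Or.inl (mem_bypassedIndices.2 ⟨by omega, by simpa using hbl, hal⟩)
      · exact Or.inr (Finset.mem_filter.2
          ⟨mem_missingIndices.2 ⟨by omega, hal, hb⟩, by omega⟩)
    · have hne : l + 2 ≠ k := by
        rintro rfl
        exact hbl hk'.2.1
      exact Or.inl (Finset.mem_filter.2 ⟨mem_missingIndices.2 ⟨by omega, ha, hbl⟩, by omega⟩)
  · obtain ⟨l, hl, rfl⟩ := Finset.mem_image.1 hj
    obtain ⟨l', hl', he⟩ := Finset.mem_image.1 hj'
    have hl3 := h3 l hl
    have hl3' := h3 l' hl'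
    obtain rfl : l' = l + 1 := by omega
    obtain ⟨-, k, hk, hkl, hadj⟩ := mem_rightIndices.1 hl
    obtain ⟨hln, s, hs, hsl, hadj'⟩ := mem_rightIndices.1 hl'
    have hs' := mem_bypassedIndices.1 hs
    have hk' := mem_bypassedIndices.1 hk
    refine h.reverse.isHamiltonian_of_consecutive_chords hn hn3 (l := n - l) (s := n + 1 - s)
      (k := n + 1 - k) (by omega) (by omega) (by omega) (by omega) (by omega) ?_ ?_ ?_ ?_
    · convert hs'.2.1 using 2 <;> omega
    · convert hk'.2.2 using 2 <;> omega
    · convert hadj'.symm using 2 <;> omega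
    · convert hadj.symm using 2 <;> omega

lemma bypassedIndices_eq_empty (h : G.IsPathSeq n v) (hn : Fintype.card V = n) (hn3 : 3 ≤ n)
    (hG : ¬ G.IsHamiltonian) {t : ℚ} (ht : 4 ≤ t) (hT : G.Tough t)
    (hM : ((missingIndices G n v).card : ℚ) ≤ t - 1) : bypassedIndices G n v = ∅ := by
  by_contra hne
  rw [← ne_eq, ← Finset.nonempty_iff_ne_empty] at hne
  set K := bypassedIndices G n v with hK
  set M := missingIndices G n v with hMdef
  set L := leftIndices G n v with hL
  set R := rightIndices G n v with hR
  have hrange : ∀ k ∈ K, 2 ≤ k ∧ k ≤ n - 1 := fun k hk => (mem_bypassedIndices.1 hk).1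
  have hLR : ∀ l ∈ L ∪ R, 1 ≤ l ∧ l ≤ n := by
    intro l hl
    rcases Finset.mem_union.1 hl with hl | hl
    exacts [(mem_leftIndices.1 hl).1, (mem_rightIndices.1 hl).1]
  have hmem : ∀ i, 1 ≤ i → i ≤ n → (v i ∈ (L ∪ R).image v ↔ i ∈ L ∪ R) := by
    refine fun i hi hin => ⟨fun hv => ?_, fun hi' => Finset.mem_image_of_mem v hi'⟩
    obtain ⟨j, hj, hji⟩ := Finset.mem_image.1 hv
    rwa [← h.inj _ _ (hLR j hj).1 (hLR j hj).2 hi hin hji]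
  have hinj : Set.InjOn v K := fun i hi j hj he => by
    have := hrange i hi
    have := hrange j hj
    exact h.inj _ _ (by omega) (by omega) (by omega) (by omega) he
  have h1K : v 1 ∉ K.image v := by
    intro h1
    obtain ⟨k, hk, hk1⟩ := Finset.mem_image.1 h1
    have := hrange k hk
    have := h.inj _ _ (by omega) (by omega) (by omega) (by omega) hk1
    omega
  have hnotin : ∀ u ∈ insert (v 1) (K.image v), u ∉ (L ∪ R).image v := by
    intro u hu
    rcases Finset.mem_insert.1 hu with rfl | hu
    · rw [hmem 1 le_rfl (by omega), Finset.mem_union]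
      rintro (hl | hl)
      · obtain ⟨-, k, hk, hk1, hadj⟩ := mem_leftIndices.1 hl
        have hk' := mem_bypassedIndices.1 hk
        refine hG (h.isHamiltonian_of_crossing hn hn3 (i := k - 1) (by omega) (by omega) ?_
          hk'.2.1)
        rwa [show k - 1 + 1 = k by omega]
      · obtain ⟨-, k, hk, hk1, -⟩ := mem_rightIndices.1 hl
        have := hrange k hk
        omega
    · obtain ⟨i, hi, rfl⟩ := Finset.mem_image.1 hu
      have := hrange i hi
      rw [hmem i (by omega) (by omega), Finset.mem_union]
      rintro (hl | hl)
      · obtain ⟨-, k, hk, -, hadj⟩ := mem_leftIndices.1 hl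
        exact h.not_adj_of_mem_bypassedIndices hn hn3 hG hi hk hadj
      · obtain ⟨-, k, hk, -, hadj⟩ := mem_rightIndices.1 hl
        exact h.not_adj_of_mem_bypassedIndices hn hn3 hG hk hi hadj
  have hedge : ∀ u w, w ∉ (L ∪ R).image v → G.Adj u w → u ∉ K.image v := by
    intro u w hw hadj hu
    obtain ⟨k, hk, rfl⟩ := Finset.mem_image.1 hu
    obtain ⟨l, hl1, hln, rfl⟩ := h.exists_eq hn w
    refine hw (Finset.mem_image_of_mem v (Finset.mem_union.2 ?_))
    obtain hlt | rfl | hlt := lt_trichotomy l k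
    · exact Or.inl (mem_leftIndices.2 ⟨⟨hl1, hln⟩, k, hk, hlt, hadj.symm⟩)
    · exact absurd rfl hadj.ne
    · exact Or.inr (mem_rightIndices.2 ⟨⟨hl1, hln⟩, k, hk, hlt, hadj⟩)
  have hI : (insert (v 1) (K.image v)).card = K.card + 1 := by
    rw [Finset.card_insert_of_notMem h1K, Finset.card_image_of_injOn hinj]
  have hpos : 1 ≤ K.card := hne.card_pos
  have key := hT.mul_card_le (by linarith) ((L ∪ R).image v) (insert (v 1) (K.image v))
    (fun u => if u ∈ K.image v then some u else none) (fun u w hu hw hadj => by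
      rw [if_neg (hedge u w hw hadj), if_neg (hedge w u hu hadj.symm)]) hnotin
    (fun u hu w hw he => by
      rw [Finset.mem_coe, Finset.mem_insert] at hu hw
      rcases hu with rfl | hu <;> rcases hw with rfl | hw <;> simp_all) (by omega)
  rw [hI] at key
  have hS : ((L ∪ R).image v).card ≤ L.card + R.card :=
    Finset.card_image_le.trans (Finset.card_union_le L R)
  have hLle := h.card_leftIndices_le hn hn3 hG (N := K.max' hne) (fun k hk => K.le_max' k hk)
  have hRle := h.card_rightIndices_le hn hn3 hG (N := K.min' hne) (fun k hk => K.min'_le k hk)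
  rw [← hK, ← hMdef, ← hL] at hLle
  rw [← hK, ← hMdef, ← hR] at hRle
  obtain hone | htwo : K.card = 1 ∨ 2 ≤ K.card := by omega
  · have hmm : K.max' hne = K.min' hne := by
      obtain ⟨a, ha⟩ := Finset.card_eq_one.1 hone
      simp [ha]
    have hpart := Finset.card_filter_add_card_filter_not (s := M) (· < K.max' hne)
    simp only [not_lt] at hpart
    rw [← hmm] at hRle
    have hle : ((L ∪ R).image v).card ≤ M.card + 2 := by omega
    have hle' : (((L ∪ R).image v).card : ℚ) ≤ M.card + 2 := by exact_mod_cast hle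
    rw [hone] at key
    push_cast at key
    linarith
  · have h1 := Finset.card_filter_le M (· < K.max' hne)
    have h2 := Finset.card_filter_le M (K.min' hne ≤ ·)
    have hle : ((L ∪ R).image v).card ≤ 2 * K.card + 2 * M.card := by omega
    have hle' : (((L ∪ R).image v).card : ℚ) ≤ 2 * K.card + 2 * M.card := by exact_mod_cast hle
    have htwo' : (2 : ℚ) ≤ K.card := by exact_mod_cast htwo
    push_cast at key
    nlinarith

end IsPathSeq

namespace IsPathSeq

variable {V : Type*} [Fintype V] [DecidableEq V] {G : SimpleGraph V} {n : ℕ} {v : ℕ → V}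

/-- If no vertex is bypassed, then a vertex `v e` that is adjacent to some `v s` with `e < s` and
`v (s + 1)` adjacent to `v 1` cannot be preceded by a neighbour of `v n` and be one itself: the
vertex `v (e + 1)` would have too few neighbours. -/
lemma not_adj_of_bypassedIndices_eq_empty (h : G.IsPathSeq n v) (hn : Fintype.card V = n)
    (hn3 : 3 ≤ n) (hG : ¬ G.IsHamiltonian) {t : ℚ} (ht : 4 ≤ t) (hT : G.Tough t)
    (hM : ((missingIndices G n v).card : ℚ) ≤ t - 1) (hK : bypassedIndices G n v = ∅)
    {e s : ℕ} (he : 1 ≤ e) (hes : e < s) (hs : s < n) (hx : G.Adj (v 1) (v (s + 1)))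
    (hadj : G.Adj (v e) (v s)) : ¬ G.Adj (v n) (v e) := by
  classical
  intro hy
  set M := missingIndices G n v with hMdef
  have hK' : ∀ k, 1 ≤ k → k + 1 < n → G.Adj (v n) (v k) → ¬ G.Adj (v 1) (v (k + 2)) := by
    intro k hk hkn hb ha
    have : k + 1 ∈ bypassedIndices G n v :=
      mem_bypassedIndices.2 ⟨by omega, by simpa using hb, ha⟩
    simp [hK] at this
  have haw : ¬ G.Adj (v 1) (v (e + 2)) := hK' e he (by omega) hy
  have hbw : ¬ G.Adj (v n) (v (e + 1)) := fun hb =>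
    hG (h.isHamiltonian_of_inner_chord hn hn3 he hes hs hx hb hadj)
  have hws : e + 1 < s := by
    rcases Nat.lt_or_ge (e + 1) s with hlt | hge
    · exact hlt
    · obtain rfl : s = e + 1 := by omega
      exact absurd hx haw
  have hwM : e + 1 ∈ M := mem_missingIndices.2 ⟨by omega, haw, hbw⟩
  have hae : ¬ G.Adj (v 1) (v (e + 1)) := fun ha =>
    hG (h.isHamiltonian_of_crossing hn hn3 he (by omega) ha hy)
  have heM : e ∉ M := fun hm => (mem_missingIndices.1 hm).2.2 hy
  have hleft : ∀ l, 1 ≤ l → l ≤ e → G.Adj (v (e + 1)) (v l) → l ∈ M ∨ l + 1 ∈ M := by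
    intro l hl hle hadj'
    obtain rfl | hlt := hle.eq_or_lt
    · exact Or.inr hwM
    have ha : ¬ G.Adj (v 1) (v (l + 1)) := fun ha =>
      hG (h.isHamiltonian_of_outer_chord hn hn3 hl hlt (by omega) ha hy hadj'.symm)
    have hb : ¬ G.Adj (v n) (v (l + 1)) := fun hb =>
      hG (h.isHamiltonian_of_linked_chords hn hn3 hl hlt hes hs hx hb hadj hadj'.symm)
    by_cases hbl : G.Adj (v n) (v l)
    · exact Or.inr (mem_missingIndices.2 ⟨by omega, hK' l hl (by omega) hbl, hb⟩)
    · exact Or.inl (mem_missingIndices.2 ⟨by omega, ha, hbl⟩)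
  have hright : ∀ l, e + 1 < l → l ≤ n → G.Adj (v (e + 1)) (v l) → l - 2 ∈ M ∨ l - 1 ∈ M := by
    intro l hl hln hadj'
    obtain ⟨l, rfl⟩ := Nat.exists_eq_add_of_le' (show 2 ≤ l by omega)
    have ha : ¬ G.Adj (v 1) (v (l + 1)) := fun ha =>
      hG (h.isHamiltonian_of_chord_beyond hn hn3 he hl hln ha hy hadj')
    have hb : ¬ G.Adj (v n) (v (l + 1)) := fun hb =>
      hG (h.isHamiltonian_of_consecutive_chords hn hn3 he hes hs hl hln hx hb hadj hadj')
    by_cases hbl : G.Adj (v n) (v l)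
    · exact Or.inr (mem_missingIndices.2 ⟨by omega, hK' l (by omega) (by omega) hbl, hb⟩)
    · exact Or.inl (mem_missingIndices.2 ⟨by omega, ha, hbl⟩)
  set W := {i ∈ M | i ≤ e + 1} with hW
  set X := {i ∈ M | ¬ i ≤ e + 1} with hX
  have hpart : W.card + X.card = M.card := Finset.card_filter_add_card_filter_not _
  have hwW : e + 1 ∈ W := Finset.mem_filter.2 ⟨hwM, le_rfl⟩
  set T := (W.erase (e + 1) ∪ W.image (· - 1)) ∪
    (insert (e + 1) X).image (· + 1) ∪ (insert (e + 1) X).image (· + 2) with hTdef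
  have hsub : G.neighborFinset (v (e + 1)) ⊆ T.image v := by
    intro u hu
    rw [mem_neighborFinset] at hu
    obtain ⟨l, hl, hln, rfl⟩ := h.exists_eq hn u
    refine Finset.mem_image_of_mem v ?_
    simp only [hTdef, Finset.mem_union, Finset.mem_image, Finset.mem_erase, Finset.mem_insert]
    obtain hlt | rfl | hlt := lt_trichotomy l (e + 1)
    · rcases hleft l hl (by omega) hu with hm | hm
      · exact Or.inl (Or.inl (Or.inl ⟨by omega, Finset.mem_filter.2 ⟨hm, by omega⟩⟩))
      · exact Or.inl (Or.inl (Or.inr ⟨l + 1, Finset.mem_filter.2 ⟨hm, by omega⟩, by omega⟩))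
    · exact absurd rfl hu.ne
    · rcases hright l hlt hln hu with hm | hm
      · have hne : l - 2 ≠ e := fun hne => heM (hne ▸ hm)
        refine Or.inr ⟨l - 2, ?_, by omega⟩
        by_cases h1 : l - 2 = e + 1
        · exact Or.inl h1
        · exact Or.inr (Finset.mem_filter.2 ⟨hm, by omega⟩)
      · refine Or.inl (Or.inr ⟨l - 1, ?_, by omega⟩)
        by_cases h1 : l - 1 = e + 1
        · exact Or.inl h1
        · exact Or.inr (Finset.mem_filter.2 ⟨hm, by omega⟩)
  have hTcard : T.card ≤ 2 * M.card + 1 := by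
    have h1 := Finset.card_union_le (W.erase (e + 1) ∪ W.image (· - 1) ∪
      (insert (e + 1) X).image (· + 1)) ((insert (e + 1) X).image (· + 2))
    have h2 := Finset.card_union_le (W.erase (e + 1) ∪ W.image (· - 1))
      ((insert (e + 1) X).image (· + 1))
    have h3 := Finset.card_union_le (W.erase (e + 1)) (W.image (· - 1))
    have h4 := Finset.card_erase_add_one hwW
    have h5 : (W.image (· - 1)).card ≤ W.card := Finset.card_image_le
    have h6 : ((insert (e + 1) X).image (· + 1)).card ≤ _ := Finset.card_image_le
    have h7 : ((insert (e + 1) X).image (· + 2)).card ≤ _ := Finset.card_image_le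
    have h8 := Finset.card_insert_le (e + 1) X
    rw [hTdef]
    omega
  have hne : v (e + 1) ≠ v 1 := fun heq => by
    have := h.inj _ _ (by omega) (by omega) (by omega) (by omega) heq
    omega
  have key := hT.mul_card_le (by linarith) (G.neighborFinset (v (e + 1))) {v (e + 1), v 1}
    (fun u => u = v (e + 1)) (fun u w hu hw huw => by
      rw [mem_neighborFinset] at hu hw
      have h1 : u ≠ v (e + 1) := by
        rintro rfl
        exact hw huw
      have h2 : w ≠ v (e + 1) := by
        rintro rfl
        exact hu huw.symm
      simp [h1, h2]) (fun u hu => by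
      rw [mem_neighborFinset]
      rcases Finset.mem_insert.1 hu with rfl | hu
      · exact G.loopless.irrefl _
      · rw [Finset.mem_singleton.1 hu]
        exact fun hw => hae hw.symm) (fun u hu w hw heq => by
      simp only [Finset.coe_insert, Finset.coe_singleton, Set.mem_insert_iff,
        Set.mem_singleton_iff] at hu hw
      rcases hu with rfl | rfl <;> rcases hw with rfl | rfl <;> simp_all)
    (by rw [Finset.card_pair hne])
  rw [Finset.card_pair hne] at key
  have hle := ((Finset.card_le_card hsub).trans Finset.card_image_le).trans hTcard
  have hle' : ((G.neighborFinset (v (e + 1))).card : ℚ) ≤ 2 * M.card + 1 := by exact_mod_cast hle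
  push_cast at key
  linarith

/-- A Hamiltonian path whose missing indices number at most `t - 1` closes up to a Hamiltonian
cycle in a `t`-tough graph. -/
lemma isHamiltonian_of_tough (h : G.IsPathSeq n v) (hn : Fintype.card V = n) (hn3 : 3 ≤ n)
    {t : ℚ} (ht : 4 ≤ t) (hT : G.Tough t)
    (hM : ((missingIndices G n v).card : ℚ) ≤ t - 1) : G.IsHamiltonian := by
  by_contra hG
  have hK := h.bypassedIndices_eq_empty hn hn3 hG ht hT hM
  have hcard := h.card_indices hn hn3 hG
  set A := startIndices G n v with hA
  set B := endIndices G n v with hB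
  set M := missingIndices G n v with hMdef
  have hK' : ∀ k, 1 ≤ k → k + 1 < n → G.Adj (v n) (v k) → ¬ G.Adj (v 1) (v (k + 2)) := by
    intro k hk hkn hb ha
    have : k + 1 ∈ bypassedIndices G n v :=
      mem_bypassedIndices.2 ⟨by omega, by simpa using hb, ha⟩
    simp [hK] at this
  set B' := B.image (· + 1) with hB'
  have hmemB' : ∀ j, j ∈ B' ↔ (2 ≤ j ∧ j ≤ n) ∧ G.Adj (v n) (v (j - 1)) := by
    intro j
    rw [hB', Finset.mem_image]
    constructor
    · rintro ⟨i, hi, rfl⟩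
      have hi' := mem_endIndices.1 hi
      exact ⟨by omega, by simpa using hi'.2⟩
    · rintro ⟨hj, hadj⟩
      exact ⟨j - 1, mem_endIndices.2 ⟨by omega, hadj⟩, by omega⟩
  have hB'card : B'.card = B.card := Finset.card_image_of_injective _ (add_left_injective 1)
  have hdisj : Disjoint A B' := by
    rw [Finset.disjoint_left]
    intro i hi hi'
    have hiA := mem_startIndices.1 hi
    have hiB := (hmemB' i).1 hi'
    refine hK' (i - 1) (by omega) (by omega) hiB.2 ?_
    rw [show i - 1 + 2 = i + 1 by omega]
    exact hiA.2
  have hsub : A ∪ B' ⊆ Finset.Icc 1 n := by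
    intro i hi
    rw [Finset.mem_Icc]
    rcases Finset.mem_union.1 hi with hi | hi
    · have := (mem_startIndices.1 hi).1
      omega
    · have := ((hmemB' i).1 hi).1
      omega
  set Z := Finset.Icc 1 n \ (A ∪ B') with hZ
  have hZcard : Z.card = M.card + 1 := by
    have hle := Finset.card_le_card hsub
    rw [hZ, Finset.card_sdiff_of_subset hsub]
    rw [Finset.card_union_of_disjoint hdisj, Nat.card_Icc] at *
    omega
  have hrange : ∀ i ∈ Z ∪ M, 1 ≤ i ∧ i ≤ n := by
    intro i hi
    rcases Finset.mem_union.1 hi with hi | hi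
    · exact Finset.mem_Icc.1 (Finset.mem_sdiff.1 hi).1
    · have := (mem_missingIndices.1 hi).1
      omega
  have hmemS : ∀ i, 1 ≤ i → i ≤ n → (v i ∈ (Z ∪ M).image v ↔ i ∈ Z ∪ M) := by
    refine fun i hi hin => ⟨fun hv => ?_, fun hi' => Finset.mem_image_of_mem v hi'⟩
    obtain ⟨j, hj, hji⟩ := Finset.mem_image.1 hv
    rwa [← h.inj _ _ (hrange j hj).1 (hrange j hj).2 hi hin hji]
  have hmemA : ∀ i, 1 ≤ i → i ≤ n → (v i ∈ A.image v ↔ i ∈ A) := by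
    refine fun i hi hin => ⟨fun hv => ?_, fun hi' => Finset.mem_image_of_mem v hi'⟩
    obtain ⟨j, hj, hji⟩ := Finset.mem_image.1 hv
    have hj' := (mem_startIndices.1 hj).1
    rwa [← h.inj _ _ hj'.1 (by omega) hi hin hji]
  have hedge : ∀ i j, 1 ≤ i → i ≤ n → 1 ≤ j → j ≤ n → i ∉ Z ∪ M → j ∉ Z ∪ M →
      G.Adj (v i) (v j) → i ∈ A → j ∈ A := by
    intro i j hi hin hj hjn hiS hjS hadj hiA
    by_contra hjA
    have hiA' := mem_startIndices.1 hiA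
    have hjB : j ∈ B' := by
      by_contra hjB
      refine hjS (Finset.mem_union_left _ (Finset.mem_sdiff.2 ⟨Finset.mem_Icc.2 ⟨hj, hjn⟩, ?_⟩))
      rw [Finset.mem_union]
      tauto
    have hjB' := (hmemB' j).1 hjB
    have hj1 : j - 1 + 1 = j := by omega
    obtain hlt | heq | hlt : i < j - 1 ∨ i = j - 1 ∨ j ≤ i := by omega
    · exact hG (h.isHamiltonian_of_outer_chord hn hn3 hi hlt (by omega) hiA'.2 hjB'.2
        (by rwa [hj1]))
    · rw [← heq] at hjB'
      exact hG (h.isHamiltonian_of_crossing hn hn3 hi (by omega) hiA'.2 hjB'.2)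
    · have hji : j < i := by
        refine lt_of_le_of_ne hlt ?_
        rintro rfl
        exact hjA hiA
      refine hjS (Finset.mem_union_right _ (mem_missingIndices.2 ⟨by omega, fun ha => ?_, ?_⟩))
      · exact hjA (mem_startIndices.2 ⟨by omega, ha⟩)
      · exact h.not_adj_of_bypassedIndices_eq_empty hn hn3 hG ht hT hM hK hj hji (by omega)
          hiA'.2 hadj.symm
  have h1A : 1 ∈ A := mem_startIndices.2 ⟨by omega, h.adj 1 le_rfl (by omega)⟩
  have hnA : n ∉ A := fun hnA => by
    have := (mem_startIndices.1 hnA).1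
    omega
  have hnB : n ∈ B' := (hmemB' n).2 ⟨by omega, by
    have := h.adj (n - 1) (by omega) (by omega)
    rw [show n - 1 + 1 = n by omega] at this
    exact this.symm⟩
  have h1S : 1 ∉ Z ∪ M := by
    rw [Finset.mem_union]
    rintro (hm | hm)
    · exact (Finset.mem_sdiff.1 hm).2 (Finset.mem_union_left _ h1A)
    · exact (mem_missingIndices.1 hm).2.1 (mem_startIndices.1 h1A).2
  have hnS : n ∉ Z ∪ M := by
    rw [Finset.mem_union]
    rintro (hm | hm)
    · exact (Finset.mem_sdiff.1 hm).2 (Finset.mem_union_right _ hnB)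
    · have := (mem_missingIndices.1 hm).1
      omega
  have h1A' := (hmemA 1 le_rfl (by omega)).2 h1A
  have hnA' := mt (hmemA n (by omega) le_rfl).1 hnA
  have hne : v 1 ≠ v n := fun heq => hnA' (heq ▸ h1A')
  have key := hT.mul_card_le (by linarith) ((Z ∪ M).image v) {v 1, v n}
    (fun u => u ∈ A.image v) (fun u w hu hw huw => by
      obtain ⟨i, hi, hin, rfl⟩ := h.exists_eq hn u
      obtain ⟨j, hj, hjn, rfl⟩ := h.exists_eq hn w
      rw [hmemS _ hi hin] at hu
      rw [hmemS _ hj hjn] at hw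
      simp only [hmemA _ hi hin, hmemA _ hj hjn]
      exact propext ⟨hedge i j hi hin hj hjn hu hw huw, hedge j i hj hjn hi hin hw hu huw.symm⟩)
    (fun u hu => by
      rcases Finset.mem_insert.1 hu with rfl | hu
      · rwa [hmemS 1 le_rfl (by omega)]
      · rw [Finset.mem_singleton.1 hu]
        rwa [hmemS n (by omega) le_rfl]) (fun u hu w hw heq => by
      simp only [Finset.coe_insert, Finset.coe_singleton, Set.mem_insert_iff,
        Set.mem_singleton_iff] at hu hw
      have hiff : u ∈ A.image v ↔ w ∈ A.image v := iff_of_eq heq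
      rcases hu with rfl | rfl <;> rcases hw with rfl | rfl <;> tauto)
    (by rw [Finset.card_pair hne])
  rw [Finset.card_pair hne] at key
  have hle : ((Z ∪ M).image v).card ≤ 2 * M.card + 1 := by
    have := (Finset.card_image_le (f := v)).trans (Finset.card_union_le Z M)
    omega
  have hle' : (((Z ∪ M).image v).card : ℚ) ≤ 2 * M.card + 1 := by exact_mod_cast hle
  push_cast at key
  linarith

end IsPathSeq

end SimpleGraph

/-- Toughness Closure Lemma: if `t ≥ 4` is rational, `G` is a `t`-tough graph on
`n ≥ 3` vertices, and `x, y` are distinct nonadjacent vertices with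
`deg(x) + deg(y) ≥ n − t`, then `G` is Hamiltonian iff `G + xy` is Hamiltonian. -/
theorem toughness_closure_lemma
    {V : Type*} [Fintype V] [DecidableEq V] (G : SimpleGraph V) [DecidableRel G.Adj]
    (n : ℕ) (t : ℚ) (ht : 4 ≤ t) (hn : Fintype.card V = n) (hn3 : 3 ≤ n)
    (htough : SimpleGraph.Tough t G)
    (x y : V) (hne : x ≠ y) (hnadj : ¬ G.Adj x y)
    (hdeg : (n : ℚ) - t ≤ (G.degree x : ℚ) + (G.degree y : ℚ)) :
    G.IsHamiltonian ↔ (G ⊔ SimpleGraph.fromEdgeSet {s(x, y)}).IsHamiltonian := by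
  refine ⟨fun hG => hG.mono le_sup_left, fun hG' => ?_⟩
  by_contra hG
  obtain ⟨v, h, rfl, rfl⟩ :=
    SimpleGraph.exists_isPathSeq_of_isHamiltonian_sup hn hn3 hG hG'
  have hcard := h.card_indices hn hn3 hG
  rw [h.card_startIndices hn, h.card_endIndices hn] at hcard
  refine hG (h.isHamiltonian_of_tough hn hn3 ht htough ?_)
  have hcard' : (G.degree (v 1) : ℚ) + G.degree (v n) +
      (SimpleGraph.IsPathSeq.missingIndices G n v).card + 1 = n := by
    exact_mod_cast (by omega : _ + _ + _ + 1 = n)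
  linarith
end

section
/- Let t ≥ 4 be a rational number and let G be a t-tough graph on n ≥ 3 vertices. Suppose G is not Hamiltonian, but there exists a vertex z of G such that G − z has a Hamilton cycle C. Fix an orientation of C and, for a vertex u of C, let u^+ denote the successor of u on the oriented cycle C. Then for any two distinct neighbors x and y of z, deg(x^+) + deg(y^+) < n − t. -/
/-- Given an oriented Hamilton cycle of `G − z`, encoded as a bijection
`c : ZMod m ≃ {u // u ≠ z}` with consecutive vertices adjacent, `cycNext c w`
is the successor `w⁺` of a vertex `w ≠ z` on the oriented cycle (and `z` itself
for `w = z`). -/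
def cycNext {V : Type*} [DecidableEq V] {z : V} {m : ℕ}
    (c : ZMod m ≃ {u : V // u ≠ z}) (w : V) : V :=
  if h : w = z then w else (c (c.symm ⟨w, h⟩ + 1)).1

/-- `v 0, v 1, …, v N` is a Hamiltonian path of `G`. -/
structure SimpleGraph.IsHamPathSeq {V : Type*} (G : SimpleGraph V) (v : ℕ → V) (N : ℕ) : Prop where
  adj : ∀ i < N, G.Adj (v i) (v (i + 1))
  inj : Set.InjOn v (Set.Iic N)
  surj : ∀ w, ∃ i ≤ N, v i = w

/-- Some walk from `v a` to `v b` visits exactly the vertices `v i`, `i ∈ s`, each once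
per index. -/
def SimpleGraph.WalkOn {V : Type*} (G : SimpleGraph V) (v : ℕ → V) (s : Finset ℕ) (a b : ℕ) :
    Prop :=
  ∃ p : G.Walk (v a) (v b), (p.support : Multiset V) = s.val.map v

namespace SimpleGraph

section Tough

variable {V : Type*} [Fintype V] {G : SimpleGraph V} {t : ℚ}

/-- Deleting a set `S` that contains all neighbours of the vertices in `T`, but neither a vertex
of `T` nor the further vertex `u`, leaves at least `|T| + 1` components. -/
lemma Tough.mul_card_add_one_le (h : G.Tough t) (ht : 0 ≤ t) {S T : Finset V} {u : V}
    (huS : u ∉ S) (huT : u ∉ T) (hTS : Disjoint T S) (hT : T.Nonempty)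
    (hN : ∀ w ∈ T, ∀ w', G.Adj w w' → w' ∈ S) :
    t * ((T.card : ℚ) + 1) ≤ S.card := by
  classical
  have hmem : ∀ w ∈ insert u T, w ∈ ((↑S : Set V)ᶜ) := by
    intro w hw
    rcases Finset.mem_insert.1 hw with rfl | hw
    · simpa using huS
    · simpa using Finset.disjoint_left.1 hTS hw
  have iso : ∀ (a b : ((↑S : Set V)ᶜ : Set V)), a.1 ∈ T →
      (G.induce ((↑S : Set V)ᶜ)).Reachable a b → a = b := by
    rintro a b ha ⟨p⟩
    cases p with
    | nil => rfl
    | @cons _ c _ e q => exact absurd (hN _ ha _ e) c.2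
  let f : {w // w ∈ insert u T} → (G.induce ((↑S : Set V)ᶜ)).ConnectedComponent :=
    fun w ↦ (G.induce ((↑S : Set V)ᶜ)).connectedComponentMk ⟨w.1, hmem w.1 w.2⟩
  have hf : Function.Injective f := by
    rintro ⟨a, ha⟩ ⟨b, hb⟩ hab
    have hr := ConnectedComponent.exact hab
    rcases Finset.mem_insert.1 ha with ha' | ha'
    · rcases Finset.mem_insert.1 hb with hb' | hb'
      · exact Subtype.ext (ha'.trans hb'.symm)
      · exact Subtype.ext (Subtype.mk.inj (iso _ _ hb' hr.symm)).symm
    · exact Subtype.ext (Subtype.mk.inj (iso _ _ ha' hr))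
  have hcard := Nat.card_le_card_of_injective f hf
  rw [Nat.card_eq_fintype_card, Fintype.card_coe, Finset.card_insert_of_notMem huT] at hcard
  have hpos := hT.card_pos
  refine le_trans ?_ (h S (by omega))
  gcongr
  exact_mod_cast hcard

end Tough

variable {V : Type*} {G : SimpleGraph V} {v : ℕ → V} {N : ℕ}

namespace WalkOn

lemma symm {s : Finset ℕ} {a b : ℕ} (h : G.WalkOn v s a b) : G.WalkOn v s b a := by
  obtain ⟨p, hp⟩ := h
  refine ⟨p.reverse, ?_⟩
  rw [Walk.support_reverse, ← hp]
  exact Multiset.coe_reverse _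

lemma join {s s' : Finset ℕ} {a b c d : ℕ} (h : G.WalkOn v s a b) (e : G.Adj (v b) (v c))
    (h' : G.WalkOn v s' c d) (hd : Disjoint s s') : G.WalkOn v (s ∪ s') a d := by
  obtain ⟨p, hp⟩ := h
  obtain ⟨q, hq⟩ := h'
  refine ⟨p.append (.cons e q), ?_⟩
  rw [← Finset.disjUnion_eq_union _ _ hd, Finset.disjUnion_val, Multiset.map_add, ← hp, ← hq,
    Walk.support_append]
  simp

end WalkOn

namespace IsHamPathSeq

lemma walkOn_Icc (h : G.IsHamPathSeq v N) {i j : ℕ} (hij : i ≤ j) (hj : j ≤ N) :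
    G.WalkOn v (Finset.Icc i j) i j := by
  induction j, hij using Nat.le_induction with
  | base => exact ⟨.nil, by simp⟩
  | succ j hij ih =>
    have hs : G.WalkOn v {j + 1} (j + 1) (j + 1) := ⟨.nil, by simp⟩
    convert (ih (by omega)).join (h.adj j (by omega)) hs (by simp) using 1
    ext x
    simp only [Finset.mem_Icc, Finset.mem_union, Finset.mem_singleton]
    omega

lemma card_eq [Fintype V] (h : G.IsHamPathSeq v N) : Fintype.card V = N + 1 := by
  classical
  have : (Finset.Iic N).image v = Finset.univ := by
    ext w
    obtain ⟨i, hi, rfl⟩ := h.surj w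
    simpa using ⟨i, hi, rfl⟩
  rw [← Finset.card_univ, ← this, Finset.card_image_of_injOn (by simpa using h.inj)]
  simp

variable [Fintype V] [DecidableEq V]

lemma isHamiltonian_of_walkOn (h : G.IsHamPathSeq v N) (hN : 2 ≤ N) {a b : ℕ} {s : Finset ℕ}
    (hw : G.WalkOn v s a b) (hs : s = Finset.Iic N) (e : G.Adj (v b) (v a)) :
    G.IsHamiltonian := by
  obtain ⟨p, hp⟩ := hw
  subst hs
  have hnd : p.support.Nodup := by
    rw [← Multiset.coe_nodup, hp]
    exact Multiset.Nodup.map_on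
      (fun x hx y hy hxy ↦ h.inj (by simpa using hx) (by simpa using hy) hxy) (Finset.nodup _)
  have hlen : p.length = N := by
    have := congrArg Multiset.card hp
    simp at this
    omega
  have hpath : p.IsPath := Walk.IsPath.mk' hnd
  have hcard := h.card_eq
  intro _
  refine ⟨v b, .cons e p, ?_⟩
  rw [Walk.isHamiltonianCycle_iff_isCycle_and_length_eq]
  refine ⟨?_, by simp [hlen, hcard]⟩
  rw [Walk.cons_isCycle_iff]
  refine ⟨hpath, fun he ↦ ?_⟩
  have := hpath.length_eq_one_of_mem_edges (Sym2.eq_swap ▸ he)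
  omega

section Nonhamiltonian

variable (h : G.IsHamPathSeq v N) (hN : 2 ≤ N) (hG : ¬ G.IsHamiltonian)
include h hN hG

lemma not_crossing {i : ℕ} (hi : i < N) (hb : G.Adj (v N) (v i)) (ha : G.Adj (v 0) (v (i + 1))) :
    False := by
  have w := (h.walkOn_Icc (Nat.zero_le i) hi.le).join hb.symm
    (h.walkOn_Icc (i := i + 1) (j := N) (by omega) le_rfl).symm
    (by rw [Finset.disjoint_left]; simp; omega)
  refine hG (h.isHamiltonian_of_walkOn hN w ?_ ha.symm)
  ext x; simp; omega

lemma not_adj_of_succ_adj_of_pred_adj {i j : ℕ} (hij : i < j) (hj : j < N)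
    (ha : G.Adj (v 0) (v (i + 1))) (hb : G.Adj (v N) (v j)) : ¬ G.Adj (v i) (v (j + 1)) := by
  intro e
  have w := ((h.walkOn_Icc (Nat.zero_le i) (by omega)).join e
    (h.walkOn_Icc (i := j + 1) (j := N) (by omega) le_rfl)
    (by rw [Finset.disjoint_left]; simp; omega)).join hb
    (h.walkOn_Icc (i := i + 1) (j := j) (by omega) (by omega)).symm
    (by rw [Finset.disjoint_left]; simp; omega)
  refine hG (h.isHamiltonian_of_walkOn hN w ?_ ha.symm)
  ext x; simp; omega

lemma not_adj_of_succ_adj_of_succ_adj {i j : ℕ} (hij : i < j) (hj : j < N)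
    (hb : G.Adj (v N) (v (i + 1))) (ha : G.Adj (v 0) (v (j + 1))) : ¬ G.Adj (v i) (v j) := by
  intro e
  have w := ((h.walkOn_Icc (Nat.zero_le i) (by omega)).join e
    (h.walkOn_Icc (i := i + 1) (j := j) (by omega) (by omega)).symm
    (by rw [Finset.disjoint_left]; simp; omega)).join hb.symm
    (h.walkOn_Icc (i := j + 1) (j := N) (by omega) le_rfl).symm
    (by rw [Finset.disjoint_left]; simp; omega)
  refine hG (h.isHamiltonian_of_walkOn hN w ?_ ha.symm)
  ext x; simp; omega

lemma not_adj_of_pred_adj_of_pred_adj {i j : ℕ} (hij : i < j) (hj : j < N)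
    (hb : G.Adj (v N) (v i)) (ha : G.Adj (v 0) (v j)) : ¬ G.Adj (v (i + 1)) (v (j + 1)) := by
  intro e
  have w := ((h.walkOn_Icc (Nat.zero_le i) (by omega)).join hb.symm
    (h.walkOn_Icc (i := j + 1) (j := N) (by omega) le_rfl).symm
    (by rw [Finset.disjoint_left]; simp; omega)).join e.symm
    (h.walkOn_Icc (i := i + 1) (j := j) (by omega) (by omega))
    (by rw [Finset.disjoint_left]; simp; omega)
  refine hG (h.isHamiltonian_of_walkOn hN w ?_ ha.symm)
  ext x; simp; omega

lemma not_adj_of_interlaced {i p j : ℕ} (hip : i < p) (hpj : p < j) (hj : j < N)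
    (ha : G.Adj (v 0) (v (i + 1))) (hb : G.Adj (v N) (v j))
    (e : G.Adj (v i) (v (p + 1))) : ¬ G.Adj (v p) (v (j + 1)) := by
  intro e'
  have w := (((h.walkOn_Icc (Nat.zero_le i) (by omega)).join e
    (h.walkOn_Icc (i := p + 1) (j := j) (by omega) (by omega))
    (by rw [Finset.disjoint_left]; simp; omega)).join hb.symm
    (h.walkOn_Icc (i := j + 1) (j := N) (by omega) le_rfl).symm
    (by rw [Finset.disjoint_left]; simp; omega)).join e'.symm
    (h.walkOn_Icc (i := i + 1) (j := p) (by omega) (by omega)).symm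
    (by rw [Finset.disjoint_left]; simp; omega)
  refine hG (h.isHamiltonian_of_walkOn hN w ?_ ha.symm)
  ext x; simp; omega

lemma not_adj_consecutive_left {i k : ℕ} (hik : i < k) (hk : k + 1 < N)
    (hb : G.Adj (v N) (v k)) (ha : G.Adj (v 0) (v (k + 2)))
    (e : G.Adj (v i) (v (k + 1))) : ¬ G.Adj (v (i + 1)) (v (k + 1)) := by
  intro e'
  have w := (((h.walkOn_Icc (Nat.zero_le i) (by omega)).join e
    (h.walkOn_Icc (le_refl (k + 1)) (by omega))
    (by rw [Finset.disjoint_left]; simp; omega)).join e'.symm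
    (h.walkOn_Icc (i := i + 1) (j := k) (by omega) (by omega))
    (by rw [Finset.disjoint_left]; simp; omega)).join hb.symm
    (h.walkOn_Icc (i := k + 2) (j := N) (by omega) le_rfl).symm
    (by rw [Finset.disjoint_left]; simp; omega)
  refine hG (h.isHamiltonian_of_walkOn hN w ?_ ha.symm)
  ext x; simp; omega

lemma not_adj_consecutive_right {i k : ℕ} (hik : k + 2 ≤ i) (hi : i < N)
    (hb : G.Adj (v N) (v k)) (ha : G.Adj (v 0) (v (k + 2)))
    (e : G.Adj (v i) (v (k + 1))) : ¬ G.Adj (v (i + 1)) (v (k + 1)) := by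
  intro e'
  have w := (((h.walkOn_Icc (Nat.zero_le k) (by omega)).join hb.symm
    (h.walkOn_Icc (i := i + 1) (j := N) (by omega) (by omega)).symm
    (by rw [Finset.disjoint_left]; simp; omega)).join e'
    (h.walkOn_Icc (le_refl (k + 1)) (by omega))
    (by rw [Finset.disjoint_left]; simp; omega)).join e.symm
    (h.walkOn_Icc (i := k + 2) (j := i) (by omega) (by omega)).symm
    (by rw [Finset.disjoint_left]; simp; omega)
  refine hG (h.isHamiltonian_of_walkOn hN w ?_ ha.symm)
  ext x; simp; omega

end Nonhamiltonian

section Inner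

omit [Fintype V] [DecidableEq V] in
lemma apply_inj (h : G.IsHamPathSeq v N) {i j : ℕ} (hi : i ≤ N) (hj : j ≤ N) (e : v i = v j) :
    i = j := h.inj hi hj e

/-- The index `j` is inner if `v j` lies strictly between two consecutive path vertices, the former
adjacent to the last and the latter adjacent to the first vertex of the path. -/
def Inner (G : SimpleGraph V) (v : ℕ → V) (N j : ℕ) : Prop :=
  0 < j ∧ j < N ∧ G.Adj (v N) (v (j - 1)) ∧ G.Adj (v 0) (v (j + 1))

open Classical in
/-- The indices `i` for which neither `v i` is adjacent to the last nor `v (i + 1)` is adjacent to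
the first vertex of the path. -/
noncomputable def gaps (G : SimpleGraph V) (v : ℕ → V) (N : ℕ) : Finset ℕ :=
  {i ∈ Finset.range N | ¬ G.Adj (v N) (v i) ∧ ¬ G.Adj (v 0) (v (i + 1))}

open Classical in
/-- The inner indices of a path. -/
noncomputable def inners (G : SimpleGraph V) (v : ℕ → V) (N : ℕ) : Finset ℕ :=
  {i ∈ Finset.range N | Inner G v N i}

open Classical in
/-- The indices of neighbours of inner vertices to the left of these. -/
noncomputable def leftNbrs (G : SimpleGraph V) (v : ℕ → V) (N : ℕ) : Finset ℕ :=
  {i ∈ Finset.range N | ∃ j, Inner G v N j ∧ i < j ∧ G.Adj (v i) (v j)}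

open Classical in
/-- The indices of neighbours of inner vertices to the right of these. -/
noncomputable def rightNbrs (G : SimpleGraph V) (v : ℕ → V) (N : ℕ) : Finset ℕ :=
  {i ∈ Finset.range (N + 1) | ∃ j, Inner G v N j ∧ j < i ∧ G.Adj (v i) (v j)}

variable (h : G.IsHamPathSeq v N) (hN : 2 ≤ N) (hG : ¬ G.IsHamiltonian)
include h hN hG

lemma not_adj_ends_of_inner {j : ℕ} (hj : Inner G v N j) :
    ¬ G.Adj (v 0) (v j) ∧ ¬ G.Adj (v N) (v j) := by
  obtain ⟨h0, hjN, hb, ha⟩ := hj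
  refine ⟨fun e ↦ h.not_crossing hN hG (i := j - 1) (by omega) hb ?_,
    fun e ↦ h.not_crossing hN hG hjN e ha⟩
  rwa [Nat.sub_add_cancel h0]

lemma not_adj_ends_of_left {i j : ℕ} (hj : Inner G v N j) (hij : i < j)
    (e : G.Adj (v i) (v j)) : ¬ G.Adj (v 0) (v (i + 1)) ∧ ¬ G.Adj (v N) (v (i + 1)) := by
  obtain rfl | hij' := (show i + 1 ≤ j from hij).eq_or_lt
  · exact h.not_adj_ends_of_inner hN hG hj
  obtain ⟨h0, hjN, hb, ha⟩ := hj
  refine ⟨fun e' ↦ ?_, fun e' ↦ h.not_adj_of_succ_adj_of_succ_adj hN hG hij hjN e' ha e⟩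
  refine h.not_adj_of_succ_adj_of_pred_adj hN hG (i := i) (j := j - 1) (by omega) (by omega)
    e' hb ?_
  rwa [Nat.sub_add_cancel h0]

lemma not_adj_ends_of_right {i j : ℕ} (hj : Inner G v N j) (hij : j < i) (hi : i ≤ N)
    (e : G.Adj (v i) (v j)) : ¬ G.Adj (v 0) (v (i - 1)) ∧ ¬ G.Adj (v N) (v (i - 1)) := by
  obtain ⟨i, rfl⟩ : ∃ k, i = k + 1 := ⟨i - 1, by omega⟩
  rw [Nat.add_sub_cancel]
  obtain rfl | hij' := (show j ≤ i by omega).eq_or_lt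
  · exact h.not_adj_ends_of_inner hN hG hj
  obtain ⟨h0, hjN, hb, ha⟩ := hj
  refine ⟨fun e' ↦ ?_, fun e' ↦
    h.not_adj_of_succ_adj_of_pred_adj hN hG hij' (by omega) ha e' e.symm⟩
  refine h.not_adj_of_pred_adj_of_pred_adj hN hG (i := j - 1) (j := i) (by omega) (by omega)
    hb e' ?_
  rw [Nat.sub_add_cancel h0]
  exact e.symm

lemma not_adj_inner {i j : ℕ} (hi : Inner G v N i) (hj : Inner G v N j) :
    ¬ G.Adj (v i) (v j) := by
  intro e
  rcases lt_trichotomy i j with hij | rfl | hij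
  · exact (h.not_adj_ends_of_left hN hG hj hij e).1 hi.2.2.2
  · exact e.ne rfl
  · exact (h.not_adj_ends_of_left hN hG hi hij e.symm).1 hj.2.2.2

lemma succ_notMem_rightNbrs {i : ℕ} (hi : i ∈ leftNbrs G v N) : i + 1 ∉ rightNbrs G v N := by
  intro hi'
  simp only [leftNbrs, rightNbrs, Finset.mem_filter, Finset.mem_range] at hi hi'
  obtain ⟨-, j, hj, hij, e⟩ := hi
  obtain ⟨-, k, hk, hki, e'⟩ := hi'
  obtain rfl | hki := (show k ≤ i by omega).eq_or_lt
  · exact h.not_adj_inner hN hG hk hj e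
  have := hj.1
  have := hj.2.1
  refine h.not_adj_of_interlaced hN hG (i := k) (p := i) (j := j - 1) hki ?_ (by omega)
    hk.2.2.2 hj.2.2.1 e'.symm ?_
  · obtain rfl | hne := (show i + 1 ≤ j from hij).eq_or_lt
    · exact absurd e'.symm (h.not_adj_inner hN hG hk hj)
    · omega
  · rwa [Nat.sub_add_cancel hj.1]

lemma card_leftNbrs_add_card_rightNbrs_le :
    (leftNbrs G v N).card + (rightNbrs G v N).card ≤
      2 * (inners G v N).card + 3 * (gaps G v N).card := by
  classical
  set D := inners G v N with hD
  set M := gaps G v N with hM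
  set L := leftNbrs G v N with hL
  set R := rightNbrs G v N with hR
  have hLsub : L ⊆ D.image (· - 1) ∪ M.filter (· ∈ L) ∪ M.image (· - 1) := by
    intro i hi
    have hi' := hi
    simp only [hL, leftNbrs, Finset.mem_filter, Finset.mem_range] at hi'
    obtain ⟨-, j, hj, hij, e⟩ := hi'
    obtain ⟨na, nb⟩ := h.not_adj_ends_of_left hN hG hj hij e
    have := hj.2.1
    simp only [Finset.mem_union, Finset.mem_image, Finset.mem_filter]
    by_cases hb : G.Adj (v N) (v i)
    · by_cases ha : G.Adj (v 0) (v (i + 2))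
      · refine .inl (.inl ⟨i + 1, ?_, by omega⟩)
        simp only [hD, inners, Finset.mem_filter, Finset.mem_range]
        exact ⟨by omega, by omega, by omega, hb, ha⟩
      · refine .inr ⟨i + 1, ?_, by omega⟩
        simp only [hM, gaps, Finset.mem_filter, Finset.mem_range]
        exact ⟨by omega, nb, ha⟩
    · refine .inl (.inr ⟨?_, hi⟩)
      simp only [hM, gaps, Finset.mem_filter, Finset.mem_range]
      exact ⟨by omega, hb, na⟩
  have hRsub : R ⊆ D.image (· + 1) ∪ (M.filter (· + 1 ∈ R)).image (· + 1) ∪ M.image (· + 2) := by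
    intro i hi
    have hi' := hi
    simp only [hR, rightNbrs, Finset.mem_filter, Finset.mem_range] at hi'
    obtain ⟨hiN, j, hj, hij, e⟩ := hi'
    obtain ⟨na, nb⟩ := h.not_adj_ends_of_right hN hG hj hij (by omega) e
    have := hj.1
    obtain ⟨i, rfl⟩ : ∃ k, i = k + 2 := ⟨i - 2, by omega⟩
    rw [show i + 2 - 1 = i + 1 by omega] at na nb
    simp only [Finset.mem_union, Finset.mem_image, Finset.mem_filter]
    by_cases ha : G.Adj (v 0) (v (i + 2))
    · by_cases hb : G.Adj (v N) (v i)
      · refine .inl (.inl ⟨i + 1, ?_, by omega⟩)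
        simp only [hD, inners, Finset.mem_filter, Finset.mem_range]
        exact ⟨by omega, by omega, by omega, hb, ha⟩
      · refine .inr ⟨i, ?_, by omega⟩
        simp only [hM, gaps, Finset.mem_filter, Finset.mem_range]
        exact ⟨by omega, hb, na⟩
    · refine .inl (.inr ⟨i + 1, ⟨?_, hi⟩, by omega⟩)
      simp only [hM, gaps, Finset.mem_filter, Finset.mem_range]
      exact ⟨by omega, nb, ha⟩
  have hdisj : Disjoint (M.filter (· ∈ L)) (M.filter (· + 1 ∈ R)) := by
    rw [Finset.disjoint_left]
    intro i hi hi'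
    exact h.succ_notMem_rightNbrs hN hG (Finset.mem_filter.1 hi).2 (Finset.mem_filter.1 hi').2
  have hMc : (M.filter (· ∈ L)).card + (M.filter (· + 1 ∈ R)).card ≤ M.card := by
    rw [← Finset.card_union_of_disjoint hdisj]
    exact Finset.card_le_card (Finset.union_subset (Finset.filter_subset _ _)
      (Finset.filter_subset _ _))
  have h1 := Finset.card_le_card hLsub
  have h2 := Finset.card_le_card hRsub
  have := Finset.card_union_le (D.image (· - 1) ∪ M.filter (· ∈ L)) (M.image (· - 1))
  have := Finset.card_union_le (D.image (· - 1)) (M.filter (· ∈ L))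
  have := Finset.card_union_le (D.image (· + 1) ∪ (M.filter (· + 1 ∈ R)).image (· + 1))
    (M.image (· + 2))
  have := Finset.card_union_le (D.image (· + 1)) ((M.filter (· + 1 ∈ R)).image (· + 1))
  have := Finset.card_image_le (s := D) (f := (· - 1))
  have := Finset.card_image_le (s := D) (f := (· + 1))
  have := Finset.card_image_le (s := M) (f := (· - 1))
  have := Finset.card_image_le (s := M) (f := (· + 2))
  have := Finset.card_image_le (s := M.filter (· + 1 ∈ R)) (f := (· + 1))
  omega

lemma card_range_eq_degree_add_degree_add_card_gaps [DecidableRel G.Adj] :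
    N = G.degree (v 0) + G.degree (v N) + (gaps G v N).card := by
  classical
  have h0 : G.degree (v 0) = ((Finset.range N).filter fun i ↦ G.Adj (v 0) (v (i + 1))).card := by
    rw [← card_neighborFinset_eq_degree]
    symm
    refine Finset.card_bij (fun i _ ↦ v (i + 1)) ?_ ?_ ?_
    · intro i hi
      simpa using (Finset.mem_filter.1 hi).2
    · intro i hi j hj e
      have hi := Finset.mem_range.1 (Finset.mem_filter.1 hi).1
      have hj := Finset.mem_range.1 (Finset.mem_filter.1 hj).1
      have := h.apply_inj (by omega) (by omega) e
      omega
    · intro w hw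
      obtain ⟨i, hi, rfl⟩ := h.surj w
      rw [mem_neighborFinset] at hw
      obtain ⟨i, rfl⟩ : ∃ k, i = k + 1 := by
        cases i with
        | zero => exact absurd rfl hw.ne
        | succ k => exact ⟨k, rfl⟩
      exact ⟨i, by simp [hw]; omega, rfl⟩
  have hN' : G.degree (v N) = ((Finset.range N).filter fun i ↦ G.Adj (v N) (v i)).card := by
    rw [← card_neighborFinset_eq_degree]
    symm
    refine Finset.card_bij (fun i _ ↦ v i) ?_ ?_ ?_
    · intro i hi
      simpa using (Finset.mem_filter.1 hi).2
    · intro i hi j hj e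
      have hi := Finset.mem_range.1 (Finset.mem_filter.1 hi).1
      have hj := Finset.mem_range.1 (Finset.mem_filter.1 hj).1
      exact h.apply_inj (by omega) (by omega) e
    · intro w hw
      obtain ⟨i, hi, rfl⟩ := h.surj w
      rw [mem_neighborFinset] at hw
      have : i ≠ N := by rintro rfl; exact hw.ne rfl
      exact ⟨i, by simp [hw]; omega, rfl⟩
  have hdisj : Disjoint ((Finset.range N).filter fun i ↦ G.Adj (v 0) (v (i + 1)))
      ((Finset.range N).filter fun i ↦ G.Adj (v N) (v i)) := by
    rw [Finset.disjoint_left]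
    intro i hi hi'
    simp only [Finset.mem_filter, Finset.mem_range] at hi hi'
    exact h.not_crossing hN hG hi.1 hi'.2 hi.2
  have hdisj' : Disjoint (((Finset.range N).filter fun i ↦ G.Adj (v 0) (v (i + 1))) ∪
      ((Finset.range N).filter fun i ↦ G.Adj (v N) (v i))) (gaps G v N) := by
    rw [Finset.disjoint_left]
    intro i hi hi'
    simp only [gaps, Finset.mem_union, Finset.mem_filter, Finset.mem_range] at hi hi'
    tauto
  rw [h0, hN', ← Finset.card_union_of_disjoint hdisj, ← Finset.card_union_of_disjoint hdisj']
  conv_lhs => rw [← Finset.card_range N]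
  congr 1
  ext i
  simp only [gaps, Finset.mem_union, Finset.mem_filter, Finset.mem_range]
  tauto

lemma degree_le_card_inners_add_card_gaps [DecidableRel G.Adj] {k : ℕ} (hk : Inner G v N k) :
    G.degree (v k) ≤ (inners G v N).card + (gaps G v N).card + 1 := by
  classical
  set D := inners G v N with hD
  set M := gaps G v N with hM
  set L := (Finset.range k).filter fun i ↦ G.Adj (v i) (v k) with hL
  set R := (Finset.Ioc k N).filter fun i ↦ G.Adj (v i) (v k) with hR
  have hk0 := hk.1
  have hkN := hk.2.1
  have hdeg : G.degree (v k) ≤ L.card + R.card := by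
    rw [← card_neighborFinset_eq_degree]
    refine (Finset.card_le_card (t := (L ∪ R).image v) ?_).trans
      (Finset.card_image_le.trans (Finset.card_union_le _ _))
    intro w hw
    obtain ⟨i, hi, rfl⟩ := h.surj w
    rw [mem_neighborFinset] at hw
    have hne : i ≠ k := by rintro rfl; exact hw.ne rfl
    refine Finset.mem_image_of_mem v ?_
    simp only [hL, hR, Finset.mem_union, Finset.mem_filter, Finset.mem_range, Finset.mem_Ioc]
    have := hw.symm
    rcases hne.lt_or_gt with hlt | hlt
    · exact .inl ⟨hlt, this⟩
    · exact .inr ⟨⟨hlt, hi⟩, this⟩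
  set W := L.image (· + 1) ∪ R.image (· - 1) with hW
  have hmemW : ∀ p, p ∈ W ↔ (0 < p ∧ p ≤ k ∧ G.Adj (v (p - 1)) (v k)) ∨
      (k ≤ p ∧ p < N ∧ G.Adj (v (p + 1)) (v k)) := by
    intro p
    simp only [hW, hL, hR, Finset.mem_union, Finset.mem_image, Finset.mem_filter,
      Finset.mem_range, Finset.mem_Ioc]
    constructor
    · rintro (⟨i, ⟨hi, e⟩, rfl⟩ | ⟨i, ⟨hi, e⟩, rfl⟩)
      · exact .inl ⟨by omega, by omega, by simpa using e⟩
      · exact .inr ⟨by omega, by omega, by rwa [Nat.sub_add_cancel (by omega)]⟩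
    · rintro (⟨h0, hp, e⟩ | ⟨hp, hpN, e⟩)
      · exact .inl ⟨p - 1, ⟨by omega, e⟩, by omega⟩
      · exact .inr ⟨p + 1, ⟨by omega, e⟩, by omega⟩
  have hinter : (L.image (· + 1) ∩ R.image (· - 1)).card ≤ 1 := by
    refine (Finset.card_le_card (t := {k}) fun p hp ↦ ?_).trans (by simp)
    simp only [hL, hR, Finset.mem_inter, Finset.mem_image, Finset.mem_filter,
      Finset.mem_range, Finset.mem_Ioc] at hp
    obtain ⟨⟨i, hi, rfl⟩, j, hj, hij⟩ := hp
    simp only [Finset.mem_singleton]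
    omega
  have hcL : (L.image (· + 1)).card = L.card :=
    Finset.card_image_of_injective _ (add_left_injective 1)
  have hcR : (R.image (· - 1)).card = R.card := by
    refine Finset.card_image_of_injOn fun i hi j hj e ↦ ?_
    simp only [hR, Finset.coe_filter, Finset.mem_Ioc, Set.mem_ofPred_eq] at hi hj
    change i - 1 = j - 1 at e
    omega
  have hcW := Finset.card_union_add_card_inter (L.image (· + 1)) (R.image (· - 1))
  rw [← hW] at hcW
  have hcons : ∀ p ∈ W, p + 1 ∉ W := by
    intro p hp hp'
    rw [hmemW] at hp hp'
    obtain ⟨k, rfl⟩ : ∃ l, k = l + 1 := ⟨k - 1, by omega⟩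
    have hb := hk.2.2.1
    have ha := hk.2.2.2
    simp only [Nat.add_sub_cancel] at hb
    have key : ∀ i, i < k → G.Adj (v i) (v (k + 1)) → ¬ G.Adj (v (i + 1)) (v (k + 1)) :=
      fun i hi e ↦ h.not_adj_consecutive_left hN hG hi hkN hb ha e
    have key' : ∀ i, k + 2 ≤ i → i < N → G.Adj (v i) (v (k + 1)) →
        ¬ G.Adj (v (i + 1)) (v (k + 1)) :=
      fun i hi hi' e ↦ h.not_adj_consecutive_right hN hG hi hi' hb ha e
    have hadj := h.adj (k + 1) hkN
    have hadj' := h.adj k (by omega)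
    rcases hp with ⟨h0, hpk, e⟩ | ⟨hpk, hpN, e⟩
    · obtain ⟨p, rfl⟩ : ∃ l, p = l + 1 := ⟨p - 1, by omega⟩
      rw [Nat.add_sub_cancel] at e
      rcases hp' with ⟨-, hpk', e'⟩ | ⟨hpk', hpN', e'⟩
      · exact key p (by omega) e (by simpa using e')
      · rcases (show p = k ∨ p + 1 = k by omega) with rfl | rfl
        · exact key' (p + 2) (by omega) (by omega) hadj.symm e'
        · exact key p (by omega) e hadj'
    · rcases hp' with ⟨-, hpk', e'⟩ | ⟨hpk', hpN', e'⟩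
      · omega
      · exact key' (p + 1) (by omega) (by omega) e e'
  have hWsub : W ⊆ D ∪ M.filter (· ∈ W) ∪ (M.filter (· + 1 ∈ W)).image (· + 1) := by
    intro p hp
    have hp' := hp
    rw [hmemW] at hp'
    have hfacts : 0 < p ∧ p < N ∧ ¬ G.Adj (v 0) (v p) ∧ ¬ G.Adj (v N) (v p) := by
      rcases hp' with ⟨h0, hpk, e⟩ | ⟨hpk, hpN, e⟩
      · have := h.not_adj_ends_of_left hN hG hk (i := p - 1) (by omega) e
        rw [Nat.sub_add_cancel h0] at this
        exact ⟨h0, by omega, this⟩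
      · exact ⟨by omega, hpN,
          h.not_adj_ends_of_right hN hG hk (i := p + 1) (by omega) (by omega) e⟩
    obtain ⟨h0, hpN, na, nb⟩ := hfacts
    simp only [Finset.mem_union, Finset.mem_image, Finset.mem_filter]
    by_cases ha : G.Adj (v 0) (v (p + 1))
    · by_cases hb : G.Adj (v N) (v (p - 1))
      · refine .inl (.inl ?_)
        simp only [hD, inners, Finset.mem_filter, Finset.mem_range]
        exact ⟨hpN, h0, hpN, hb, ha⟩
      · refine .inr ⟨p - 1, ⟨?_, by rwa [Nat.sub_add_cancel h0]⟩, by omega⟩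
        simp only [hM, gaps, Finset.mem_filter, Finset.mem_range]
        exact ⟨by omega, hb, by rwa [Nat.sub_add_cancel h0]⟩
    · refine .inl (.inr ⟨?_, hp⟩)
      simp only [hM, gaps, Finset.mem_filter, Finset.mem_range]
      exact ⟨hpN, nb, ha⟩
  have hMc : (M.filter (· ∈ W)).card + (M.filter (· + 1 ∈ W)).card ≤ M.card := by
    rw [← Finset.card_union_of_disjoint]
    · exact Finset.card_le_card (Finset.union_subset (Finset.filter_subset _ _)
        (Finset.filter_subset _ _))
    · rw [Finset.disjoint_left]
      intro i hi hi'
      exact hcons i (Finset.mem_filter.1 hi).2 (Finset.mem_filter.1 hi').2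
  have h1 := Finset.card_le_card hWsub
  have := Finset.card_union_le (D ∪ M.filter (· ∈ W)) ((M.filter (· + 1 ∈ W)).image (· + 1))
  have := Finset.card_union_le D (M.filter (· ∈ W))
  have := Finset.card_image_le (s := M.filter (· + 1 ∈ W)) (f := (· + 1))
  omega

/-- In a nonhamiltonian `t`-tough graph, `t > 3`, the ends of a Hamiltonian path with an inner
vertex have degree sum less than `N + 1 - t`. -/
theorem degree_add_degree_lt [DecidableRel G.Adj] {t : ℚ} (ht : 3 < t) (htough : G.Tough t) {k : ℕ}
    (hk : Inner G v N k) :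
    (G.degree (v 0) : ℚ) + G.degree (v N) < N + 1 - t := by
  classical
  by_contra hcon
  have hk0 := hk.1
  have hkN := hk.2.1
  have hsum := h.card_range_eq_degree_add_degree_add_card_gaps hN hG
  have hdeg := h.degree_le_card_inners_add_card_gaps hN hG hk
  have hNb := h.card_leftNbrs_add_card_rightNbrs_le hN hG
  have hdeg2 : t * (((({v k} : Finset V)).card : ℚ) + 1) ≤ (G.neighborFinset (v k)).card := by
    refine htough.mul_card_add_one_le (by linarith) (u := v 0) ?_ ?_ (by simp) (by simp) (by simp)
    · rw [mem_neighborFinset]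
      exact fun e ↦ (h.not_adj_ends_of_inner hN hG hk).1 e.symm
    · rw [Finset.mem_singleton]
      intro e
      have := h.apply_inj (by omega) (by omega) e
      omega
  have hcut : t * ((((inners G v N).image v).card : ℚ) + 1) ≤
      ((leftNbrs G v N ∪ rightNbrs G v N).image v).card := by
    have hinner : ∀ i, i ∈ inners G v N → Inner G v N i := fun i hi ↦ (Finset.mem_filter.1 hi).2
    have hmem : ∀ i, i ∈ leftNbrs G v N ∪ rightNbrs G v N →
        i ≤ N ∧ ∃ j, Inner G v N j ∧ G.Adj (v i) (v j) := by
      intro i hi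
      simp only [leftNbrs, rightNbrs, Finset.mem_union, Finset.mem_filter, Finset.mem_range] at hi
      rcases hi with ⟨hi, j, hj, -, e⟩ | ⟨hi, j, hj, -, e⟩
      · exact ⟨by omega, j, hj, e⟩
      · exact ⟨by omega, j, hj, e⟩
    refine htough.mul_card_add_one_le (by linarith) (u := v 0) ?_ ?_ ?_ ?_ ?_
    · intro h0
      obtain ⟨i, hi, e⟩ := Finset.mem_image.1 h0
      obtain ⟨-, j, hj, e'⟩ := hmem i hi
      rw [e] at e'
      exact (h.not_adj_ends_of_inner hN hG hj).1 e'
    · intro h0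
      obtain ⟨i, hi, e⟩ := Finset.mem_image.1 h0
      have hi := hinner i hi
      have := h.apply_inj hi.2.1.le (by omega) e
      have := hi.1
      omega
    · rw [Finset.disjoint_left]
      intro w hw hw'
      obtain ⟨i, hi, rfl⟩ := Finset.mem_image.1 hw
      obtain ⟨j, hj, e⟩ := Finset.mem_image.1 hw'
      obtain ⟨-, l, hl, e'⟩ := hmem j hj
      rw [e] at e'
      exact h.not_adj_inner hN hG (hinner i hi) hl e'
    · exact ⟨v k, Finset.mem_image_of_mem v (Finset.mem_filter.2 ⟨by simpa using hkN, hk⟩)⟩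
    · intro w hw w' e
      obtain ⟨j, hj, rfl⟩ := Finset.mem_image.1 hw
      obtain ⟨i, hi, rfl⟩ := h.surj w'
      have hj := hinner j hj
      refine Finset.mem_image_of_mem v ?_
      simp only [leftNbrs, rightNbrs, Finset.mem_union, Finset.mem_filter, Finset.mem_range]
      have hjN := hj.2.1
      rcases lt_trichotomy i j with hij | rfl | hij
      · exact .inl ⟨by omega, j, hj, hij, e.symm⟩
      · exact absurd rfl e.ne
      · exact .inr ⟨by omega, j, hj, hij, e.symm⟩
  have hDcard : ((inners G v N).image v).card = (inners G v N).card := by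
    refine Finset.card_image_of_injOn fun i hi j hj e ↦ h.apply_inj ?_ ?_ e
    · exact (Finset.mem_range.1 (Finset.mem_filter.1 hi).1).le
    · exact (Finset.mem_range.1 (Finset.mem_filter.1 hj).1).le
  have hScard : ((leftNbrs G v N ∪ rightNbrs G v N).image v).card ≤
      2 * (inners G v N).card + 3 * (gaps G v N).card :=
    Finset.card_image_le.trans ((Finset.card_union_le _ _).trans hNb)
  rw [hDcard] at hcut
  rw [card_neighborFinset_eq_degree, Finset.card_singleton] at hdeg2
  have hScard' : (((leftNbrs G v N ∪ rightNbrs G v N).image v).card : ℚ) ≤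
      2 * (inners G v N).card + 3 * (gaps G v N).card := by exact_mod_cast hScard
  have hsum' : (N : ℚ) = G.degree (v 0) + G.degree (v N) + (gaps G v N).card := by
    exact_mod_cast hsum
  have hdeg' : (G.degree (v k) : ℚ) ≤ (inners G v N).card + (gaps G v N).card + 1 := by
    exact_mod_cast hdeg
  push_cast at hdeg2
  have hgap : ((gaps G v N).card : ℚ) ≤ t - 1 := by linarith
  have hinn : t ≤ (inners G v N).card := by linarith
  nlinarith

end Inner

end IsHamPathSeq


/-- The sequence that follows an oriented cycle `c` of `G - z` from the successor of `c i`, moves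
through `z` after `k` steps, and then follows the cycle backwards from `c i`. -/
def splicedSeq {V : Type*} {z : V} {m : ℕ} (c : ZMod m → {u : V // u ≠ z}) (i : ZMod m) (k p : ℕ) :
    V :=
  if p < k then (c (i + 1 + p)).1 else if p = k then z else (c (i - (p - k - 1 : ℕ))).1

lemma isHamPathSeq_splicedSeq {V : Type*} [Fintype V] {G : SimpleGraph V} {z : V} {m : ℕ}
    [NeZero m] (c : ZMod m ≃ {u : V // u ≠ z})
    (hC : ∀ i : ZMod m, G.Adj (c i).1 (c (i + 1)).1) {i j : ZMod m} (hij : i ≠ j)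
    (hi : G.Adj z (c i)) (hj : G.Adj z (c j)) :
    G.IsHamPathSeq (splicedSeq c i (j - i).val) m := by
  classical
  set k := (j - i).val with hk
  have hkm : k < m := ZMod.val_lt _
  have hkj : ((k : ℕ) : ZMod m) = j - i := ZMod.natCast_zmod_val _
  have hk0 : 0 < k := by
    rw [hk, Nat.pos_iff_ne_zero, ne_eq, ZMod.val_eq_zero, sub_eq_zero]
    exact hij.symm
  have hsurj : ∀ w, ∃ p ≤ m, splicedSeq c i k p = w := by
    intro w
    by_cases hw : w = z
    · exact ⟨k, hkm.le, by simp [splicedSeq, hw]⟩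
    obtain ⟨r, hr⟩ := c.surjective ⟨w, hw⟩
    set s := (r - i - 1).val with hs
    have hsm : s < m := ZMod.val_lt _
    have hsr : ((s : ℕ) : ZMod m) = r - i - 1 := ZMod.natCast_zmod_val _
    by_cases hsk : s < k
    · refine ⟨s, hsm.le, ?_⟩
      rw [splicedSeq, if_pos hsk, hsr, show i + 1 + (r - i - 1) = r by ring, hr]
    · refine ⟨k + m - s, by omega, ?_⟩
      rw [splicedSeq, if_neg (by omega), if_neg (by omega),
        show k + m - s - k - 1 = m - (s + 1) by omega, Nat.cast_sub (by omega)]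
      push_cast
      rw [hsr, ZMod.natCast_self, show i - (0 - (r - i - 1 + 1)) = r by ring, hr]
  refine ⟨fun p hp ↦ ?_, ?_, hsurj⟩
  · rcases lt_trichotomy (p + 1) k with h | h | h
    · rw [splicedSeq, splicedSeq, if_pos (by omega), if_pos h]
      have := hC (i + 1 + p)
      push_cast
      rwa [add_assoc (i + 1)] at this
    · rw [splicedSeq, splicedSeq, if_pos (by omega), if_neg (by omega), if_pos h]
      have : i + 1 + (p : ZMod m) = j := by
        rw [← h] at hkj
        push_cast at hkj
        linear_combination hkj
      rw [this]
      exact hj.symm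
    · rcases (show k ≤ p by omega).eq_or_lt with h' | h'
      · rw [splicedSeq, splicedSeq, if_neg (by omega), if_pos h'.symm, if_neg (by omega),
          if_neg (by omega), show p + 1 - k - 1 = 0 by omega]
        simpa using hi
      · rw [splicedSeq, splicedSeq, if_neg (by omega), if_neg (by omega), if_neg (by omega),
          if_neg (by omega), show p + 1 - k - 1 = p - k - 1 + 1 by omega]
        have := (hC (i - (p - k - 1 + 1 : ℕ))).symm
        rwa [show i - ((p - k - 1 + 1 : ℕ) : ZMod m) + 1 = i - (p - k - 1 : ℕ) by
          push_cast; ring] at this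
  · have hcard : Fintype.card V = m + 1 := by
      have h1 := Fintype.card_congr c
      rw [ZMod.card, Fintype.card_subtype_compl, Fintype.card_subtype_eq] at h1
      have : 0 < Fintype.card V := Fintype.card_pos_iff.2 ⟨z⟩
      omega
    have himage : (Finset.Iic m).image (splicedSeq c i k) = Finset.univ := by
      ext w
      obtain ⟨p, hp, rfl⟩ := hsurj w
      simpa using ⟨p, hp, rfl⟩
    have := Finset.injOn_of_card_image_eq (s := Finset.Iic m) (f := splicedSeq c i k)
      (by rw [himage, Finset.card_univ, hcard, Nat.card_Iic])
    simpa using this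

end SimpleGraph

/-- If `G` is `t`-tough (`t ≥ 4` rational) on `n ≥ 3` vertices, not Hamiltonian,
and `G − z` has a Hamilton cycle `C` (oriented, encoded by `c`), then for any
two distinct neighbors `x, y` of `z` we have `deg(x⁺) + deg(y⁺) < n − t`. -/
theorem successor_degree_sum_lt
    {V : Type*} [Fintype V] [DecidableEq V] (G : SimpleGraph V) [DecidableRel G.Adj]
    (n : ℕ) (t : ℚ) (ht : 4 ≤ t) (hn : Fintype.card V = n) (hn3 : 3 ≤ n)
    (htough : SimpleGraph.Tough t G) (hnotham : ¬ G.IsHamiltonian)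
    (z : V) (m : ℕ) (hm : 3 ≤ m) (c : ZMod m ≃ {u : V // u ≠ z})
    (hC : ∀ i : ZMod m, G.Adj (c i).1 (c (i + 1)).1)
    (x y : V) (hx : G.Adj z x) (hy : G.Adj z y) (hne : x ≠ y) :
    (G.degree (cycNext c x) : ℚ) + (G.degree (cycNext c y) : ℚ) < (n : ℚ) - t := by
  have : NeZero m := ⟨by omega⟩
  obtain ⟨i, hi⟩ := c.surjective ⟨x, hx.ne'⟩
  obtain ⟨j, hj⟩ := c.surjective ⟨y, hy.ne'⟩
  have hxi : cycNext c x = (c (i + 1)).1 := by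
    rw [cycNext, dif_neg hx.ne', ← hi, Equiv.symm_apply_apply]
  have hyj : cycNext c y = (c (j + 1)).1 := by
    rw [cycNext, dif_neg hy.ne', ← hj, Equiv.symm_apply_apply]
  have hij : i ≠ j := by
    rintro rfl
    exact hne (congrArg Subtype.val (hi.symm.trans hj))
  have hpath := SimpleGraph.isHamPathSeq_splicedSeq c hC hij (by rwa [hi]) (by rwa [hj])
  set k := (j - i).val with hk
  have hkm : k < m := ZMod.val_lt _
  have hkj : ((k : ℕ) : ZMod m) = j - i := ZMod.natCast_zmod_val _
  have hk0 : 0 < k := by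
    rw [hk, Nat.pos_iff_ne_zero, ne_eq, ZMod.val_eq_zero, sub_eq_zero]
    exact hij.symm
  have h0 : SimpleGraph.splicedSeq c i k 0 = (c (i + 1)).1 := by
    rw [SimpleGraph.splicedSeq, if_pos hk0, Nat.cast_zero, add_zero]
  have hm' : SimpleGraph.splicedSeq c i k m = (c (j + 1)).1 := by
    rw [SimpleGraph.splicedSeq, if_neg (by omega), if_neg (by omega),
      show m - k - 1 = m - (k + 1) by omega, Nat.cast_sub (by omega)]
    push_cast
    rw [hkj, ZMod.natCast_self, show i - (0 - (j - i + 1)) = j + 1 by ring]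
  have hpred : SimpleGraph.splicedSeq c i k (k - 1) = (c j).1 := by
    rw [SimpleGraph.splicedSeq, if_pos (by omega), Nat.cast_sub (by omega), hkj, Nat.cast_one,
      show i + 1 + (j - i - 1) = j by ring]
  have hsucc : SimpleGraph.splicedSeq c i k (k + 1) = (c i).1 := by
    rw [SimpleGraph.splicedSeq, if_neg (by omega), if_neg (by omega),
      show k + 1 - k - 1 = 0 by omega, Nat.cast_zero, sub_zero]
  have hinner : SimpleGraph.IsHamPathSeq.Inner G (SimpleGraph.splicedSeq c i k) m k := by
    refine ⟨hk0, hkm, ?_, ?_⟩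
    · rw [hm', hpred]
      exact (hC j).symm
    · rw [h0, hsucc]
      exact (hC i).symm
  have hlt := hpath.degree_add_degree_lt (by omega) hnotham (by linarith) htough hinner
  have hcard : (n : ℚ) = m + 1 := by
    rw [← hn, hpath.card_eq]
    push_cast
    rfl
  rw [h0, hm'] at hlt
  rw [hxi, hyj, hcard]
  exact hlt
end

section
/- With G, n, t, the labeling v_1, …, v_n and U^α as in the setup: let α < n/2 be a positive integer such that for every i ∈ [1, n], d_i < α − t implies d_i ≥ i − t + 1. Then U^α = {v_i : d_i ≥ n − α} is a universal clique of G, i.e., every vertex of U^α is adjacent to every other vertex of G. -/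
/-- In an enumeration of the vertices by non-decreasing degree, if at least `i` vertices have
degree at most `k`, then so does the `i`-th one. -/
theorem SimpleGraph.degree_le_of_le_card {V : Type*} [Fintype V] [DecidableEq V]
    (G : SimpleGraph V) [DecidableRel G.Adj] {n : ℕ} {v : ℕ → V}
    (hsurj : Set.SurjOn v (Set.Icc 1 n) Set.univ)
    (hmono : ∀ i j, 1 ≤ i → i ≤ j → j ≤ n → G.degree (v i) ≤ G.degree (v j))
    {i k : ℕ} (hi : 1 ≤ i) {W : Finset V} (hW : i ≤ W.card)
    (hdeg : ∀ x ∈ W, G.degree x ≤ k) : G.degree (v i) ≤ k := by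
  by_contra! hlt
  have hsub : W ⊆ (Finset.Icc 1 (i - 1)).image v := by
    intro x hx
    obtain ⟨j, ⟨hj1, hjn⟩, rfl⟩ := hsurj (Set.mem_univ x)
    have hji : ¬ i ≤ j := fun hij => by
      have h1 := hmono i j hi hij hjn
      have h2 := hdeg _ hx
      omega
    exact Finset.mem_image_of_mem v (Finset.mem_Icc.2 ⟨hj1, by omega⟩)
  have hcard := (Finset.card_le_card hsub).trans Finset.card_image_le
  rw [Nat.card_Icc] at hcard
  omega

/-- Setup: `t ≥ 4` an integer, `G` a `t`-tough graph on `n ≥ 3` vertices, labeled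
`v 1, …, v n` with non-decreasing degrees `dᵢ`, equal to its `t`-closure.
If `α < n/2` is a positive integer such that for every `i ∈ [1, n]`,
`dᵢ < α − t` implies `dᵢ ≥ i − t + 1`, then `Uᵅ = {vᵢ : dᵢ ≥ n − α}` is a
universal clique of `G`: every vertex of `Uᵅ` is adjacent to every other vertex. -/
theorem Ualpha_universal_clique
    {V : Type*} [Fintype V] [DecidableEq V] (G : SimpleGraph V) [DecidableRel G.Adj]
    (n t : ℕ) (ht : 4 ≤ t) (hn : Fintype.card V = n) (hn3 : 3 ≤ n)
    (htough : SimpleGraph.Tough (t : ℚ) G)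
    (v : ℕ → V) (hbij : Set.BijOn v (Set.Icc 1 n) Set.univ)
    (hmono : ∀ i j, 1 ≤ i → i ≤ j → j ≤ n → G.degree (v i) ≤ G.degree (v j))
    (hclosed : ∀ a b : V, a ≠ b → ¬ G.Adj a b →
      (G.degree a : ℤ) + (G.degree b : ℤ) < (n : ℤ) - (t : ℤ))
    (α : ℕ) (hα1 : 1 ≤ α) (hα : 2 * α < n)
    (hspec : ∀ i, 1 ≤ i → i ≤ n → (G.degree (v i) : ℤ) < (α : ℤ) - (t : ℤ) →
      (i : ℤ) - (t : ℤ) + 1 ≤ (G.degree (v i) : ℤ)) :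
    ∀ a ∈ {u : V | (n : ℤ) - (α : ℤ) ≤ (G.degree u : ℤ)},
      ∀ b : V, b ≠ a → G.Adj a b := by
  intro a ha b hba
  by_contra hab
  simp only [Set.mem_ofPred_eq] at ha
  have hmem : ∀ x, x ∈ Gᶜ.neighborFinset a ↔ a ≠ x ∧ ¬ G.Adj a x := by
    intro x
    rw [SimpleGraph.mem_neighborFinset, SimpleGraph.compl_adj]
  obtain ⟨w, hw, hmax⟩ := (Gᶜ.neighborFinset a).exists_max_image (fun x => G.degree x)
    ⟨b, (hmem b).2 ⟨hba.symm, hab⟩⟩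
  obtain ⟨hne, hnadj⟩ := (hmem w).1 hw
  have hsum := hclosed a w hne hnadj
  have hcompl := G.degree_compl a
  rw [← SimpleGraph.card_neighborFinset_eq_degree, hn] at hcompl
  have hle : (Gᶜ.neighborFinset a).card ≤ n := hn ▸ Finset.card_le_univ _
  have hdeg := G.degree_le_of_le_card (k := G.degree w) (i := G.degree w + t)
    hbij.surjOn hmono (by omega) (W := Gᶜ.neighborFinset a) (by omega) hmax
  have := hspec (G.degree w + t) (by omega) (by omega) (by omega)
  push_cast at this
  omega
end

section
/- With G, n, t, k and the labeling v_1, …, v_n as in the setup: every universal clique of G has at most k − 2 vertices. -/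
namespace SimpleGraph

variable {V : Type*} (G : SimpleGraph V)

/-- If any two distinct vertices of `J`, which avoids `S`, include one whose neighbours all lie
in `S`, then deleting `S` leaves at least `|J|` components. -/
lemma card_le_card_connectedComponent_induce_compl [Finite V] (S J : Finset V)
    (hdisj : ∀ x ∈ J, x ∉ S)
    (hsep : ∀ x ∈ J, ∀ y ∈ J, x ≠ y → (∀ z, G.Adj x z → z ∈ S) ∨ (∀ z, G.Adj y z → z ∈ S)) :
    J.card ≤ Nat.card (G.induce ((↑S : Set V)ᶜ)).ConnectedComponent := by
  classical
  have isolated : ∀ a b : ((↑S : Set V)ᶜ : Set V), (∀ z, G.Adj a z → z ∈ S) →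
      (G.induce ((↑S : Set V)ᶜ)).Reachable a b → a = b := by
    rintro a b ha ⟨p⟩
    cases p with
    | nil => rfl
    | @cons _ w _ h p => exact absurd (ha w h) w.2
  let f : J → (G.induce ((↑S : Set V)ᶜ)).ConnectedComponent :=
    fun x => (G.induce ((↑S : Set V)ᶜ)).connectedComponentMk ⟨x, hdisj x x.2⟩
  have hf : Function.Injective f := by
    intro x y hxy
    have hr := ConnectedComponent.exact hxy
    by_contra hne
    rcases hsep x x.2 y y.2 (fun h => hne (Subtype.ext h)) with h | h
    · exact hne (Subtype.ext (Subtype.mk.inj (isolated _ _ h hr)))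
    · exact hne (Subtype.ext (Subtype.mk.inj (isolated _ _ h hr.symm)).symm)
  simpa using Nat.card_le_card_of_injective f hf

/-- A finite set of vertices contains an independent subset dominating it. -/
lemma exists_independent_dominating_subset (X : Finset V) :
    ∃ I ⊆ X, (∀ x ∈ I, ∀ y ∈ I, ¬ G.Adj x y) ∧ ∀ y ∈ X, y ∉ I → ∃ x ∈ I, G.Adj x y := by
  classical
  obtain ⟨I, hI, hmax⟩ := Finset.exists_max_image
    (X.powerset.filter fun I => ∀ x ∈ I, ∀ y ∈ I, ¬ G.Adj x y) Finset.card ⟨∅, by simp⟩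
  simp only [Finset.mem_filter, Finset.mem_powerset] at hI hmax
  refine ⟨I, hI.1, hI.2, fun y hy hyI => ?_⟩
  by_contra! hno
  have hle := hmax (insert y I) ⟨Finset.insert_subset hy hI.1, fun a ha b hb => by
    rcases Finset.mem_insert.1 ha with rfl | haI <;> rcases Finset.mem_insert.1 hb with rfl | hbI
    · exact G.irrefl
    · exact fun h => hno b hbI h.symm
    · exact hno a haI
    · exact hI.2 a haI b hbI⟩
  rw [Finset.card_insert_of_notMem hyI] at hle
  omega

/-- In a `t`-tough graph on `n` vertices with `t ≥ 3` and some `k < n / 2` vertices of degree at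
most `k`, no set of universal vertices has exactly `k - 1` elements. -/
lemma Tough.card_add_one_ne_of_universal [Fintype V] [DecidableEq V] [DecidableRel G.Adj]
    {t k : ℕ} (ht : 3 ≤ t) (htough : G.Tough (t : ℚ)) (hk : 2 * k < Fintype.card V)
    {X W : Finset V} (hX : X.card = k) (hXdeg : ∀ x ∈ X, G.degree x ≤ k)
    (hW : ∀ a ∈ W, ∀ b, b ≠ a → G.Adj a b) : W.card + 1 ≠ k := by
  intro hWk
  have hXW : ∀ x ∈ X, x ∉ W := by
    intro x hx hxW
    have hsub : Finset.univ.erase x ⊆ G.neighborFinset x := fun b hb => by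
      simpa using hW x hxW b (Finset.ne_of_mem_erase hb)
    have hle := Finset.card_le_card hsub
    rw [Finset.card_erase_of_mem (Finset.mem_univ x), Finset.card_univ,
      card_neighborFinset_eq_degree] at hle
    have := hXdeg x hx
    omega
  have hout : ∀ x ∈ X, (G.neighborFinset x \ W).card ≤ 1 := by
    intro x hx
    have hsub : W ⊆ G.neighborFinset x := fun a ha => by
      simpa using (hW a ha x fun h => hXW x hx (h ▸ ha)).symm
    rw [Finset.card_sdiff_of_subset hsub, card_neighborFinset_eq_degree]
    have := hXdeg x hx
    omega
  obtain ⟨I, hIX, hind, hdom⟩ := G.exists_independent_dominating_subset X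
  set Y := I.biUnion fun x => G.neighborFinset x \ W with hY
  have hYcard : Y.card ≤ I.card := by
    simpa using Finset.card_biUnion_le_card_mul I _ 1 fun x hx => hout x (hIX hx)
  have hXI : X ⊆ I ∪ Y := by
    intro y hy
    by_cases hyI : y ∈ I
    · exact Finset.mem_union_left _ hyI
    · obtain ⟨x, hx, hxy⟩ := hdom y hy hyI
      refine Finset.mem_union_right _ (Finset.mem_biUnion.2 ⟨x, hx, ?_⟩)
      simpa using ⟨hxy, hXW y hy⟩
  have hkI : k ≤ 2 * I.card := by
    have h₁ := Finset.card_le_card hXI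
    have h₂ := Finset.card_union_le I Y
    omega
  have hScard : (W ∪ Y).card ≤ W.card + I.card := (Finset.card_union_le W Y).trans (by omega)
  have hnbr : ∀ x ∈ I, ∀ z, G.Adj x z → z ∈ W ∪ Y := by
    intro x hx z hxz
    by_cases hz : z ∈ W
    · exact Finset.mem_union_left _ hz
    · refine Finset.mem_union_right _ (Finset.mem_biUnion.2 ⟨x, hx, ?_⟩)
      simpa using ⟨hxz, hz⟩
  have hIS : ∀ x ∈ I, x ∉ W ∪ Y := by
    intro x hx hxS
    rcases Finset.mem_union.1 hxS with h | h
    · exact hXW x (hIX hx) h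
    · obtain ⟨y, hy, hyx⟩ := Finset.mem_biUnion.1 h
      exact hind y hy x hx (by simpa using (Finset.mem_sdiff.1 hyx).1)
  have hbound : ∀ J : Finset V, 2 ≤ J.card → (∀ x ∈ J, x ∉ W ∪ Y) →
      (∀ x ∈ J, ∀ y ∈ J, x ≠ y → x ∈ I ∨ y ∈ I) → 3 * J.card ≤ W.card + I.card := by
    intro J hJ hJS hJI
    have hc := G.card_le_card_connectedComponent_induce_compl (W ∪ Y) J hJS
      fun x hx y hy hxy => (hJI x hx y hy hxy).imp (hnbr x) (hnbr y)
    have htc := htough (W ∪ Y) (hJ.trans hc)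
    norm_cast at htc
    exact (Nat.mul_le_mul ht hc).trans (htc.trans hScard)
  by_cases hI : 2 ≤ I.card
  · have := hbound I hI hIS fun x hx _ _ _ => Or.inl hx
    omega
  · obtain ⟨x, hx⟩ : ∃ x, I = {x} := Finset.card_eq_one.1 (by omega)
    have hxI : x ∈ I := by simp [hx]
    obtain ⟨u, -, hu⟩ := Finset.exists_mem_notMem_of_card_lt_card
      (s := insert x (W ∪ Y)) (t := Finset.univ) (by
        have := Finset.card_insert_le x (W ∪ Y)
        rw [Finset.card_univ]
        omega)
    rw [Finset.mem_insert, not_or] at hu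
    have hcard : ({x, u} : Finset V).card = 2 := Finset.card_pair (Ne.symm hu.1)
    have := hbound {x, u} hcard.ge (by
        intro y hy
        rcases Finset.mem_insert.1 hy with rfl | hy
        · exact hIS _ hxI
        · rw [Finset.mem_singleton.1 hy]
          exact hu.2) (by
        intro y hy z hz hyz
        simp only [Finset.mem_insert, Finset.mem_singleton] at hy hz
        grind)
    omega

end SimpleGraph

/-- Setup: `t ≥ 4` an integer, `G` a `t`-tough non-Hamiltonian graph on `n ≥ 3`
vertices, labeled `v 1, …, v n` with non-decreasing degrees `dᵢ`, satisfying the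
degree sequence condition, equal to its `t`-closure, and `k` the least positive
integer with `k < n/2` and `d_k ≤ k`.  Then every universal clique of `G` has at
most `k − 2` vertices. -/
theorem universal_clique_le
    {V : Type*} [Fintype V] [DecidableEq V] (G : SimpleGraph V) [DecidableRel G.Adj]
    (n t : ℕ) (ht : 4 ≤ t) (hn : Fintype.card V = n) (hn3 : 3 ≤ n)
    (htough : SimpleGraph.Tough (t : ℚ) G) (hnotham : ¬ G.IsHamiltonian)
    (v : ℕ → V) (hbij : Set.BijOn v (Set.Icc 1 n) Set.univ)
    (hmono : ∀ i j, 1 ≤ i → i ≤ j → j ≤ n → G.degree (v i) ≤ G.degree (v j))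
    (hcond : ∀ i, 1 ≤ i → 2 * i < n →
      G.degree (v i) ≤ i → n - i ≤ G.degree (v (n - i + t)))
    (hclosed : ∀ a b : V, a ≠ b → ¬ G.Adj a b →
      (G.degree a : ℤ) + (G.degree b : ℤ) < (n : ℤ) - (t : ℤ))
    (k : ℕ) (hk1 : 1 ≤ k) (hk2 : 2 * k < n) (hkd : G.degree (v k) ≤ k)
    (hkmin : ∀ i, 1 ≤ i → 2 * i < n → G.degree (v i) ≤ i → k ≤ i) :
    ∀ W : Set V, (∀ a ∈ W, ∀ b : V, b ≠ a → G.Adj a b) →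
      (W.ncard : ℤ) ≤ (k : ℤ) - 2 := by
  intro W hW
  by_contra! hlt
  have hXcard : ((Finset.Icc 1 k).image v).card = k := by
    rw [Finset.card_image_of_injOn, Nat.card_Icc, Nat.add_sub_cancel]
    refine hbij.injOn.mono fun i hi => ?_
    simp only [Finset.coe_Icc, Set.mem_Icc] at hi ⊢
    omega
  have hXdeg : ∀ x ∈ (Finset.Icc 1 k).image v, G.degree x ≤ k := by
    intro x hx
    obtain ⟨i, hi, rfl⟩ := Finset.mem_image.1 hx
    rw [Finset.mem_Icc] at hi
    exact (hmono i k hi.1 hi.2 (by omega)).trans hkd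
  obtain ⟨W', hW', hcard⟩ := Finset.exists_subset_card_eq
    (s := W.toFinite.toFinset) (n := k - 1) (by
      rw [← Set.ncard_eq_toFinset_card W]
      omega)
  exact SimpleGraph.Tough.card_add_one_ne_of_universal G (by omega) htough (by omega) hXcard hXdeg
    (fun a ha => hW a (by simpa using hW' ha)) (by omega : W'.card + 1 = k)
end

section
/- Let G be a non-Hamiltonian graph with a Hamilton path P = v_1 v_2 ⋯ v_n, and set x = v_1 and y = v_n. Let i, j ∈ [2, n−1] with x adjacent to v_i and y adjacent to v_j. Then: (1) if i ≤ n−3 and additionally x is adjacent to v_{i+2}, then v_{i+1} is not adjacent to v_{k+1} for any index k such that v_k is adjacent to y; (2) if j ≤ n−3 and additionally y is adjacent to v_{j+2}, then v_{j+1} is not adjacent to v_{k−1} for any index k such that v_k is adjacent to x. -/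
namespace SimpleGraph

variable {V : Type*} [Fintype V] [DecidableEq V] {G : SimpleGraph V} {n : ℕ} {v : ℕ → V}

/-- A graph with a cyclic enumeration of its vertices along edges is Hamiltonian. -/
lemma isHamiltonian_of_injOn_Icc (hn : Fintype.card V = n) (h3 : 3 ≤ n)
    (hinj : Set.InjOn v (Set.Icc 1 n)) (hadj : ∀ p, 1 ≤ p → p < n → G.Adj (v p) (v (p + 1)))
    (hclose : G.Adj (v n) (v 1)) : G.IsHamiltonian := by
  have hstep : ∀ a b : Fin n, (a - b).val = 1 → G.Adj (v (b + 1)) (v (a + 1)) := by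
    intro a b h
    have ha := a.isLt
    have hb := b.isLt
    rcases le_or_gt b a with hba | hba
    · rw [Fin.coe_sub_iff_le.mpr hba] at h
      have hab : (a : ℕ) = b + 1 := by omega
      rw [hab]
      exact hadj _ (by omega) (by omega)
    · rw [Fin.coe_sub_iff_lt.mpr hba] at h
      have ha0 : (a : ℕ) + 1 = 1 := by omega
      have hbn : (b : ℕ) + 1 = n := by omega
      rwa [ha0, hbn]
  have hcontained : cycleGraph n ⊑ G := by
    refine ⟨Hom.toCopy ⟨fun a ↦ v (a + 1), fun {a b} h ↦ ?_⟩ fun a b h ↦ ?_⟩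
    · rcases cycleGraph_adj'.mp h with h | h
      · exact (hstep a b h).symm
      · exact hstep b a h
    · have := hinj ⟨by omega, by omega⟩ ⟨by omega, by omega⟩ h
      exact Fin.ext (by omega)
  obtain ⟨a, p, hp, hlen⟩ := (cycleGraph_isContained_iff (by omega)).mp hcontained
  exact fun _ ↦ ⟨a, p, Walk.isHamiltonianCycle_iff_isCycle_and_length_eq.mpr
    ⟨hp, hlen.trans hn.symm⟩⟩

/-- If the vertices of a Hamilton path can be reordered into a closed cyclic enumeration,
the graph is Hamiltonian. -/
lemma isHamiltonian_of_reorder (hn : Fintype.card V = n) (h3 : 3 ≤ n)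
    (hinj : Set.InjOn v (Set.Icc 1 n)) (s : ℕ → ℕ)
    (hmaps : ∀ p, 1 ≤ p → p ≤ n → 1 ≤ s p ∧ s p ≤ n)
    (hs : ∀ p q, 1 ≤ p → p ≤ n → 1 ≤ q → q ≤ n → s p = s q → p = q)
    (hadj : ∀ p, 1 ≤ p → p < n → G.Adj (v (s p)) (v (s (p + 1))))
    (hclose : G.Adj (v (s n)) (v (s 1))) : G.IsHamiltonian := by
  refine isHamiltonian_of_injOn_Icc (v := v ∘ s) hn h3 ?_ hadj hclose
  exact hinj.comp (fun p hp q hq h ↦ hs p q hp.1 hp.2 hq.1 hq.2 h) fun p hp ↦ hmaps p hp.1 hp.2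

/-- In a non-Hamiltonian graph with a Hamilton path `v 1, …, v n` such that `v 1` is adjacent to
`v i` and `v (i + 2)`, the vertex `v (i + 1)` is not adjacent to the successor of a neighbour
of `v n`. -/
lemma not_adj_succ_of_not_isHamiltonian (hn : Fintype.card V = n) (hG : ¬ G.IsHamiltonian)
    (hinj : Set.InjOn v (Set.Icc 1 n)) (hpath : ∀ p, 1 ≤ p → p < n → G.Adj (v p) (v (p + 1)))
    {i k : ℕ} (hi : 1 ≤ i) (hin : i + 2 ≤ n) (hxi : G.Adj (v 1) (v i))
    (hxi2 : G.Adj (v 1) (v (i + 2))) (hk : 1 ≤ k) (hkn : k ≤ n) (hky : G.Adj (v k) (v n)) :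
    ¬ G.Adj (v (i + 1)) (v (k + 1)) := by
  intro hadj
  apply hG
  have hk_ne : k ≠ n := fun h ↦ hky.ne (by rw [h])
  have hk_ne_i : k ≠ i := fun h ↦ hadj.ne (by rw [h])
  have up : ∀ a b, 1 ≤ a → b ≤ n → b = a + 1 → G.Adj (v a) (v b) := by
    rintro a b ha hb rfl
    exact hpath a ha hb
  have down : ∀ a b, 1 ≤ b → a ≤ n → a = b + 1 → G.Adj (v a) (v b) :=
    fun a b ha hb h ↦ (up b a ha hb h).symm
  have edge : ∀ {c d}, G.Adj (v c) (v d) → ∀ a b, a = c → b = d → G.Adj (v a) (v b) := by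
    rintro c d h a b rfl rfl
    exact h
  rcases lt_or_gt_of_ne hk_ne_i with hki | hki
  · refine isHamiltonian_of_reorder hn (by omega) hinj
      (fun p ↦ if p ≤ k then p else if p ≤ k + (n - i) then n + k + 1 - p else p - (n - i))
      ?_ ?_ ?_ ?_
    · intro p _ _; split_ifs <;> omega
    · intro p q _ _ _ _; split_ifs <;> omega
    · intro p _ _
      split_ifs <;> first
        | omega
        | exact up _ _ (by omega) (by omega) (by omega)
        | exact down _ _ (by omega) (by omega) (by omega)
        | exact edge hky _ _ (by omega) (by omega)
        | exact edge hadj _ _ (by omega) (by omega)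
    · split_ifs <;> first
        | omega
        | exact edge hxi.symm _ _ (by omega) (by omega)
  · rcases Nat.eq_or_lt_of_le (Nat.succ_le_of_lt hki) with rfl | hki2
    · refine isHamiltonian_of_reorder hn (by omega) hinj
        (fun p ↦ if p ≤ i + 1 then p else n + i + 2 - p) ?_ ?_ ?_ ?_
      · intro p _ _; split_ifs <;> omega
      · intro p q _ _ _ _; split_ifs <;> omega
      · intro p _ _
        split_ifs <;> first
          | omega
          | exact up _ _ (by omega) (by omega) (by omega)
          | exact down _ _ (by omega) (by omega) (by omega)
          | exact edge hky _ _ (by omega) (by omega)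
      · split_ifs <;> first
          | omega
          | exact edge hxi2.symm _ _ (by omega) (by omega)
    · refine isHamiltonian_of_reorder hn (by omega) hinj
        (fun p ↦ if p ≤ i + 1 then p else if p ≤ i + 1 + (n - k) then p + k - (i + 1)
          else n + i + 2 - p) ?_ ?_ ?_ ?_
      · intro p _ _; split_ifs <;> omega
      · intro p q _ _ _ _; split_ifs <;> omega
      · intro p _ _
        split_ifs <;> first
          | omega
          | exact up _ _ (by omega) (by omega) (by omega)
          | exact down _ _ (by omega) (by omega) (by omega)
          | exact edge hky.symm _ _ (by omega) (by omega)
          | exact edge hadj _ _ (by omega) (by omega)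
      · split_ifs <;> first
          | omega
          | exact edge hxi2.symm _ _ (by omega) (by omega)

end SimpleGraph

/-- Let `G` be a non-Hamiltonian graph with a Hamilton path `v 1, v 2, …, v n`,
`x = v 1`, `y = v n`.  If `i, j ∈ [2, n−1]` with `x ~ v i` and `y ~ v j`, then:
(1) if `i ≤ n − 3` and moreover `x ~ v (i+2)`, then `v (i+1) ≁ v (k+1)` for any
index `k` with `v k ~ y`; (2) if `j ≤ n − 3` and moreover `y ~ v (j+2)`, then
`v (j+1) ≁ v (k−1)` for any index `k` with `v k ~ x`. -/
theorem hamilton_path_adjacency'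
    {V : Type*} [Fintype V] [DecidableEq V] (G : SimpleGraph V)
    (n : ℕ) (hn : Fintype.card V = n)
    (hnotham : ¬ G.IsHamiltonian)
    (v : ℕ → V) (hbij : Set.BijOn v (Set.Icc 1 n) Set.univ)
    (hpath : ∀ i, 1 ≤ i → i < n → G.Adj (v i) (v (i + 1)))
    (i j : ℕ) (hi2 : 2 ≤ i) (hi : i ≤ n - 1) (hj2 : 2 ≤ j) (hj : j ≤ n - 1)
    (hxi : G.Adj (v 1) (v i)) (hyj : G.Adj (v n) (v j)) :
    (i ≤ n - 3 → G.Adj (v 1) (v (i + 2)) →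
      ∀ k, 1 ≤ k → k ≤ n → G.Adj (v k) (v n) → ¬ G.Adj (v (i + 1)) (v (k + 1))) ∧
    (j ≤ n - 3 → G.Adj (v n) (v (j + 2)) →
      ∀ k, 1 ≤ k → k ≤ n → G.Adj (v k) (v 1) → ¬ G.Adj (v (j + 1)) (v (k - 1))) := by
  refine ⟨fun hi3 hxi2 k hk hkn hky ↦ SimpleGraph.not_adj_succ_of_not_isHamiltonian hn hnotham
    hbij.injOn hpath (by omega) (by omega) hxi hxi2 hk hkn hky, fun hj3 hyj2 k hk hkn hkx hadj ↦ ?_⟩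
  have hk1 : k ≠ 1 := fun h ↦ hkx.ne (by rw [h])
  have edge : ∀ {c d}, G.Adj (v c) (v d) → ∀ a b, a = c → b = d → G.Adj (v a) (v b) := by
    rintro c d h a b rfl rfl
    exact h
  refine SimpleGraph.not_adj_succ_of_not_isHamiltonian (v := fun m ↦ v (n + 1 - m))
    (i := n - 1 - j) (k := n + 1 - k) hn hnotham ?_ ?_ (by omega) (by omega)
    (edge hyj2 _ _ (by omega) (by omega)) (edge hyj _ _ (by omega) (by omega)) (by omega)
    (by omega) (edge hkx _ _ (by omega) (by omega)) (edge hadj _ _ (by omega) (by omega))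
  · intro p hp q hq h
    obtain ⟨hp1, hpn⟩ := hp
    obtain ⟨hq1, hqn⟩ := hq
    have := hbij.injOn ⟨by omega, by omega⟩ ⟨by omega, by omega⟩ h
    omega
  · intro p hp hpn
    exact edge (hpath (n - p) (by omega) (by omega)).symm _ _ (by omega) (by omega)
end

section
/- Let t ≥ 4 be a rational number and let G be a t-tough, non-Hamiltonian graph on n ≥ 3 vertices with a Hamilton path P = v_1 ⋯ v_n from x = v_1 to y = v_n, where x and y are nonadjacent and deg(x) + deg(y) ≥ n − t. Suppose for some i ∈ [2, n−2] that neither v_i nor v_{i+1} is adjacent to x or to y, v_{i−1} is adjacent to y, and v_{i+2} is adjacent to x (i.e., {v_i, v_{i+1}} is a crossing-gap of size 2). Then v_i is not adjacent to v_j for any j ∈ [3, n−2] such that y is adjacent to both v_{j−1} and v_{j+1}. -/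
namespace SimpleGraph

open Finset

/-- Some walk from `a` to `b` with `k` vertices (counted with multiplicity) visits every vertex
satisfying `S`. -/
def WalkCovers (H : SimpleGraph ℕ) (a b : ℕ) (S : ℕ → Prop) (k : ℕ) : Prop :=
  ∃ p : H.Walk a b, p.length + 1 = k ∧ ∀ m, S m → m ∈ p.support

/-- `1, 2, …, n` is a path of `H` with nonadjacent ends, and no cycle of `H` passes through exactly
these vertices. -/
structure IsNoncyclicPath (H : SimpleGraph ℕ) (n : ℕ) : Prop where
  adj_succ : ∀ m, 1 ≤ m → m < n → H.Adj m (m + 1)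
  not_adj_ends : ¬ H.Adj 1 n
  no_cycle : ∀ {a b : ℕ} {S : ℕ → Prop} {k : ℕ}, H.WalkCovers a b S k → H.Adj b a →
    k = n → (∀ m, 1 ≤ m → m ≤ n → S m) → False

variable {H : SimpleGraph ℕ} {n : ℕ}

theorem WalkCovers.append {a b c d k l : ℕ} {S T : ℕ → Prop} (h : H.WalkCovers a b S k)
    (hbc : H.Adj b c) (h' : H.WalkCovers c d T l) :
    H.WalkCovers a d (fun m => S m ∨ T m) (k + l) := by
  obtain ⟨p, hp, hpS⟩ := h
  obtain ⟨q, hq, hqT⟩ := h'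
  refine ⟨p.append (.cons hbc q), ?_, ?_⟩
  · simp only [Walk.length_append, Walk.length_cons]
    omega
  · rintro m (hm | hm)
    · exact (Walk.mem_support_append_iff _ _).2 (.inl (hpS m hm))
    · exact (Walk.mem_support_append_iff _ _).2 (.inr (List.mem_cons_of_mem _ (hqT m hm)))

theorem WalkCovers.reverse {a b k : ℕ} {S : ℕ → Prop} (h : H.WalkCovers a b S k) :
    H.WalkCovers b a S k := by
  obtain ⟨p, hp, hpS⟩ := h
  exact ⟨p.reverse, by simpa using hp, by simpa using hpS⟩

theorem walkCovers_self (H : SimpleGraph ℕ) (a : ℕ) : H.WalkCovers a a (fun m => m = a) 1 :=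
  ⟨.nil, rfl, by simp⟩

namespace IsNoncyclicPath

/-- The segment of the path that ascends from `a` to `b`. -/
theorem up (hP : IsNoncyclicPath H n) {a b : ℕ} (hab : a ≤ b) (ha : 1 ≤ a) (hb : b ≤ n) :
    H.WalkCovers a b (fun m => a ≤ m ∧ m ≤ b) (b + 1 - a) := by
  induction b, hab using Nat.le_induction with
  | base => exact ⟨.nil, by simp, fun m hm => by simp; omega⟩
  | succ b hab ih =>
    obtain ⟨p, hp, hpS⟩ := (ih (by omega)).append (hP.adj_succ b (by omega) (by omega))
      (walkCovers_self H (b + 1))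
    exact ⟨p, by omega, fun m hm => hpS m (by omega)⟩

/-- The segment of the path that descends from `b` to `a`. -/
theorem down (hP : IsNoncyclicPath H n) {a b : ℕ} (hab : a ≤ b) (ha : 1 ≤ a) (hb : b ≤ n) :
    H.WalkCovers b a (fun m => a ≤ m ∧ m ≤ b) (b + 1 - a) :=
  (hP.up hab ha hb).reverse

theorem reflect (hP : IsNoncyclicPath H n) :
    IsNoncyclicPath (H.comap fun m => n + 1 - m) n where
  adj_succ m h1 h2 := by
    have := (hP.adj_succ (n - m) (by omega) (by omega)).symm
    simpa [comap_adj, show n - m + 1 = n + 1 - m by omega] using this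
  not_adj_ends h := by
    refine hP.not_adj_ends (Adj.symm ?_)
    simpa [comap_adj] using h
  no_cycle := by
    rintro a b S k ⟨p, hp, hpS⟩ hba hk hS
    refine hP.no_cycle (S := fun m => 1 ≤ m ∧ m ≤ n)
      ⟨p.map (Hom.comap (fun m => n + 1 - m) H), by simpa using hp, fun m hm => ?_⟩ hba hk
      fun m h1 h2 => ⟨h1, h2⟩
    rw [Walk.support_map, List.mem_map]
    exact ⟨n + 1 - m, hpS _ (hS _ (by omega) (by omega)), show n + 1 - (n + 1 - m) = m by omega⟩

theorem not_crossing (hP : IsNoncyclicPath H n) {m : ℕ} (h1 : 1 ≤ m) (hn : m + 1 ≤ n)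
    (hx : H.Adj 1 (m + 1)) : ¬ H.Adj n m := fun hy =>
  hP.no_cycle ((hP.up h1 le_rfl (by omega)).append hy.symm (hP.down hn (by omega) le_rfl))
    hx.symm (by omega) fun m _ _ => by omega

end IsNoncyclicPath

/-- The vertex `k` of the path `1, …, n` is a crossing-gap of size one. -/
def IsUnitGap (H : SimpleGraph ℕ) (n k : ℕ) : Prop :=
  2 ≤ k ∧ k + 1 ≤ n ∧ H.Adj n (k - 1) ∧ H.Adj 1 (k + 1)

namespace IsUnitGap

variable {k l b : ℕ}

theorem reflect (h : IsUnitGap H n k) :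
    IsUnitGap (H.comap fun m => n + 1 - m) n (n + 1 - k) := by
  obtain ⟨h1, h2, h3, h4⟩ := h
  refine ⟨by omega, by omega, ?_, ?_⟩
  · simpa [comap_adj, show n + 1 - (n + 1 - k - 1) = k + 1 by omega] using h4
  · simpa [comap_adj, show n + 1 - (n + 1 - k + 1) = k - 1 by omega] using h3

theorem not_adj_one (hk : IsUnitGap H n k) (hP : IsNoncyclicPath H n) : ¬ H.Adj 1 k := by
  obtain ⟨h1, h2, h3, h4⟩ := hk
  intro h
  refine hP.not_crossing (m := k - 1) (by omega) (by omega) ?_ h3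
  rwa [Nat.sub_add_cancel (by omega)]

theorem not_adj_last (hk : IsUnitGap H n k) (hP : IsNoncyclicPath H n) : ¬ H.Adj n k :=
  hP.not_crossing (by linarith [hk.1]) hk.2.1 hk.2.2.2

theorem not_adj_one_pred (hk : IsUnitGap H n k) (hP : IsNoncyclicPath H n) (hkb : k < b)
    (hb : b ≤ n) (h : H.Adj k b) : ¬ H.Adj 1 (b - 1) := by
  obtain ⟨h1, h2, h3, h4⟩ := id hk
  intro hx
  obtain rfl | hkb := (show k + 1 ≤ b from hkb).eq_or_lt
  · exact hk.not_adj_one hP hx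
  · exact hP.no_cycle ((((walkCovers_self H k).append h (hP.up hb (by omega) le_rfl)).append h3
      (hP.down (a := 1) (by omega) le_rfl (by omega))).append hx
      (hP.down (a := k + 1) (by omega) (by omega) (by omega)))
      (hP.adj_succ k (by omega) (by omega)).symm (by omega) fun m _ _ => by omega

theorem not_adj_last_pred (hk : IsUnitGap H n k) (hP : IsNoncyclicPath H n) (hkb : k < b)
    (hb : b ≤ n) (h : H.Adj k b) : ¬ H.Adj n (b - 1) := by
  obtain ⟨h1, h2, h3, h4⟩ := id hk
  intro hy
  obtain rfl | hkb := (show k + 1 ≤ b from hkb).eq_or_lt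
  · exact hk.not_adj_last hP hy
  · exact hP.no_cycle (((hP.up (a := 1) (by omega) le_rfl (by omega)).append h
      (hP.up hb (by omega) le_rfl)).append hy
      (hP.down (a := k + 1) (by omega) (by omega) (by omega)))
      h4.symm (by omega) fun m _ _ => by omega

theorem not_adj_of_lt (hk : IsUnitGap H n k) (hl : IsUnitGap H n l) (hP : IsNoncyclicPath H n)
    (hkl : k < l) : ¬ H.Adj k l := fun h =>
  hk.not_adj_last_pred hP hkl (by linarith [hl.2.1]) h hl.2.2.1

theorem not_adj (hk : IsUnitGap H n k) (hl : IsUnitGap H n l) (hP : IsNoncyclicPath H n) :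
    ¬ H.Adj k l := by
  intro h
  rcases h.ne.lt_or_gt with hkl | hkl
  · exact hk.not_adj_of_lt hl hP hkl h
  · exact hl.not_adj_of_lt hk hP hkl h.symm

theorem not_adj_succ (hk : IsUnitGap H n k) (hl : IsUnitGap H n l) (hP : IsNoncyclicPath H n)
    (hkb : k < b) (hlb : l < b + 1) (hb : b + 1 ≤ n) (h : H.Adj k b) : ¬ H.Adj l (b + 1) := by
  intro h'
  obtain ⟨hk1, hk2, hk3, hk4⟩ := id hk
  obtain ⟨hl1, hl2, hl3, hl4⟩ := id hl
  have hlb : l ≠ b := by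
    rintro rfl
    exact hk.not_adj hl hP h
  rcases lt_trichotomy k l with hkl | rfl | hkl
  · have hkl' : k + 1 ≠ l := by
      rintro rfl
      exact hl.not_adj_one hP hk4
    exact hP.no_cycle ((((hP.up (a := k + 1) (b := l - 1) (by omega) (by omega) (by omega)).append
      hl3.symm (hP.down hb (by omega) le_rfl)).append h'.symm
      (hP.up (a := l) (b := b) (by omega) (by omega) (by omega))).append h.symm
      (hP.down (a := 1) (by omega) le_rfl (by omega))) hk4 (by omega) fun m _ _ => by omega
  · exact hP.no_cycle ((((hP.up (a := 1) (b := k - 1) (by omega) le_rfl (by omega)).append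
      hk3.symm (hP.down hb (by omega) le_rfl)).append h'.symm (walkCovers_self H k)).append h
      (hP.down (a := k + 1) (by omega) (by omega) (by omega))) hk4.symm (by omega)
      fun m _ _ => by omega
  · exact hP.no_cycle ((((hP.down hb (by omega) le_rfl).append h'.symm
      (hP.up (a := l) (b := k) (by omega) (by omega) (by omega))).append h
      (hP.down (a := k + 1) (by omega) (by omega) (by omega))).append hk4.symm
      (hP.up (a := 1) (b := l - 1) (by omega) le_rfl (by omega))) hl3.symm (by omega)
      fun m _ _ => by omega

theorem not_adj_one_succ (hk : IsUnitGap H n k) (hP : IsNoncyclicPath H n) (hbk : b < k)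
    (hb : 1 ≤ b) (h : H.Adj k b) : ¬ H.Adj 1 (b + 1) := by
  have hkn := hk.2.1
  have := hk.reflect.not_adj_last_pred hP.reflect (b := n + 1 - b) (by omega) (by omega)
    (by simpa [comap_adj, show n + 1 - (n + 1 - k) = k by omega,
      show n + 1 - (n + 1 - b) = b by omega] using h)
  simpa [comap_adj, show n + 1 - (n + 1 - b - 1) = b + 1 by omega] using this

theorem not_adj_last_succ (hk : IsUnitGap H n k) (hP : IsNoncyclicPath H n) (hbk : b < k)
    (hb : 1 ≤ b) (h : H.Adj k b) : ¬ H.Adj n (b + 1) := by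
  have hkn := hk.2.1
  have := hk.reflect.not_adj_one_pred hP.reflect (b := n + 1 - b) (by omega) (by omega)
    (by simpa [comap_adj, show n + 1 - (n + 1 - k) = k by omega,
      show n + 1 - (n + 1 - b) = b by omega] using h)
  simpa [comap_adj, show n + 1 - (n + 1 - b - 1) = b + 1 by omega] using this

theorem not_adj_succ_left (hk : IsUnitGap H n k) (hl : IsUnitGap H n l)
    (hP : IsNoncyclicPath H n) (hbk : b < k) (hbl : b + 1 < l) (hb : 1 ≤ b) (h : H.Adj k b) :
    ¬ H.Adj l (b + 1) := by
  have hkn := hk.2.1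
  have hln := hl.2.1
  intro h'
  have := hl.reflect.not_adj_succ hk.reflect hP.reflect (b := n - b) (by omega) (by omega)
    (by omega)
    (by simpa [comap_adj, show n + 1 - (n + 1 - l) = l by omega,
      show n + 1 - (n - b) = b + 1 by omega] using h')
  refine this ?_
  simpa [comap_adj, show n + 1 - (n + 1 - k) = k by omega,
    show n + 1 - (n - b + 1) = b by omega] using h

end IsUnitGap

section Counting

open scoped Classical

/-- A set without consecutive elements, each of which is witnessed by an element of `M` in one of
two adjacent positions, has at most as many elements as `M`. -/
theorem card_le_card_of_no_consecutive {B M : Finset ℕ} (s : ℕ) (hB : ∀ b ∈ B, b + 1 ∉ B)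
    (hM : ∀ b ∈ B, ∃ m ∈ M, m + s = b ∨ m + s = b + 1) : B.card ≤ M.card := by
  choose! f hf hfs using hM
  refine card_le_card_of_injOn f hf fun b hb c hc hbc => ?_
  have h1 := hfs b hb
  have h2 := hfs c hc
  by_contra hne
  obtain rfl | rfl : c = b + 1 ∨ b = c + 1 := by omega
  · exact hB _ hb hc
  · exact hB _ hc hb

/-- The positions `m` of the path `1, …, n` at which the edges from `m + 1` to `1` and from `m` to
`n` are both absent. -/
noncomputable def neutral (H : SimpleGraph ℕ) (n : ℕ) : Finset ℕ :=
  {m ∈ Icc 1 (n - 1) | ¬ H.Adj 1 (m + 1) ∧ ¬ H.Adj n m}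

/-- The set of crossing-gaps of size one. -/
noncomputable def unitGaps (H : SimpleGraph ℕ) (n : ℕ) : Finset ℕ :=
  {k ∈ Icc 1 n | IsUnitGap H n k}

theorem mem_neutral {m : ℕ} :
    m ∈ neutral H n ↔ 1 ≤ m ∧ m + 1 ≤ n ∧ ¬ H.Adj 1 (m + 1) ∧ ¬ H.Adj n m := by
  simp only [neutral, mem_filter, mem_Icc, and_assoc]
  constructor <;> rintro ⟨h1, h2, h3⟩ <;> exact ⟨h1, by omega, h3⟩

theorem mem_unitGaps {k : ℕ} : k ∈ unitGaps H n ↔ IsUnitGap H n k := by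
  simp only [unitGaps, mem_filter, mem_Icc, and_iff_right_iff_imp]
  rintro ⟨h1, h2, -⟩
  omega

theorem card_neutral (hP : IsNoncyclicPath H n) :
    (neutral H n).card + {m ∈ Icc 1 n | H.Adj 1 m}.card + {m ∈ Icc 1 n | H.Adj n m}.card
      = n - 1 := by
  have hX : {m ∈ Icc 1 n | H.Adj 1 m}.card = {m ∈ Icc 1 (n - 1) | H.Adj 1 (m + 1)}.card := by
    refine (card_bij (fun m _ => m + 1) ?_ (fun _ _ _ _ h => by omega) ?_).symm
    · simp only [mem_filter, mem_Icc]
      exact fun m hm => ⟨by omega, hm.2⟩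
    · simp only [mem_filter, mem_Icc]
      rintro m ⟨hm, h⟩
      have := h.ne
      exact ⟨m - 1, ⟨by omega, by rwa [Nat.sub_add_cancel hm.1]⟩, by omega⟩
  have hY : {m ∈ Icc 1 n | H.Adj n m} = {m ∈ Icc 1 (n - 1) | H.Adj n m} := by
    ext m
    simp only [mem_filter, mem_Icc]
    constructor <;> rintro ⟨hm, h⟩ <;> have := h.ne <;> exact ⟨by omega, h⟩
  have hXY : Disjoint {m ∈ Icc 1 (n - 1) | H.Adj 1 (m + 1)} {m ∈ Icc 1 (n - 1) | H.Adj n m} := by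
    rw [disjoint_filter]
    intro m hm
    rw [mem_Icc] at hm
    exact hP.not_crossing hm.1 (by omega)
  have hN : neutral H n = {m ∈ Icc 1 (n - 1) | ¬ (H.Adj 1 (m + 1) ∨ H.Adj n m)} := by
    simp only [neutral, not_or]
  have := card_filter_add_card_filter_not (s := Icc 1 (n - 1))
    (fun m => H.Adj 1 (m + 1) ∨ H.Adj n m)
  rw [filter_or, card_union_of_disjoint hXY, Nat.card_Icc] at this
  rw [hX, hY, hN]
  omega

/-- The vertices of the path `1, …, n` with a neighbour in `W`. -/
noncomputable def pathNeighbors (H : SimpleGraph ℕ) (n : ℕ) (W : Finset ℕ) : Finset ℕ :=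
  {b ∈ Icc 1 n | ∃ k ∈ W, H.Adj k b}

variable {W : Finset ℕ}

theorem card_right_neighbors_le (hP : IsNoncyclicPath H n) (hW : ∀ k ∈ W, IsUnitGap H n k) {a : ℕ}
    (ha : ∀ k ∈ W, a ≤ k) :
    {b ∈ Icc 1 n | ∃ k ∈ W, k < b ∧ H.Adj k b}.card
      ≤ {m ∈ neutral H n | a ≤ m}.card + (unitGaps H n).card := by
  refine (card_le_card_of_no_consecutive 2 ?_ ?_).trans (card_union_le _ _)
  · simp only [mem_filter, mem_Icc]
    rintro b ⟨hb, k, hk, hkb, h⟩ ⟨hb', l, hl, hlb, h'⟩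
    exact (hW k hk).not_adj_succ (hW l hl) hP hkb hlb hb'.2 h h'
  · simp only [mem_filter, mem_Icc, mem_union, mem_neutral, mem_unitGaps]
    rintro b ⟨hb, k, hk, hkb, h⟩
    have hX := (hW k hk).not_adj_one_pred hP hkb hb.2 h
    have hY := (hW k hk).not_adj_last_pred hP hkb hb.2 h
    have hak := ha k hk
    obtain ⟨h1, h2, h3, h4⟩ := hW k hk
    obtain ⟨b, rfl⟩ := Nat.exists_eq_add_of_le' (show 2 ≤ b by omega)
    simp only [Nat.add_succ_sub_one] at hX hY
    by_cases hYb : H.Adj n b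
    · by_cases hXb : H.Adj 1 (b + 2)
      · exact ⟨b + 1, .inr ⟨by
          have : b ≠ 0 := by rintro rfl; exact absurd hkb (by omega)
          omega, by omega, by simpa using hYb, hXb⟩, .inr rfl⟩
      · exact ⟨b + 1, .inl ⟨⟨by omega, by omega, hXb, hY⟩, by omega⟩, .inr rfl⟩
    · have hkb' : k ≠ b + 1 := by
        rintro rfl
        exact hYb (by simpa using h3)
      exact ⟨b, .inl ⟨⟨by omega, by omega, hX, hYb⟩, by omega⟩, .inl rfl⟩

theorem card_left_neighbors_le (hP : IsNoncyclicPath H n) (hW : ∀ k ∈ W, IsUnitGap H n k) {c : ℕ}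
    (hc : ∀ k ∈ W, k ≤ c) :
    {b ∈ Icc 1 n | ∃ k ∈ W, b < k ∧ H.Adj k b}.card
      ≤ {m ∈ neutral H n | ¬ c ≤ m}.card + (unitGaps H n).card := by
  refine (card_le_card_of_no_consecutive 0 ?_ ?_).trans (card_union_le _ _)
  · simp only [mem_filter, mem_Icc]
    rintro b ⟨hb, k, hk, hkb, h⟩ ⟨hb', l, hl, hlb, h'⟩
    exact (hW k hk).not_adj_succ_left (hW l hl) hP hkb hlb hb.1 h h'
  · simp only [mem_filter, mem_Icc, mem_union, mem_neutral, mem_unitGaps]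
    rintro b ⟨hb, k, hk, hkb, h⟩
    have hX := (hW k hk).not_adj_one_succ hP hkb hb.1 h
    have hY := (hW k hk).not_adj_last_succ hP hkb hb.1 h
    have hkc := hc k hk
    obtain ⟨h1, h2, h3, h4⟩ := hW k hk
    by_cases hYb : H.Adj n b
    · by_cases hXb : H.Adj 1 (b + 2)
      · exact ⟨b + 1, .inr ⟨by omega, by omega, by simpa using hYb, hXb⟩, .inr rfl⟩
      · have hkb' : k ≠ b + 1 := by
          rintro rfl
          exact hXb h4
        exact ⟨b + 1, .inl ⟨⟨by omega, by omega, hXb, hY⟩, by omega⟩, .inr rfl⟩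
    · exact ⟨b, .inl ⟨⟨by omega, by omega, hX, hYb⟩, by omega⟩, .inl rfl⟩

theorem card_pathNeighbors_le (hP : IsNoncyclicPath H n) (hW : ∀ k ∈ W, IsUnitGap H n k) {a c : ℕ}
    (ha : ∀ k ∈ W, a ≤ k) (hc : ∀ k ∈ W, k ≤ c) :
    (pathNeighbors H n W).card ≤ {m ∈ neutral H n | a ≤ m}.card
      + {m ∈ neutral H n | ¬ c ≤ m}.card + 2 * (unitGaps H n).card := by
  have hsub : pathNeighbors H n W ⊆ {b ∈ Icc 1 n | ∃ k ∈ W, k < b ∧ H.Adj k b}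
      ∪ {b ∈ Icc 1 n | ∃ k ∈ W, b < k ∧ H.Adj k b} := by
    intro b hb
    simp only [pathNeighbors, mem_filter, mem_union] at hb ⊢
    obtain ⟨hb, k, hk, h⟩ := hb
    rcases h.ne.lt_or_gt with hkb | hkb
    · exact .inl ⟨hb, k, hk, hkb, h⟩
    · exact .inr ⟨hb, k, hk, hkb, h⟩
  have := (card_le_card hsub).trans (card_union_le _ _)
  have := card_right_neighbors_le hP hW ha
  have := card_left_neighbors_le hP hW hc
  omega

/-- The consequence of `t`-toughness for independent subsets of the path `1, …, n` that avoid `1`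
and its neighbours. -/
def HasLargeNeighborhoods (H : SimpleGraph ℕ) (n : ℕ) (t : ℚ) : Prop :=
  ∀ W : Finset ℕ, W.Nonempty → (∀ k ∈ W, 2 ≤ k ∧ k ≤ n ∧ ¬ H.Adj 1 k) →
    (∀ k ∈ W, ∀ l ∈ W, ¬ H.Adj k l) → t * (W.card + 1) ≤ (pathNeighbors H n W).card

theorem not_isUnitGap (hP : IsNoncyclicPath H n) {t : ℚ} (ht : 4 ≤ t)
    (hN : ((neutral H n).card : ℚ) ≤ t - 1) (hH : HasLargeNeighborhoods H n t) (k : ℕ) :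
    ¬ IsUnitGap H n k := by
  intro hk
  have hlarge : ∀ W : Finset ℕ, W.Nonempty → (∀ k ∈ W, IsUnitGap H n k) →
      t * (W.card + 1) ≤ (pathNeighbors H n W).card := fun W hne hW =>
    hH W hne (fun l hl => ⟨(hW l hl).1, by linarith [(hW l hl).2.1], (hW l hl).not_adj_one hP⟩)
      fun l hl m hm => (hW l hl).not_adj (hW m hm) hP
  obtain hg | hg := (Nat.succ_le_of_lt (card_pos.2 ⟨k, mem_unitGaps.2 hk⟩)).eq_or_lt
  · have h1 := hlarge {k} (singleton_nonempty k) (by simpa using hk)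
    have h2 := card_pathNeighbors_le hP (W := {k}) (by simpa using hk) (a := k) (c := k)
      (by simp) (by simp)
    rw [card_filter_add_card_filter_not, ← hg] at h2
    have h3 : ((pathNeighbors H n {k}).card : ℚ) ≤ (neutral H n).card + 2 := by exact_mod_cast h2
    rw [card_singleton] at h1
    push_cast at h1
    linarith
  · have hgap : ∀ l ∈ unitGaps H n, IsUnitGap H n l := fun l hl => mem_unitGaps.1 hl
    have h1 := hlarge _ ⟨k, mem_unitGaps.2 hk⟩ hgap
    have h2 := card_pathNeighbors_le hP hgap (a := 0) (c := n) (fun _ _ => Nat.zero_le _)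
      (fun l hl => by linarith [(hgap l hl).2.1])
    have h3 := card_filter_le (neutral H n) (fun m => 0 ≤ m)
    have h4 := card_filter_le (neutral H n) (fun m => ¬ n ≤ m)
    have h5 : ((pathNeighbors H n (unitGaps H n)).card : ℚ)
        ≤ 2 * (neutral H n).card + 2 * (unitGaps H n).card := by
      exact_mod_cast (show _ ≤ _ by omega)
    have h6 : (2 : ℚ) ≤ (unitGaps H n).card := by exact_mod_cast hg
    nlinarith

/-- The vertices `i`, `i + 1` of the path `1, …, n` form a crossing-gap of size two. -/
structure IsDoubleGap (H : SimpleGraph ℕ) (n i : ℕ) : Prop where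
  two_le : 2 ≤ i
  le : i + 2 ≤ n
  not_adj_one : ¬ H.Adj 1 i
  not_adj_last : ¬ H.Adj n i
  not_adj_one_succ : ¬ H.Adj 1 (i + 1)
  not_adj_last_succ : ¬ H.Adj n (i + 1)
  adj_last : H.Adj n (i - 1)
  adj_one : H.Adj 1 (i + 2)

namespace IsDoubleGap

variable {i j b : ℕ}

theorem not_adj_last_of_le (hi : IsDoubleGap H n i) (hP : IsNoncyclicPath H n) (hb : 1 ≤ b)
    (hbi : b ≤ i) (h : H.Adj (i + 1) b) : ¬ H.Adj n (b + 1) := fun hy => by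
  have := hi.le
  exact hP.no_cycle (((hP.up hb le_rfl (by omega)).append h.symm
    (hP.down (a := b + 1) (b := i + 1) (by omega) (by omega) (by omega))).append hy.symm
    (hP.down hi.le (by omega) le_rfl)) hi.adj_one.symm (by omega) fun m _ _ => by omega

theorem not_adj_last_of_ge (hi : IsDoubleGap H n i) (hP : IsNoncyclicPath H n) (hb : b ≤ n)
    (hbi : i + 2 ≤ b) (h : H.Adj (i + 1) b) : ¬ H.Adj n (b - 1) := fun hy => by
  have := hi.le
  obtain rfl | hbi := hbi.eq_or_lt
  · exact hi.not_adj_last_succ hy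
  · exact hP.no_cycle (((hP.up (a := 1) (b := i + 1) (by omega) le_rfl (by omega)).append h
      (hP.up hb (by omega) le_rfl)).append hy
      (hP.down (a := i + 2) (by omega) (by omega) (by omega))) hi.adj_one.symm (by omega)
      fun m _ _ => by omega

theorem not_adj_one_of_le_of_right (hi : IsDoubleGap H n i) (hP : IsNoncyclicPath H n)
    (hij : i + 3 ≤ j) (hj : j + 2 ≤ n) (hy : H.Adj n (j - 1)) (h : H.Adj i j) (hb : 1 ≤ b)
    (hbi : b ≤ i) (hib : H.Adj (i + 1) b) : ¬ H.Adj 1 (b + 1) := fun hx => by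
  obtain rfl | hbi := hbi.eq_or_lt
  · exact hi.not_adj_one_succ hx
  · exact hP.no_cycle (((((walkCovers_self H (i + 1)).append hib
      (hP.down hb le_rfl (by omega))).append hx (hP.up hbi (by omega) (by omega))).append h
      (hP.up (a := j) (b := n) (by omega) (by omega) le_rfl)).append hy
      (hP.down (a := i + 2) (by omega) (by omega) (by omega)))
      (hP.adj_succ (i + 1) (by omega) (by omega)).symm (by omega) fun m _ _ => by omega

theorem not_adj_one_of_lt_of_right (hi : IsDoubleGap H n i) (hP : IsNoncyclicPath H n)
    (hj : j + 2 ≤ n) (hy : H.Adj n (j - 1)) (h : H.Adj i j) (hbi : i + 2 ≤ b)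
    (hbj : b < j) (hib : H.Adj (i + 1) b) : ¬ H.Adj 1 (b - 1) := fun hx => by
  obtain rfl | hbi := hbi.eq_or_lt
  · exact hi.not_adj_one_succ hx
  · have := hi.two_le
    exact hP.no_cycle (((((walkCovers_self H (i + 1)).append hib
      (hP.up (b := j - 1) (by omega) (by omega) (by omega))).append hy.symm
      (hP.down (a := j) (by omega) (by omega) le_rfl)).append h.symm
      (hP.down (a := 1) (by omega) le_rfl (by omega))).append hx
      (hP.down (a := i + 2) (by omega) (by omega) (by omega)))
      (hP.adj_succ (i + 1) (by omega) (by omega)).symm (by omega) fun m _ _ => by omega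

theorem not_adj_one_of_ge_of_right (hi : IsDoubleGap H n i) (hP : IsNoncyclicPath H n)
    (hij : i + 3 ≤ j) (hy : H.Adj n (j - 1)) (h : H.Adj i j) (hbj : j ≤ b) (hb : b + 1 ≤ n)
    (hib : H.Adj (i + 1) b) : ¬ H.Adj 1 (b + 1) := fun hx => by
  have := hi.two_le
  exact hP.no_cycle (((((walkCovers_self H (i + 1)).append hib
    (hP.down hbj (by omega) (by omega))).append h.symm
    (hP.down (a := 1) (by omega) le_rfl (by omega))).append hx
    (hP.up hb (by omega) le_rfl)).append hy
    (hP.down (a := i + 2) (by omega) (by omega) (by omega)))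
    (hP.adj_succ (i + 1) (by omega) (by omega)).symm (by omega) fun m _ _ => by omega

theorem not_adj_succ_of_le_of_right (hi : IsDoubleGap H n i) (hP : IsNoncyclicPath H n)
    (hij : i + 3 ≤ j) (hj : j + 2 ≤ n) (hy : H.Adj n (j - 1)) (h : H.Adj i j) (hb : 1 ≤ b)
    (hbi : b ≤ i) (hib : H.Adj (i + 1) b) : ¬ H.Adj (i + 1) (b + 1) := fun hib' => by
  obtain rfl | hbi := hbi.eq_or_lt
  · exact hib'.ne rfl
  · exact hP.no_cycle (((((hP.up hb le_rfl (by omega)).append hib.symm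
      (walkCovers_self H (i + 1))).append hib' (hP.up hbi (by omega) (by omega))).append h
      (hP.up (a := j) (b := n) (by omega) (by omega) le_rfl)).append hy
      (hP.down (a := i + 2) (by omega) (by omega) (by omega)))
      hi.adj_one.symm (by omega) fun m _ _ => by omega

theorem not_adj_succ_of_lt_of_right (hi : IsDoubleGap H n i) (hP : IsNoncyclicPath H n)
    (hj : j + 2 ≤ n) (hy : H.Adj n (j - 1)) (h : H.Adj i j) (hbi : i + 2 ≤ b)
    (hbj : b + 1 < j) (hib : H.Adj (i + 1) b) : ¬ H.Adj (i + 1) (b + 1) := fun hib' => by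
  have := hi.two_le
  exact hP.no_cycle (((((hP.up (a := 1) (b := i) (by omega) le_rfl (by omega)).append h
    (hP.up (a := j) (b := n) (by omega) (by omega) le_rfl)).append hy
    (hP.down (a := b + 1) (by omega) (by omega) (by omega))).append hib'.symm
    (walkCovers_self H (i + 1))).append hib (hP.down hbi (by omega) (by omega)))
    hi.adj_one.symm (by omega) fun m _ _ => by omega

theorem not_adj_one_of_lt_of_left (hi : IsDoubleGap H n i) (hP : IsNoncyclicPath H n)
    (hji : j + 2 ≤ i) (hy : H.Adj n (j + 1)) (h : H.Adj i j) (hb : 1 ≤ b) (hbj : b < j)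
    (hib : H.Adj (i + 1) b) : ¬ H.Adj 1 (b + 1) := fun hx => by
  have := hi.le
  exact hP.no_cycle (((((walkCovers_self H (i + 1)).append hib
    (hP.down hb le_rfl (by omega))).append hx (hP.up hbj (by omega) (by omega))).append h.symm
    (hP.down (a := j + 1) (by omega) (by omega) (by omega))).append hy.symm
    (hP.down hi.le (by omega) le_rfl))
    (hP.adj_succ (i + 1) (by omega) (by omega)).symm (by omega) fun m _ _ => by omega

theorem not_adj_one_of_gt_of_left (hi : IsDoubleGap H n i) (hP : IsNoncyclicPath H n)
    (hj : 3 ≤ j) (hy' : H.Adj n (j - 1)) (hy : H.Adj n (j + 1)) (h : H.Adj i j) (hbj : j < b)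
    (hbi : b ≤ i) (hib : H.Adj (i + 1) b) : ¬ H.Adj 1 (b - 1) := fun hx => by
  have := hi.le
  obtain rfl | hbj := (show j + 1 ≤ b from hbj).eq_or_lt
  · exact hP.not_crossing (m := j - 1) (by omega) (by omega)
      (by rwa [Nat.sub_add_cancel (by omega)]) hy'
  · exact hP.no_cycle (((((walkCovers_self H (i + 1)).append hib
      (hP.up hbi (by omega) (by omega))).append h
      (hP.down (a := 1) (by omega) le_rfl (by omega))).append hx
      (hP.down (a := j + 1) (by omega) (by omega) (by omega))).append hy.symm
      (hP.down hi.le (by omega) le_rfl))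
      (hP.adj_succ (i + 1) (by omega) (by omega)).symm (by omega) fun m _ _ => by omega

theorem not_adj_one_of_ge_of_left (hi : IsDoubleGap H n i) (hP : IsNoncyclicPath H n)
    (hj : 3 ≤ j) (hji : j + 2 ≤ i) (hy : H.Adj n (j + 1)) (h : H.Adj i j) (hbi : i + 2 ≤ b)
    (hb : b ≤ n) (hib : H.Adj (i + 1) b) : ¬ H.Adj 1 (b - 1) := fun hx => by
  obtain rfl | hbi := hbi.eq_or_lt
  · exact hi.not_adj_one_succ hx
  · exact hP.no_cycle (((((walkCovers_self H (i + 1)).append hib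
      (hP.up hb (by omega) le_rfl)).append hy
      (hP.up (b := i) (by omega) (by omega) (by omega))).append h
      (hP.down (a := 1) (by omega) le_rfl (by omega))).append hx
      (hP.down (a := i + 2) (by omega) (by omega) (by omega)))
      (hP.adj_succ (i + 1) (by omega) (by omega)).symm (by omega) fun m _ _ => by omega

theorem not_adj_succ_of_left (hi : IsDoubleGap H n i) (hP : IsNoncyclicPath H n)
    (hj : 3 ≤ j) (hji : j + 2 ≤ i) (hy : H.Adj n (j + 1)) (h : H.Adj i j) (hb : 1 ≤ b)
    (hbn : b + 1 ≤ n) (hib : H.Adj (i + 1) b) : ¬ H.Adj (i + 1) (b + 1) := fun hib' => by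
  have := hi.le
  have hbi : b ≠ i + 1 := by
    rintro rfl
    exact hib.ne rfl
  have hbi' : b ≠ i := by
    rintro rfl
    exact hib'.ne rfl
  have hbj : b ≠ j := by
    rintro rfl
    exact hi.not_adj_last_of_le hP hb (by omega) hib hy
  by_cases hlt : b < j
  · exact hP.no_cycle (((((hP.up hb le_rfl (by omega)).append hib.symm
      (walkCovers_self H (i + 1))).append hib' (hP.up (b := j) (by omega) (by omega)
      (by omega))).append h.symm
      (hP.down (a := j + 1) (by omega) (by omega) (by omega))).append hy.symm
      (hP.down hi.le (by omega) le_rfl))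
      hi.adj_one.symm (by omega) fun m _ _ => by omega
  by_cases hle : b < i
  · exact hP.no_cycle (((((hP.up (a := 1) (b := j) (by omega) le_rfl (by omega)).append h.symm
      (hP.down (a := b + 1) (by omega) (by omega) (by omega))).append hib'.symm
      (walkCovers_self H (i + 1))).append hib
      (hP.down (a := j + 1) (by omega) (by omega) (by omega))).append hy.symm
      (hP.down hi.le (by omega) le_rfl))
      hi.adj_one.symm (by omega) fun m _ _ => by omega
  · exact hP.no_cycle (((((hP.up (a := 1) (b := j) (by omega) le_rfl (by omega)).append h.symm
      (hP.down (a := j + 1) (by omega) (by omega) (by omega))).append hy.symm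
      (hP.down hbn (by omega) le_rfl)).append hib'.symm
      (walkCovers_self H (i + 1))).append hib
      (hP.down (a := i + 2) (by omega) (by omega) (by omega)))
      hi.adj_one.symm (by omega) fun m _ _ => by omega

/-- If a `Y` position is never followed by an `X` position, and a `P` position is never an `X`
position nor preceded by a `Y` position, then the `P` positions number at most twice the positions
that are neither `X` nor `Y`. -/
theorem card_le_two_mul_card_neither {X Y P : ℕ → Prop} {s e : ℕ} (hse : s ≤ e) (hs : Y s)
    (hYX : ∀ m, s ≤ m → m < e → Y m → ¬ X (m + 1))
    (hPY : ∀ m, s ≤ m → m < e → P (m + 1) → ¬ Y m)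
    (hPX : ∀ m, s < m → m ≤ e → P m → ¬ X m) :
    {m ∈ Ioc s e | P m}.card + (if Y e then 0 else 1)
      ≤ 2 * {m ∈ Ioc s e | ¬ X m ∧ ¬ Y m}.card := by
  induction e, hse using Nat.le_induction with
  | base => simp [hs]
  | succ e hse ih =>
    have ih := ih (fun m h1 h2 => hYX m h1 (by omega)) (fun m h1 h2 => hPY m h1 (by omega))
      (fun m h1 h2 => hPX m h1 (by omega))
    have h1 := hYX e hse (by omega)
    have h2 := hPY e hse (by omega)
    have h3 := hPX (e + 1) (by omega) le_rfl
    simp only [card_filter, Finset.sum_Ioc_succ_top hse] at ih ⊢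
    clear hYX hPY hPX hs
    split_ifs at ih ⊢ <;> first | omega | tauto

theorem mem_neutral_of_not_isUnitGap (hU : ∀ k, ¬ IsUnitGap H n k) (hb : 1 ≤ b) (hbn : b + 2 ≤ n)
    (hx : ¬ H.Adj 1 (b + 1)) (hy : ¬ H.Adj n (b + 1)) :
    b ∈ neutral H n ∨ b + 1 ∈ neutral H n := by
  simp only [mem_neutral]
  by_cases hyb : H.Adj n b
  · exact .inr ⟨by omega, hbn, fun hxb => hU (b + 1) ⟨by omega, hbn, hyb, hxb⟩, hy⟩
  · exact .inl ⟨hb, by omega, hx, hyb⟩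

theorem mem_neutral (hi : IsDoubleGap H n i) : i ∈ neutral H n :=
  SimpleGraph.mem_neutral.2 ⟨by linarith [hi.two_le], by linarith [hi.le], hi.not_adj_one_succ,
    hi.not_adj_last⟩

theorem succ_notMem_neutral (hi : IsDoubleGap H n i) : i + 1 ∉ neutral H n := fun h =>
  (SimpleGraph.mem_neutral.1 h).2.2.1 hi.adj_one

theorem lt_of_adj (hi : IsDoubleGap H n i) (hbn : b ≤ n) (h : H.Adj (i + 1) b) : b < n :=
  lt_of_le_of_ne hbn fun e => hi.not_adj_last_succ (e ▸ h.symm)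

theorem card_neighbors_le_of_left (hi : IsDoubleGap H n i) (hP : IsNoncyclicPath H n)
    (hU : ∀ k, ¬ IsUnitGap H n k) (hj : 3 ≤ j) (hji : j + 2 ≤ i) (hy' : H.Adj n (j - 1))
    (hy : H.Adj n (j + 1)) (h : H.Adj i j) :
    {b ∈ Icc 1 n | H.Adj (i + 1) b}.card ≤ 2 * (neutral H n).card := by
  have hin := hi.le
  set B := {b ∈ Icc 1 n | H.Adj (i + 1) b} with hB
  have hcons : ∀ b ∈ B, b + 1 ∉ B := by
    simp only [hB, mem_filter, mem_Icc]
    rintro b ⟨hb, hib⟩ ⟨hb', hib'⟩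
    exact hi.not_adj_succ_of_left hP hj hji hy h hb.1 hb'.2 hib hib'
  have hsub : B ⊆ {b ∈ B | ∃ m ∈ neutral H n, m + 0 = b ∨ m + 0 = b + 1}
      ∪ {b ∈ B | ∃ m ∈ neutral H n, m + 2 = b ∨ m + 2 = b + 1} := by
    rw [← filter_or]
    intro b hbB
    refine mem_filter.2 ⟨hbB, ?_⟩
    simp only [hB, mem_filter, mem_Icc] at hbB
    obtain ⟨⟨hb, hbn⟩, hib⟩ := hbB
    have hbi : b ≠ i + 1 := by
      rintro rfl
      exact hib.ne rfl
    by_cases hle : b ≤ i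
    · have hyb := hi.not_adj_last_of_le hP hb hle hib
      have hbj : b ≠ j := by
        rintro rfl
        exact hyb hy
      by_cases hlt : b < j
      · have hxb := hi.not_adj_one_of_lt_of_left hP hji hy h hb hlt hib
        obtain hm | hm := mem_neutral_of_not_isUnitGap hU hb (by omega) hxb hyb
        · exact .inl ⟨_, hm, .inl rfl⟩
        · exact .inl ⟨_, hm, .inr rfl⟩
      · have hxb := hi.not_adj_one_of_gt_of_left hP hj hy' hy h (by omega) hle hib
        obtain ⟨b, rfl⟩ := Nat.exists_eq_add_of_le' (show 2 ≤ b by omega)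
        by_cases hyb' : H.Adj n (b + 1)
        · by_cases hxb' : H.Adj 1 (b + 2 + 1)
          · exact absurd ⟨by omega, by omega, hyb', hxb'⟩ (hU (b + 2))
          · obtain hm | hm := mem_neutral_of_not_isUnitGap hU hb (by omega) hxb' hyb
            · exact .inl ⟨_, hm, .inl rfl⟩
            · exact .inl ⟨_, hm, .inr rfl⟩
        · obtain hm | hm := mem_neutral_of_not_isUnitGap hU (b := b) (by omega) (by omega) hxb hyb'
          · exact .inr ⟨_, hm, .inl rfl⟩
          · exact .inr ⟨_, hm, .inr rfl⟩
    · have hyb := hi.not_adj_last_of_ge hP hbn (by omega) hib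
      have hxb := hi.not_adj_one_of_ge_of_left hP hj hji hy h (by omega) hbn hib
      obtain ⟨b, rfl⟩ := Nat.exists_eq_add_of_le' (show 2 ≤ b by omega)
      obtain hm | hm := mem_neutral_of_not_isUnitGap hU (b := b) (by omega) (by omega) hxb hyb
      · exact .inr ⟨_, hm, .inl rfl⟩
      · exact .inr ⟨_, hm, .inr rfl⟩
  have h1 := (card_le_card hsub).trans (card_union_le _ _)
  have h2 : ∀ s, {b ∈ B | ∃ m ∈ neutral H n, m + s = b ∨ m + s = b + 1}.card
      ≤ (neutral H n).card := fun s =>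
    card_le_card_of_no_consecutive s
      (fun b hb hb' => hcons b (mem_filter.1 hb).1 (mem_filter.1 hb').1)
      fun b hb => (mem_filter.1 hb).2
  have h3 := h2 0
  have h4 := h2 2
  omega

theorem card_neighbors_le_of_right (hi : IsDoubleGap H n i) (hP : IsNoncyclicPath H n)
    (hU : ∀ k, ¬ IsUnitGap H n k) (hij : i + 3 ≤ j) (hj : j + 2 ≤ n) (hy : H.Adj n (j - 1))
    (h : H.Adj i j) :
    {b ∈ Icc 1 n | H.Adj (i + 1) b}.card ≤ 2 * (neutral H n).card := by
  have hi2 := hi.two_le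
  have hB₁ : {b ∈ Icc 1 i | H.Adj (i + 1) b}.card
      ≤ (insert i {m ∈ neutral H n | m < i}).card := by
    refine card_le_card_of_no_consecutive 0 ?_ ?_
    · simp only [mem_filter, mem_Icc]
      rintro b ⟨hb, hib⟩ ⟨hb', hib'⟩
      exact hi.not_adj_succ_of_le_of_right hP hij hj hy h hb.1 hb.2 hib hib'
    · simp only [mem_filter, mem_Icc, mem_insert]
      rintro b ⟨⟨hb, hbi⟩, hib⟩
      have hyb := hi.not_adj_last_of_le hP hb hbi hib
      have hxb := hi.not_adj_one_of_le_of_right hP hij hj hy h hb hbi hib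
      obtain hm | hm := mem_neutral_of_not_isUnitGap hU hb (by omega) hxb hyb
      · exact ⟨b, hbi.eq_or_lt.imp_right fun hlt => ⟨hm, hlt⟩, .inl rfl⟩
      · have hbi' : b ≠ i := by
          rintro rfl
          exact hi.succ_notMem_neutral hm
        exact ⟨b + 1, (show b + 1 ≤ i by omega).eq_or_lt.imp_right fun hlt => ⟨hm, hlt⟩, .inr rfl⟩
  have hB₂ : {b ∈ Ico (i + 2) j | H.Adj (i + 1) b}.card
      ≤ (insert i {m ∈ neutral H n | i < m ∧ m < j}).card := by
    refine card_le_card_of_no_consecutive 2 ?_ ?_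
    · simp only [mem_filter, mem_Ico]
      rintro b ⟨hb, hib⟩ ⟨hb', hib'⟩
      exact hi.not_adj_succ_of_lt_of_right hP hj hy h hb.1 hb'.2 hib hib'
    · simp only [mem_filter, mem_Ico, mem_insert]
      rintro b ⟨⟨hbi, hbj⟩, hib⟩
      have hyb := hi.not_adj_last_of_ge hP (by omega) hbi hib
      have hxb := hi.not_adj_one_of_lt_of_right hP hj hy h hbi hbj hib
      obtain ⟨b, rfl⟩ := Nat.exists_eq_add_of_le' (show 2 ≤ b by omega)
      obtain hm | hm := mem_neutral_of_not_isUnitGap hU (b := b) (by omega) (by omega) hxb hyb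
      · exact ⟨b, (show i ≤ b by omega).eq_or_lt.imp Eq.symm fun hlt => ⟨hm, hlt, by omega⟩,
          .inl rfl⟩
      · exact ⟨b + 1, .inr ⟨hm, by omega, by omega⟩, .inr rfl⟩
  have hB₃ := card_le_two_mul_card_neither (X := fun m => H.Adj 1 (m + 1)) (Y := fun m => H.Adj n m)
    (P := fun m => H.Adj (i + 1) m) (s := j - 1) (e := n - 1) (by omega) hy
    (fun m h1 h2 hm hm' => hU (m + 1) ⟨by omega, by omega, hm, hm'⟩)
    (fun m h1 h2 hm => hi.not_adj_last_of_ge hP (by omega) (by omega) hm)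
    (fun m h1 h2 hm => hi.not_adj_one_of_ge_of_right hP hij hy h (by omega) (by omega) hm)
  have hN₃ : {m ∈ Ioc (j - 1) (n - 1) | ¬ H.Adj 1 (m + 1) ∧ ¬ H.Adj n m}
      ⊆ {m ∈ neutral H n | i < m ∧ ¬ m < j} := by
    intro m
    simp only [mem_filter, mem_Ioc, SimpleGraph.mem_neutral]
    rintro ⟨hm, hm'⟩
    exact ⟨⟨by omega, by omega, hm'⟩, by omega, by omega⟩
  have hsub : {b ∈ Icc 1 n | H.Adj (i + 1) b} ⊆ ({b ∈ Icc 1 i | H.Adj (i + 1) b}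
      ∪ {b ∈ Ico (i + 2) j | H.Adj (i + 1) b}) ∪ {b ∈ Ioc (j - 1) (n - 1) | H.Adj (i + 1) b} := by
    intro b
    simp only [mem_union, mem_filter, mem_Icc, mem_Ico, mem_Ioc, ← or_and_right]
    rintro ⟨hb, hib⟩
    have hbn := hi.lt_of_adj hb.2 hib
    have hbi : b ≠ i + 1 := by
      rintro rfl
      exact hib.ne rfl
    exact ⟨by omega, hib⟩
  have hN : insert i ({m ∈ neutral H n | m < i} ∪ ({m ∈ neutral H n | i < m ∧ m < j}
      ∪ {m ∈ neutral H n | i < m ∧ ¬ m < j})) ⊆ neutral H n := by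
    rw [insert_subset_iff]
    exact ⟨hi.mem_neutral, union_subset (filter_subset _ _)
      (union_subset (filter_subset _ _) (filter_subset _ _))⟩
  have hcard := card_le_card hN
  rw [card_insert_of_notMem (by simp), card_union_of_disjoint, card_union_of_disjoint] at hcard
  · have h1 := (card_le_card hsub).trans (card_union_le _ _)
    have h2 := card_union_le {b ∈ Icc 1 i | H.Adj (i + 1) b} {b ∈ Ico (i + 2) j | H.Adj (i + 1) b}
    have h3 := card_insert_le i {m ∈ neutral H n | m < i}
    have h4 := card_insert_le i {m ∈ neutral H n | i < m ∧ m < j}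
    have h5 := card_le_card hN₃
    omega
  · exact disjoint_filter.2 fun m _ h1 h2 => h2.2 h1.2
  · rw [← filter_or]
    exact disjoint_filter.2 fun m _ h1 h2 => by omega

theorem not_adj_of_adj_last (hi : IsDoubleGap H n i) (hP : IsNoncyclicPath H n) {t : ℚ}
    (ht : 4 ≤ t) (hN : ((neutral H n).card : ℚ) ≤ t - 1) (hH : HasLargeNeighborhoods H n t)
    (hj : 3 ≤ j) (hjn : j + 2 ≤ n) (hy' : H.Adj n (j - 1)) (hy : H.Adj n (j + 1)) :
    ¬ H.Adj i j := by
  intro h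
  have hU := not_isUnitGap hP ht hN hH
  have hin := hi.le
  have hji : j ≠ i := h.ne'
  have hji₁ : j ≠ i + 1 := by
    rintro rfl
    exact hi.not_adj_last hy'
  have hji₂ : j ≠ i + 2 := by
    rintro rfl
    exact hi.not_adj_last_succ hy'
  have hji₃ : j + 1 ≠ i := by
    rintro rfl
    exact hi.not_adj_last hy
  have hle : {b ∈ Icc 1 n | H.Adj (i + 1) b}.card ≤ 2 * (neutral H n).card := by
    rcases hji.lt_or_gt with hlt | hlt
    · exact hi.card_neighbors_le_of_left hP hU hj (by omega) hy' hy h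
    · exact hi.card_neighbors_le_of_right hP hU (by omega) hjn hy' h
  have hge := hH {i + 1} (singleton_nonempty _)
    (by simpa using ⟨by linarith [hi.two_le], by omega, hi.not_adj_one_succ⟩) (by simp)
  simp only [card_singleton, pathNeighbors, mem_singleton, exists_eq_left] at hge
  have hle' : ({b ∈ Icc 1 n | H.Adj (i + 1) b}.card : ℚ) ≤ 2 * (neutral H n).card := by
    exact_mod_cast hle
  push_cast at hge
  linarith

end IsDoubleGap

end Counting

theorem Walk.IsPath.isHamiltonian_of_adj {V : Type*} [Fintype V] [DecidableEq V]
    {G : SimpleGraph V} {a b : V} {p : G.Walk a b} (hp : p.IsPath) (hmem : ∀ u, u ∈ p.support)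
    (hba : G.Adj b a) (hV : 3 ≤ Fintype.card V) : G.IsHamiltonian := by
  intro _
  have hH := hp.isHamiltonian_of_mem hmem
  refine ⟨b, .cons hba p, ⟨(cons_isCycle_iff p hba).2 ⟨hp, fun he => ?_⟩, ?_⟩⟩
  · have h1 := hp.length_eq_one_of_mem_edges (by rwa [Sym2.eq_swap] at he)
    have h2 := hH.length_eq
    omega
  · rw [isHamiltonian_iff_isPath_and_length_eq]
    simpa using ⟨hp, hH.length_eq⟩

theorem Tough.mul_card_add_one_le_s15 {V : Type*} [Fintype V] {t : ℚ} {G : SimpleGraph V}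
    (hG : G.Tough t) {W : Finset V} (hW : W.Nonempty) (hind : ∀ w ∈ W, ∀ u ∈ W, ¬ G.Adj w u)
    {z : V} (hz : z ∉ W) (hWz : ∀ w ∈ W, ¬ G.Adj w z) (S : Finset V)
    (hS : ∀ u, u ∈ S ↔ ∃ w ∈ W, G.Adj w u) : t * (W.card + 1) ≤ S.card := by
  classical
  have hWS : ∀ u ∈ insert z W, u ∈ (↑S : Set V)ᶜ := by
    intro u hu
    rw [Set.mem_compl_iff, mem_coe, hS]
    rintro ⟨w, hw, hwu⟩
    obtain rfl | hu := mem_insert.1 hu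
    · exact hWz w hw hwu
    · exact hind w hw u hu hwu
  have hiso : ∀ (w : ((↑S : Set V)ᶜ : Set V)) (u : ((↑S : Set V)ᶜ : Set V)), w.1 ∈ W →
      (G.induce (↑S : Set V)ᶜ).Reachable w u → w = u := by
    rintro w u hw ⟨p⟩
    cases p with
    | nil => rfl
    | @cons _ x _ h _ => exact absurd (mem_coe.2 ((hS x.1).2 ⟨_, hw, by simpa using h⟩)) x.2
  have hcard : W.card + 1 ≤ Nat.card (G.induce (↑S : Set V)ᶜ).ConnectedComponent := by
    rw [← card_insert_of_notMem hz, ← Nat.card_eq_finsetCard]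
    refine Nat.card_le_card_of_injective (fun u : ↥(insert z W) =>
      (G.induce (↑S : Set V)ᶜ).connectedComponentMk ⟨u.1, hWS u.1 u.2⟩) ?_
    rintro ⟨u, hu⟩ ⟨w, hw⟩ h
    have h := ConnectedComponent.exact h
    rw [Subtype.mk.injEq]
    rcases mem_insert.1 hu with rfl | hu'
    · rcases mem_insert.1 hw with rfl | hw'
      · rfl
      · exact (congrArg Subtype.val (hiso _ _ hw' h.symm)).symm
    · exact congrArg Subtype.val (hiso _ _ hu' h)
  have ht := hG S (by have := hW.card_pos; omega)
  have hS0 : (0 : ℚ) ≤ S.card := Nat.cast_nonneg _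
  have hc : (W.card : ℚ) + 1 ≤ Nat.card (G.induce (↑S : Set V)ᶜ).ConnectedComponent := by
    exact_mod_cast hcard
  rcases le_total 0 t with ht0 | ht0
  · exact (mul_le_mul_of_nonneg_left hc ht0).trans ht
  · exact (mul_nonpos_of_nonpos_of_nonneg ht0 (by positivity)).trans hS0

section Labelling

variable {V : Type*} [Fintype V] {G : SimpleGraph V} {v : ℕ → V}

theorem isNoncyclicPath_comap [DecidableEq V] (hn : Fintype.card V = n) (hn3 : 3 ≤ n)
    (hG : ¬ G.IsHamiltonian) (hv : Set.BijOn v (Set.Icc 1 n) Set.univ)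
    (hpath : ∀ i, 1 ≤ i → i < n → G.Adj (v i) (v (i + 1))) (hends : ¬ G.Adj (v 1) (v n)) :
    IsNoncyclicPath (G.comap v) n where
  adj_succ := hpath
  not_adj_ends := hends
  no_cycle := by
    rintro a b S k ⟨p, hp, hpS⟩ hba hk hS
    have hmem : ∀ u, u ∈ (p.map (Hom.comap v G)).support := by
      intro u
      obtain ⟨m, hm, rfl⟩ := hv.surjOn (Set.mem_univ u)
      rw [Walk.support_map]
      exact List.mem_map.2 ⟨m, hpS m (hS m hm.1 hm.2), rfl⟩
    have hlen : (p.map (Hom.comap v G)).support.length = n := by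
      rw [Walk.length_support, Walk.length_map]
      omega
    have hnodup : (p.map (Hom.comap v G)).support.Nodup := by
      refine Multiset.coe_nodup.1 (Multiset.toFinset_card_eq_card_iff_nodup.1 ?_)
      rw [Multiset.coe_card, hlen, ← hn, ← card_univ]
      congr 1
      ext u
      simpa using hmem u
    exact hG (((Walk.isPath_def _).2 hnodup).isHamiltonian_of_adj hmem hba (hn ▸ hn3))

theorem hasLargeNeighborhoods_comap {t : ℚ} (hG : G.Tough t)
    (hv : Set.BijOn v (Set.Icc 1 n) Set.univ) (hn : 1 ≤ n) :
    HasLargeNeighborhoods (G.comap v) n t := by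
  classical
  intro W hW hW₁ hind
  have hinj : Set.InjOn v W := hv.injOn.mono fun k hk => by
    have := hW₁ k hk
    exact ⟨by omega, this.2.1⟩
  have := hG.mul_card_add_one_le_s15 (W := W.image v) (z := v 1) (hW.image v)
    (by simpa using hind) ?_ (by simpa using fun k hk h => (hW₁ k hk).2.2 h.symm)
    ((pathNeighbors (G.comap v) n W).image v) ?_
  · rw [card_image_of_injOn hinj] at this
    exact this.trans (by exact_mod_cast card_image_le)
  · rw [mem_image]
    rintro ⟨k, hk, h⟩
    have h2 := hW₁ k hk
    have := hv.injOn ⟨by omega, h2.2.1⟩ ⟨le_rfl, hn⟩ h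
    omega
  · intro u
    obtain ⟨m, hm, rfl⟩ := hv.surjOn (Set.mem_univ u)
    simp only [mem_image, pathNeighbors, mem_filter, mem_Icc, comap_adj]
    constructor
    · rintro ⟨b, ⟨-, k, hk, h⟩, hb⟩
      exact ⟨v k, ⟨k, hk, rfl⟩, hb ▸ h⟩
    · rintro ⟨-, ⟨k, hk, rfl⟩, h⟩
      exact ⟨m, ⟨hm, k, hk, h⟩, rfl⟩

theorem card_filter_adj_comap [DecidableRel G.Adj] (hv : Set.BijOn v (Set.Icc 1 n) Set.univ)
    (a : ℕ) [DecidablePred ((G.comap v).Adj a)] :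
    {m ∈ Icc 1 n | (G.comap v).Adj a m}.card = G.degree (v a) := by
  rw [← card_neighborFinset_eq_degree]
  refine card_bij (fun m _ => v m) ?_ ?_ ?_
  · simp
  · simp only [mem_filter, mem_Icc]
    exact fun m hm k hk h => hv.injOn hm.1 hk.1 h
  · intro u hu
    obtain ⟨m, hm, rfl⟩ := hv.surjOn (Set.mem_univ u)
    exact ⟨m, by simpa using ⟨hm, by simpa using hu⟩, rfl⟩

end Labelling

end SimpleGraph

/-- Let `t ≥ 4` be rational and `G` a `t`-tough non-Hamiltonian graph on `n ≥ 3`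
vertices with a Hamilton path `v 1, …, v n` from `x = v 1` to `y = v n`, where
`x ≁ y` and `deg x + deg y ≥ n − t`.  If `{v i, v (i+1)}` is a crossing-gap of
size 2 (neither vertex adjacent to `x` or `y`, with `v (i−1) ~ y` and
`v (i+2) ~ x`), then `v i ≁ v j` for every `j ∈ [3, n−2]` such that `y` is
adjacent to both `v (j−1)` and `v (j+1)`. -/
theorem crossing_gap_two_nonadjacency
    {V : Type*} [Fintype V] [DecidableEq V] (G : SimpleGraph V) [DecidableRel G.Adj]
    (n : ℕ) (t : ℚ) (ht : 4 ≤ t) (hn : Fintype.card V = n) (hn3 : 3 ≤ n)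
    (htough : SimpleGraph.Tough t G) (hnotham : ¬ G.IsHamiltonian)
    (v : ℕ → V) (hbij : Set.BijOn v (Set.Icc 1 n) Set.univ)
    (hpath : ∀ i, 1 ≤ i → i < n → G.Adj (v i) (v (i + 1)))
    (hnadj : ¬ G.Adj (v 1) (v n))
    (hdeg : (n : ℚ) - t ≤ (G.degree (v 1) : ℚ) + (G.degree (v n) : ℚ))
    (i : ℕ) (hi2 : 2 ≤ i) (hi : i ≤ n - 2)
    (h1 : ¬ G.Adj (v i) (v 1)) (h2 : ¬ G.Adj (v i) (v n))
    (h3 : ¬ G.Adj (v (i + 1)) (v 1)) (h4 : ¬ G.Adj (v (i + 1)) (v n))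
    (h5 : G.Adj (v (i - 1)) (v n)) (h6 : G.Adj (v (i + 2)) (v 1)) :
    ∀ j, 3 ≤ j → j ≤ n - 2 → G.Adj (v (j - 1)) (v n) → G.Adj (v (j + 1)) (v n) →
      ¬ G.Adj (v i) (v j) := by
  intro j hj3 hj hjy hjy'
  have hP := SimpleGraph.isNoncyclicPath_comap hn hn3 hnotham hbij hpath hnadj
  have hgap : SimpleGraph.IsDoubleGap (G.comap v) n i :=
    ⟨hi2, by omega, fun h => h1 h.symm, fun h => h2 h.symm, fun h => h3 h.symm,
      fun h => h4 h.symm, h5.symm, h6.symm⟩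
  refine hgap.not_adj_of_adj_last hP ht ?_
    (SimpleGraph.hasLargeNeighborhoods_comap htough hbij (by omega)) hj3 (by omega) hjy.symm
    hjy'.symm
  have hcard := SimpleGraph.card_neutral hP
  rw [SimpleGraph.card_filter_adj_comap hbij, SimpleGraph.card_filter_adj_comap hbij] at hcard
  have hcard' : ((SimpleGraph.neutral (G.comap v) n).card : ℚ) + G.degree (v 1) + G.degree (v n) + 1
      = n := by
    exact_mod_cast (show _ + 1 = n by omega)
  linarith
end

section
/- Let G be a non-Hamiltonian graph, z a vertex of G such that G − z has a Hamilton cycle C, and x, y two distinct neighbors of z. With the sets X = N(x^+), Y_1 = {w^− : w ∈ N(y^+) ∩ V^+_{y^+ x}}, Y_2 = {w^+ : w ∈ N(y^+) ∩ V^−_{y^+ x}}, and Y = Y_1 ∪ Y_2, we have X ∩ Y = ∅. -/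
/-- The predecessor `w⁻` of a vertex `w ≠ z` on the oriented cycle. -/
def cycPrev {V : Type*} [DecidableEq V] {z : V} {m : ℕ}
    (c : ZMod m ≃ {u : V // u ≠ z}) (w : V) : V :=
  if h : w = z then w else (c (c.symm ⟨w, h⟩ - 1)).1

/-- `cycArc c a b` is `V⁺_{ab}`: the set of vertices on the arc of the cycle
from `a` to `b` following the orientation, both endpoints included.
(Note `V⁻_{ab} = cycArc c b a`.) -/
def cycArc {V : Type*} {z : V} {m : ℕ}
    (c : ZMod m ≃ {u : V // u ≠ z}) (a b : V) : Set V :=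
  {w : V | ∃ (ha : a ≠ z) (hb : b ≠ z) (hw : w ≠ z),
    (c.symm ⟨w, hw⟩ - c.symm ⟨a, ha⟩).val ≤ (c.symm ⟨b, hb⟩ - c.symm ⟨a, ha⟩).val}

namespace SimpleGraph

variable {V : Type*} {G : SimpleGraph V}

/-- There is a path in `G` from `u` to `v` whose vertex set is exactly `S`. -/
def HasPathOn (G : SimpleGraph V) (u v : V) (S : Set V) : Prop :=
  ∃ p : G.Walk u v, p.IsPath ∧ ∀ w, w ∈ p.support ↔ w ∈ S

theorem HasPathOn.symm {u v : V} {S : Set V} (h : G.HasPathOn u v S) : G.HasPathOn v u S := by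
  obtain ⟨p, hp, hS⟩ := h
  exact ⟨p.reverse, hp.reverse, by simpa using hS⟩

theorem HasPathOn.singleton (G : SimpleGraph V) (u : V) : G.HasPathOn u u {u} :=
  ⟨Walk.nil, Walk.IsPath.nil, by simp⟩

theorem HasPathOn.join {u v u' v' : V} {S T : Set V} (h : G.HasPathOn u v S) (hadj : G.Adj v u')
    (h' : G.HasPathOn u' v' T) (hd : ∀ w ∈ S, w ∉ T) : G.HasPathOn u v' (S ∪ T) := by
  obtain ⟨p, hp, hS⟩ := h
  obtain ⟨q, hq, hT⟩ := h'
  have hsupp : (p.append (Walk.cons hadj q)).support = p.support ++ q.support := by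
    simp [Walk.support_append]
  refine ⟨p.append (Walk.cons hadj q), ?_, ?_⟩
  · rw [Walk.isPath_def, hsupp, List.nodup_append']
    refine ⟨hp.support_nodup, hq.support_nodup, fun w hw hw' => ?_⟩
    exact hd w ((hS w).1 hw) ((hT w).1 hw')
  · intro w
    rw [hsupp, List.mem_append, hS, hT, Set.mem_union]

theorem HasPathOn.isHamiltonian [Fintype V] [DecidableEq V] {x y z : V}
    (h : G.HasPathOn x y {z}ᶜ) (hx : G.Adj z x) (hy : G.Adj z y) (hne : x ≠ y) :
    G.IsHamiltonian := by
  obtain ⟨p, hp, hS⟩ := h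
  intro _
  have hz : z ∉ p.support := by simp [hS]
  have hpath : (p.concat hy.symm).IsPath := hp.concat hz hy.symm
  refine ⟨z, Walk.cons hx (p.concat hy.symm), ?_⟩
  rw [Walk.isHamiltonianCycle_iff_isCycle_and_support_count_tail_eq_one]
  refine ⟨(Walk.cons_isCycle_iff _ _).2 ⟨hpath, ?_⟩, fun w => ?_⟩
  · rw [Walk.edges_concat, List.concat_eq_append, List.mem_append]
    rintro (he | he)
    · exact hz (p.fst_mem_support_of_mem_edges he)
    · have := hx.ne
      simp only [List.mem_singleton, Sym2.eq_iff] at he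
      grind
  · rw [Walk.support_cons, List.tail_cons]
    refine List.count_eq_one_of_mem hpath.support_nodup ?_
    rw [Walk.support_concat, List.mem_append, hS]
    by_cases hw : w = z <;> simp [hw]

theorem HasPathOn.image_Icc {f : ℕ → V} {n : ℕ} (hinj : Set.InjOn f (Set.Iio n))
    (hadj : ∀ i, i + 1 < n → G.Adj (f i) (f (i + 1))) {i j : ℕ} (hij : i ≤ j) (hj : j < n) :
    G.HasPathOn (f i) (f j) (f '' Set.Icc i j) := by
  induction j, hij using Nat.le_induction with
  | base => simpa using HasPathOn.singleton G (f i)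
  | succ j hij ih =>
    have h := (ih (by omega)).join (hadj j hj) (HasPathOn.singleton G _) (by
      rintro _ ⟨a, ha, rfl⟩ h
      have ha' : a ≤ j := ha.2
      have := hinj (show a < n by omega) hj h
      omega)
    have hset : Set.Icc i (j + 1) = Set.Icc i j ∪ {j + 1} := by
      ext a; simp only [Set.mem_Icc, Set.mem_union, Set.mem_singleton_iff]; omega
    rwa [hset, Set.image_union, Set.image_singleton]

section Rotations

variable [Fintype V] [DecidableEq V] {z : V} {f : ℕ → V} {n k : ℕ}

theorem not_adj_succ_of_not_isHamiltonian_s16 (hG : ¬ G.IsHamiltonian)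
    (hinj : Set.InjOn f (Set.Iio n)) (himg : f '' Set.Iio n = {z}ᶜ)
    (hadj : ∀ i, i + 1 < n → G.Adj (f i) (f (i + 1))) (hk : k + 1 < n)
    (hzk : G.Adj z (f k)) (hzn : G.Adj z (f (n - 1))) : ¬ G.Adj (f 0) (f (k + 1)) := by
  intro h
  have hp := (HasPathOn.image_Icc hinj hadj (Nat.zero_le k) (by omega)).symm.join h
    (HasPathOn.image_Icc hinj hadj (show k + 1 ≤ n - 1 by omega) (by omega)) (by
      rintro _ ⟨a, ha, rfl⟩ ⟨b, hb, hab⟩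
      simp only [Set.mem_Icc] at ha hb
      have := hinj (show b < n by omega) (show a < n by omega) hab
      omega)
  rw [← Set.image_union, show Set.Icc 0 k ∪ Set.Icc (k + 1) (n - 1) = Set.Iio n by
    ext a; simp only [Set.mem_Icc, Set.mem_union, Set.mem_Iio]; omega, himg] at hp
  refine hG (hp.isHamiltonian hzk hzn fun he => ?_)
  have := hinj (show k < n by omega) (show n - 1 < n by omega) he
  omega

theorem not_adj_of_adj_left_of_not_isHamiltonian (hG : ¬ G.IsHamiltonian)
    (hinj : Set.InjOn f (Set.Iio n)) (himg : f '' Set.Iio n = {z}ᶜ)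
    (hadj : ∀ i, i + 1 < n → G.Adj (f i) (f (i + 1))) (hk : k + 1 < n)
    (hzk : G.Adj z (f k)) (hzn : G.Adj z (f (n - 1))) {j : ℕ} (hj : j + 1 ≤ k)
    (h : G.Adj (f 0) (f (j + 1))) : ¬ G.Adj (f (k + 1)) (f j) := by
  intro h'
  have hp := ((HasPathOn.image_Icc hinj hadj hj (by omega)).symm.join h.symm
    (HasPathOn.image_Icc hinj hadj (Nat.zero_le j) (by omega)) (by
      rintro _ ⟨a, ha, rfl⟩ ⟨b, hb, hab⟩
      simp only [Set.mem_Icc] at ha hb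
      have := hinj (show b < n by omega) (show a < n by omega) hab
      omega)).join h'.symm
    (HasPathOn.image_Icc hinj hadj (show k + 1 ≤ n - 1 by omega) (by omega)) (by
      rw [← Set.image_union]
      rintro _ ⟨a, ha, rfl⟩ ⟨b, hb, hab⟩
      simp only [Set.mem_Icc, Set.mem_union] at ha hb
      have := hinj (show b < n by omega) (show a < n by omega) hab
      omega)
  rw [← Set.image_union, ← Set.image_union,
    show Set.Icc (j + 1) k ∪ Set.Icc 0 j ∪ Set.Icc (k + 1) (n - 1) = Set.Iio n by
      ext a; simp only [Set.mem_Icc, Set.mem_union, Set.mem_Iio]; omega, himg] at hp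
  refine hG (hp.isHamiltonian hzk hzn fun he => ?_)
  have := hinj (show k < n by omega) (show n - 1 < n by omega) he
  omega

theorem not_adj_of_adj_right_of_not_isHamiltonian (hG : ¬ G.IsHamiltonian)
    (hinj : Set.InjOn f (Set.Iio n)) (himg : f '' Set.Iio n = {z}ᶜ)
    (hadj : ∀ i, i + 1 < n → G.Adj (f i) (f (i + 1)))
    (hzk : G.Adj z (f k)) (hzn : G.Adj z (f (n - 1))) {j : ℕ} (hj : k + 1 ≤ j) (hjn : j + 1 < n)
    (h : G.Adj (f 0) (f j)) : ¬ G.Adj (f (k + 1)) (f (j + 1)) := by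
  intro h'
  have hp := ((HasPathOn.image_Icc hinj hadj (Nat.zero_le k) (by omega)).symm.join h
    (HasPathOn.image_Icc hinj hadj hj (by omega)).symm (by
      rintro _ ⟨a, ha, rfl⟩ ⟨b, hb, hab⟩
      simp only [Set.mem_Icc] at ha hb
      have := hinj (show b < n by omega) (show a < n by omega) hab
      omega)).join h'
    (HasPathOn.image_Icc hinj hadj (show j + 1 ≤ n - 1 by omega) (by omega)) (by
      rw [← Set.image_union]
      rintro _ ⟨a, ha, rfl⟩ ⟨b, hb, hab⟩
      simp only [Set.mem_Icc, Set.mem_union] at ha hb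
      have := hinj (show b < n by omega) (show a < n by omega) hab
      omega)
  rw [← Set.image_union, ← Set.image_union,
    show Set.Icc 0 k ∪ Set.Icc (k + 1) j ∪ Set.Icc (j + 1) (n - 1) = Set.Iio n by
      ext a; simp only [Set.mem_Icc, Set.mem_union, Set.mem_Iio]; omega, himg] at hp
  refine hG (hp.isHamiltonian hzk hzn fun he => ?_)
  have := hinj (show k < n by omega) (show n - 1 < n by omega) he
  omega

end Rotations

end SimpleGraph

theorem cycNext_apply {V : Type*} [DecidableEq V] {z : V} {m : ℕ}
    (c : ZMod m ≃ {u : V // u ≠ z}) (i : ZMod m) : cycNext c (c i).1 = (c (i + 1)).1 := by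
  simp [cycNext, (c i).2]

theorem cycPrev_apply {V : Type*} [DecidableEq V] {z : V} {m : ℕ}
    (c : ZMod m ≃ {u : V // u ≠ z}) (i : ZMod m) : cycPrev c (c i).1 = (c (i - 1)).1 := by
  simp [cycPrev, (c i).2]

theorem mem_cycArc_apply {V : Type*} {z : V} {m : ℕ} (c : ZMod m ≃ {u : V // u ≠ z})
    (i a b : ZMod m) : (c i).1 ∈ cycArc c (c a).1 (c b).1 ↔ (i - a).val ≤ (b - a).val := by
  simp [cycArc, (c i).2, (c a).2, (c b).2]

theorem exists_eq_of_mem_cycArc {V : Type*} {z : V} {m : ℕ} [NeZero m]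
    {c : ZMod m ≃ {u : V // u ≠ z}} {u v w : V} (h : w ∈ cycArc c u v) (a : ZMod m) :
    ∃ j < m, w = (c (a + (j : ℕ))).1 := by
  obtain ⟨-, -, hw, -⟩ := h
  exact ⟨(c.symm ⟨w, hw⟩ - a).val, ZMod.val_lt _, by simp⟩

theorem ZMod.eq_zero_or_le_of_val_sub_le {m j k : ℕ} (hk : k < m)
    (h : ((j : ZMod m) - k).val ≤ (-(k : ZMod m)).val) : j = 0 ∨ k ≤ j := by
  by_contra! hc
  have h1 : ((j : ZMod m) - k) = ((m + j - k : ℕ) : ZMod m) := by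
    rw [Nat.cast_sub (by omega)]; simp
  have h2 : (-(k : ZMod m)) = ((m - k : ℕ) : ZMod m) := by
    rw [Nat.cast_sub (by omega)]; simp
  rw [h1, h2, ZMod.val_natCast_of_lt (by omega), ZMod.val_natCast_of_lt (by omega)] at h
  omega

/-- Let `G` be non-Hamiltonian, `z` a vertex with `G − z` having an oriented
Hamilton cycle (encoded by `c`), and `x, y` distinct neighbors of `z`.  With
`X = N(x⁺)`, `Y₁ = (N(y⁺) ∩ V⁺_{y⁺x})⁻`, `Y₂ = (N(y⁺) ∩ V⁻_{y⁺x})⁺` and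
`Y = Y₁ ∪ Y₂`, we have `X ∩ Y = ∅`. -/
theorem X_inter_Y_empty
    {V : Type*} [Fintype V] [DecidableEq V] (G : SimpleGraph V)
    (hnotham : ¬ G.IsHamiltonian)
    (z : V) (m : ℕ) (hm : 3 ≤ m) (c : ZMod m ≃ {u : V // u ≠ z})
    (hC : ∀ i : ZMod m, G.Adj (c i).1 (c (i + 1)).1)
    (x y : V) (hx : G.Adj z x) (hy : G.Adj z y) (hne : x ≠ y) :
    G.neighborSet (cycNext c x) ∩
      ((cycPrev c '' (G.neighborSet (cycNext c y) ∩ cycArc c (cycNext c y) x)) ∪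
       (cycNext c '' (G.neighborSet (cycNext c y) ∩ cycArc c x (cycNext c y)))) = ∅ := by
  have : NeZero m := ⟨by omega⟩
  obtain ⟨b, hb⟩ : ∃ b, y = (c b).1 := ⟨c.symm ⟨y, hy.ne'⟩, by simp⟩
  obtain ⟨a, rfl⟩ : ∃ a, b = a - 1 := ⟨b + 1, by ring⟩
  set f : ℕ → V := fun i => (c (a + i)).1 with hf
  have hinj : Set.InjOn f (Set.Iio m) := by
    intro i hi j hj hij
    have h : (i : ZMod m) = j := add_left_cancel (c.injective (Subtype.ext hij))
    have h' := congrArg ZMod.val h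
    rwa [ZMod.val_natCast_of_lt hi, ZMod.val_natCast_of_lt hj] at h'
  have himg : f '' Set.Iio m = {z}ᶜ := by
    ext w
    refine ⟨?_, fun hw => ⟨(c.symm ⟨w, hw⟩ - a).val, ZMod.val_lt _, by simp [hf]⟩⟩
    rintro ⟨i, -, rfl⟩
    exact (c _).2
  have hadj : ∀ i, G.Adj (f i) (f (i + 1)) := fun i => by
    simpa [hf, add_assoc] using hC (a + i)
  have hyf : y = f (m - 1) := by
    rw [hb]
    simp only [hf, Nat.cast_sub (show 1 ≤ m by omega)]
    simp [sub_eq_add_neg]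
  have hysucc : cycNext c y = f 0 := by simp [hb, cycNext_apply, hf]
  have hnext : ∀ i, cycNext c (f i) = f (i + 1) := fun i => by
    simp [hf, cycNext_apply, add_assoc]
  have hprev : ∀ i, cycPrev c (f (i + 1)) = f i := fun i => by
    simp [hf, cycPrev_apply, ← add_assoc]
  obtain ⟨k, hkm, rfl⟩ : ∃ k < m, f k = x := by
    have : x ∈ f '' Set.Iio m := himg ▸ hx.ne'
    exact this
  have hk : k + 1 < m := by
    have : k ≠ m - 1 := by rintro rfl; exact hne hyf.symm
    omega
  rw [hyf] at hy
  rw [hysucc, hnext, Set.eq_empty_iff_forall_notMem]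
  rintro v ⟨hv, ⟨w, ⟨hw, harc⟩, rfl⟩ | ⟨w, ⟨hw, harc⟩, rfl⟩⟩ <;>
    rw [SimpleGraph.mem_neighborSet] at hv hw <;>
    obtain ⟨j, hj, rfl⟩ := exists_eq_of_mem_cycArc harc a <;>
    rw [mem_cycArc_apply] at harc
  · change G.Adj _ (f j) at hw
    change G.Adj _ (cycPrev c (f j)) at hv
    have hjk : j ≤ k := by
      simpa [ZMod.val_natCast_of_lt hj, ZMod.val_natCast_of_lt hkm] using harc
    obtain _ | i := j
    · exact hw.ne rfl
    · rw [hprev] at hv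
      exact SimpleGraph.not_adj_of_adj_left_of_not_isHamiltonian hnotham hinj himg
        (fun i _ => hadj i) hk hx hy hjk hw hv
  · change G.Adj _ (f j) at hw
    change G.Adj _ (cycNext c (f j)) at hv
    rw [hnext] at hv
    obtain rfl | hjk := ZMod.eq_zero_or_le_of_val_sub_le hkm (by simpa using harc)
    · exact hw.ne rfl
    obtain rfl | hjk := hjk.eq_or_lt
    · exact hv.ne rfl
    by_cases hjm : j + 1 < m
    · exact SimpleGraph.not_adj_of_adj_right_of_not_isHamiltonian hnotham hinj himg
        (fun i _ => hadj i) hx hy hjk hjm hw hv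
    · have hlast : f (j + 1) = f 0 := by
        simp only [hf, show j + 1 = m by omega, CharP.cast_eq_zero, Nat.cast_zero]
      rw [hlast] at hv
      exact SimpleGraph.not_adj_succ_of_not_isHamiltonian_s16 hnotham hinj himg
        (fun i _ => hadj i) hk hx hy hv.symm
end
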